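/- arXiv:1805.06535 — 3 statements merged into one kernel-verified Lean document; each statement's English description precedes it below -/
import Mathlib

section
/- Let β > 0, 0 < a, 0 < σ, δ > 0, b > 0 with a + σ < b − 2δ, and let c₀ > 0. Let W : (0,b) → ℝ satisfy W(x) = 0 for 0 < x ≤ a, W(x) = (x−a)^β for a < x < a+σ, and W bounded measurable with W(x) ≥ c₀ for a+σ ≤ x < b. Let φ : [0,∞) → ℝ be smooth with φ(x) = 1 for x ≤ b−2δ and φ(x) = 0 for x ≥ b−δ. Fix M > 0 and K > 0. Then there exist h₀ > 0 and C'' > 0 such that: for all h ∈ (0, h₀), all l ∈ ℝ with |l| ≤ M, all C ∈ ℂ with |C| ≤ K, and every v : [0,∞) → ℂ which is continuously differentiable with v, v' square-integrable on (0,∞), twice differentiable on (0,a) ∪ (a,∞), satisfies v(0) = 0 or v'(0) = 0, and solves −h² v''(x) + i (x−a)₊^β v(x) − λ² v(x) = 0 on (0,a) ∪ (a,∞) with λ = π l h / a + C·h^{(β+4)/(β+2)}, the function u := φ·v satisfies, with q = 1/h² + λ²/2, the estimate ∫₀^b |−u''(x) + i q W(x) u(x) + (1/h⁴ − q²) u(x)|²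 dx ≤ (C''/(Re q)²) · ∫₀^b |u(x)|² dx. -/
open MeasureTheory Set

/-- The sum of the real and imaginary parts of `-v₁ v̄`, a decaying flux for solutions of
`v'' = μ v` when `Re μ + Im μ` is positive. -/
noncomputable def flux (v v₁ : ℝ → ℂ) (x : ℝ) : ℝ :=
  -((v₁ x * star (v x)).re + (v₁ x * star (v x)).im)

theorem hasDerivAt_flux {v v₁ : ℝ → ℂ} {m : ℂ} {x : ℝ} (hv : HasDerivAt v (v₁ x) x)
    (hv₁ : HasDerivAt v₁ (m * v x) x) :
    HasDerivAt (flux v v₁) (-(‖v₁ x‖ ^ 2 + (m.re + m.im) * ‖v x‖ ^ 2)) x := by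
  have hz := hv₁.mul hv.star
  have hre := Complex.reCLM.hasFDerivAt.comp_hasDerivAt x hz
  have him := Complex.imCLM.hasFDerivAt.comp_hasDerivAt x hz
  refine (hre.add him).neg.congr_deriv ?_
  simp only [Complex.reCLM_apply, Complex.imCLM_apply, Complex.sq_norm, Complex.normSq_apply,
    Complex.star_def, Complex.add_re, Complex.add_im, Complex.mul_re, Complex.mul_im,
    Complex.conj_re, Complex.conj_im]
  ring

theorem two_mul_flux_le (v v₁ : ℝ → ℂ) (x t : ℝ) :
    2 * t * flux v v₁ x ≤ 2 * ‖v x‖ ^ 2 + t ^ 2 * ‖v₁ x‖ ^ 2 := by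
  simp only [flux, Complex.sq_norm, Complex.normSq_apply, Complex.star_def, Complex.mul_re,
    Complex.mul_im, Complex.conj_re, Complex.conj_im]
  nlinarith [sq_nonneg (t * (v₁ x).re + ((v x).re - (v x).im)),
    sq_nonneg (t * (v₁ x).im + ((v x).re + (v x).im))]

theorem neg_two_mul_flux_le (v v₁ : ℝ → ℂ) (x : ℝ) :
    -2 * flux v v₁ x ≤ 2 * ‖v x‖ ^ 2 + ‖v₁ x‖ ^ 2 := by
  simpa using two_mul_flux_le v v₁ x (-1)

section Solution

variable {v v₁ : ℝ → ℂ} {μ : ℝ → ℂ} {κ y : ℝ}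

theorem integral_energy_le_flux_sub (hv : ∀ x ∈ Ici y, HasDerivAt v (v₁ x) x)
    (hv₁ : ∀ x ∈ Ici y, HasDerivAt v₁ (μ x * v x) x)
    (hμ : ∀ x ∈ Ici y, κ ≤ (μ x).re + (μ x).im) {y₀ y₁ : ℝ} (hy₀ : y ≤ y₀) (hy : y₀ ≤ y₁) :
    ∫ x in y₀..y₁, (‖v₁ x‖ ^ 2 + κ * ‖v x‖ ^ 2) ≤ flux v v₁ y₀ - flux v v₁ y₁ := by
  have hmem : ∀ x ∈ Icc y₀ y₁, x ∈ Ici y := fun x hx => hy₀.trans hx.1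
  have hd : ∀ x ∈ Icc y₀ y₁, HasDerivAt (fun x => -flux v v₁ x)
      (- -(‖v₁ x‖ ^ 2 + ((μ x).re + (μ x).im) * ‖v x‖ ^ 2)) x := fun x hx =>
    (hasDerivAt_flux (hv x (hmem x hx)) (hv₁ x (hmem x hx))).neg
  have hcv : ContinuousOn v (Icc y₀ y₁) := fun x hx =>
    (hv x (hmem x hx)).continuousAt.continuousWithinAt
  have hcv₁ : ContinuousOn v₁ (Icc y₀ y₁) := fun x hx =>
    (hv₁ x (hmem x hx)).continuousAt.continuousWithinAt
  have := intervalIntegral.integral_le_sub_of_hasDeriv_right_of_le hy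
    (fun x hx => (hd x hx).continuousAt.continuousWithinAt)
    (fun x hx => (hd x (Ioo_subset_Icc_self hx)).hasDerivWithinAt)
    (φ := fun x => ‖v₁ x‖ ^ 2 + κ * ‖v x‖ ^ 2)
    (ContinuousOn.integrableOn_Icc (by fun_prop))
    (fun x hx => by
      have := mul_le_mul_of_nonneg_right (hμ x (hmem x (Ioo_subset_Icc_self hx)))
        (sq_nonneg ‖v x‖)
      simp only [neg_neg]
      linarith)
  linarith

theorem flux_nonneg (hκ : 0 ≤ κ) (hv : ∀ x ∈ Ici y, HasDerivAt v (v₁ x) x)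
    (hv₁ : ∀ x ∈ Ici y, HasDerivAt v₁ (μ x * v x) x)
    (hμ : ∀ x ∈ Ici y, κ ≤ (μ x).re + (μ x).im)
    (hi : IntegrableOn (fun x => ‖v x‖ ^ 2) (Ioi y))
    (hi₁ : IntegrableOn (fun x => ‖v₁ x‖ ^ 2) (Ioi y)) {y₀ : ℝ} (hy₀ : y ≤ y₀) :
    0 ≤ flux v v₁ y₀ := by
  by_contra! hneg
  have hle : ∀ x ∈ Ioi y₀, flux v v₁ x ≤ flux v v₁ y₀ := fun x hx => by
    have h1 := integral_energy_le_flux_sub hv hv₁ hμ hy₀ (le_of_lt hx)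
    have h2 : 0 ≤ ∫ x in y₀..x, (‖v₁ x‖ ^ 2 + κ * ‖v x‖ ^ 2) :=
      intervalIntegral.integral_nonneg (le_of_lt hx) fun x _ => by positivity
    linarith
  have hint : IntegrableOn (fun x => 2 * ‖v x‖ ^ 2 + ‖v₁ x‖ ^ 2) (Ioi y₀) :=
    IntegrableOn.mono_set ((hi.const_mul 2).add hi₁) (Ioi_subset_Ioi hy₀)
  have hconst : IntegrableOn (fun _ : ℝ => -2 * flux v v₁ y₀) (Ioi y₀) := by
    refine Integrable.mono' hint aestronglyMeasurable_const ?_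
    filter_upwards [self_mem_ae_restrict measurableSet_Ioi] with x hx
    rw [Real.norm_of_nonneg (by linarith)]
    linarith [hle x hx, neg_two_mul_flux_le v v₁ x]
  rw [integrableOn_const_iff] at hconst
  rcases hconst with h | h
  · exact hneg.ne (by simpa using h)
  · simp at h

theorem sq_mul_flux_le_integral (hκ : 0 ≤ κ) (hv : ∀ x ∈ Ici y, HasDerivAt v (v₁ x) x)
    (hv₁ : ∀ x ∈ Ici y, HasDerivAt v₁ (μ x * v x) x)
    (hμ : ∀ x ∈ Ici y, κ ≤ (μ x).re + (μ x).im) {y₀ y₁ : ℝ} (hy₀ : y ≤ y₀) (hy : y₀ ≤ y₁) :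
    (y₁ - y₀) ^ 2 * flux v v₁ y₁ ≤ 2 * ∫ x in y₀..y₁, ‖v x‖ ^ 2 := by
  have hmem : ∀ x ∈ Icc y₀ y₁, x ∈ Ici y := fun x hx => hy₀.trans hx.1
  have hd : ∀ x ∈ Icc y₀ y₁, HasDerivAt (fun x => (x - y₀) ^ 2 * flux v v₁ x)
      (2 * (x - y₀) * flux v v₁ x
        + (x - y₀) ^ 2 * -(‖v₁ x‖ ^ 2 + ((μ x).re + (μ x).im) * ‖v x‖ ^ 2)) x := fun x hx => by
    refine ((((hasDerivAt_id x).sub_const y₀).pow 2).mul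
      (hasDerivAt_flux (hv x (hmem x hx)) (hv₁ x (hmem x hx)))).congr_deriv ?_
    simp
  have hcv : ContinuousOn v (Icc y₀ y₁) := fun x hx =>
    (hv x (hmem x hx)).continuousAt.continuousWithinAt
  have := intervalIntegral.sub_le_integral_of_hasDeriv_right_of_le hy
    (fun x hx => (hd x hx).continuousAt.continuousWithinAt)
    (fun x hx => (hd x (Ioo_subset_Icc_self hx)).hasDerivWithinAt)
    (φ := fun x => 2 * ‖v x‖ ^ 2)
    (ContinuousOn.integrableOn_Icc (by fun_prop))
    (fun x hx => by
      have h1 := hκ.trans (hμ x (hmem x (Ioo_subset_Icc_self hx)))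
      have h2 := two_mul_flux_le v v₁ x (x - y₀)
      have h3 : 0 ≤ (x - y₀) ^ 2 * (((μ x).re + (μ x).im) * ‖v x‖ ^ 2) := by positivity
      linarith)
  simpa using this

theorem flux_le_mul_flux (hκ : 0 < κ) (hv : ∀ x ∈ Ici y, HasDerivAt v (v₁ x) x)
    (hv₁ : ∀ x ∈ Ici y, HasDerivAt v₁ (μ x * v x) x)
    (hμ : ∀ x ∈ Ici y, κ ≤ (μ x).re + (μ x).im)
    (hi : IntegrableOn (fun x => ‖v x‖ ^ 2) (Ioi y))
    (hi₁ : IntegrableOn (fun x => ‖v₁ x‖ ^ 2) (Ioi y)) {y₀ d : ℝ} (hy₀ : y ≤ y₀) (hd : 0 < d) :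
    flux v v₁ (y₀ + d) ≤ 2 / (d ^ 2 * κ) * flux v v₁ y₀ := by
  have hy : y₀ ≤ y₀ + d := by linarith
  have h1 := sq_mul_flux_le_integral hκ.le hv hv₁ hμ hy₀ hy
  have h2 := integral_energy_le_flux_sub hv hv₁ hμ hy₀ hy
  have h3 := flux_nonneg hκ.le hv hv₁ hμ hi hi₁ (hy₀.trans hy)
  have hcv : ContinuousOn v (uIcc y₀ (y₀ + d)) := fun x hx =>
    (hv x (hy₀.trans (uIcc_of_le hy ▸ hx).1)).continuousAt.continuousWithinAt
  have hcv₁ : ContinuousOn v₁ (uIcc y₀ (y₀ + d)) := fun x hx =>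
    (hv₁ x (hy₀.trans (uIcc_of_le hy ▸ hx).1)).continuousAt.continuousWithinAt
  have h4 : κ * ∫ x in y₀..(y₀ + d), ‖v x‖ ^ 2
      ≤ ∫ x in y₀..(y₀ + d), (‖v₁ x‖ ^ 2 + κ * ‖v x‖ ^ 2) := by
    rw [← intervalIntegral.integral_const_mul]
    refine intervalIntegral.integral_mono_on hy
      (ContinuousOn.intervalIntegrable (by fun_prop))
      (ContinuousOn.intervalIntegrable (by fun_prop)) fun x _ => ?_
    linarith [sq_nonneg ‖v₁ x‖]
  rw [add_sub_cancel_left] at h1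
  have h5 := mul_le_mul_of_nonneg_left h1 hκ.le
  rw [div_mul_eq_mul_div, le_div_iff₀ (by positivity)]
  linarith

/-- Caccioppoli estimates on four consecutive intervals of length `d` bound the energy of a
square-integrable solution beyond these intervals by its mass on the first of them. -/
theorem integral_energy_le_integral (hκ : 0 < κ) (hv : ∀ x ∈ Ici y, HasDerivAt v (v₁ x) x)
    (hv₁ : ∀ x ∈ Ici y, HasDerivAt v₁ (μ x * v x) x)
    (hμ : ∀ x ∈ Ici y, κ ≤ (μ x).re + (μ x).im)
    (hi : IntegrableOn (fun x => ‖v x‖ ^ 2) (Ioi y))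
    (hi₁ : IntegrableOn (fun x => ‖v₁ x‖ ^ 2) (Ioi y)) {d z : ℝ} (hd : 0 < d)
    (hz : y + 4 * d ≤ z) :
    ∫ x in (y + 4 * d)..z, (‖v₁ x‖ ^ 2 + κ * ‖v x‖ ^ 2)
      ≤ (2 / (d ^ 2 * κ)) ^ 3 * (2 / d ^ 2) * ∫ x in y..(y + d), ‖v x‖ ^ 2 := by
  have step := fun {y₀ : ℝ} (hy₀ : y ≤ y₀) => flux_le_mul_flux hκ hv hv₁ hμ hi hi₁ hy₀ hd
  have h0 : flux v v₁ (y + d) ≤ 2 / d ^ 2 * ∫ x in y..(y + d), ‖v x‖ ^ 2 := by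
    have := sq_mul_flux_le_integral hκ.le hv hv₁ hμ le_rfl (by linarith : y ≤ y + d)
    rw [div_mul_eq_mul_div, le_div_iff₀ (by positivity)]
    rw [add_sub_cancel_left] at this
    linarith
  have h1 := step (y₀ := y + d) (by linarith)
  have h2 := step (y₀ := y + d + d) (by linarith)
  have h3 := step (y₀ := y + d + d + d) (by linarith)
  rw [show y + d + d + d + d = y + 4 * d by ring] at h3
  have h4 := integral_energy_le_flux_sub hv hv₁ hμ (by linarith : y ≤ y + 4 * d) hz
  have h5 := flux_nonneg hκ.le hv hv₁ hμ hi hi₁ (by linarith : y ≤ z)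
  have hr : 0 ≤ 2 / (d ^ 2 * κ) := by positivity
  calc _ ≤ flux v v₁ (y + 4 * d) := by linarith
    _ ≤ 2 / (d ^ 2 * κ) * (2 / (d ^ 2 * κ) * (2 / (d ^ 2 * κ)
          * (2 / d ^ 2 * ∫ x in y..(y + d), ‖v x‖ ^ 2))) := by
        refine h3.trans (mul_le_mul_of_nonneg_left (h2.trans
          (mul_le_mul_of_nonneg_left (h1.trans (mul_le_mul_of_nonneg_left h0 hr)) hr)) hr)
    _ = _ := by ring

end Solution

theorem residual_eq {h q lam v v₁ v₂ p p₁ p₂ w V : ℂ} (hh : h ≠ 0)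
    (hq : q = 1 / h ^ 2 + lam ^ 2 / 2)
    (heq : -h ^ 2 * v₂ + Complex.I * V * v - lam ^ 2 * v = 0) :
    -(p₂ * v + 2 * p₁ * v₁ + p * v₂) + Complex.I * q * w * (p * v)
        + (1 / h ^ 4 - q ^ 2) * (p * v)
      = -(p₂ * v + 2 * p₁ * v₁) + Complex.I / h ^ 2 * (w - V) * (p * v)
        + (Complex.I * lam ^ 2 / 2 * w - lam ^ 4 / 4) * (p * v) := by
  have hv₂ : v₂ = (Complex.I * V * v - lam ^ 2 * v) / h ^ 2 := by
    rw [eq_div_iff (pow_ne_zero 2 hh)]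
    linear_combination -heq
  rw [hv₂, hq]
  field_simp
  ring

theorem norm_damping_error_le {lam : ℂ} {w L h B : ℝ} (hh : 0 ≤ h) (hh₁ : h ≤ 1)
    (hlam : ‖lam‖ ≤ L * h) (hw : |w| ≤ B) :
    ‖Complex.I * lam ^ 2 / 2 * (w : ℂ) - lam ^ 4 / 4‖ ≤ (L ^ 2 * B + L ^ 4) * h ^ 2 := by
  have h2 : ‖lam‖ ^ 2 ≤ L ^ 2 * h ^ 2 := by
    rw [← mul_pow]
    exact pow_le_pow_left₀ (norm_nonneg _) hlam 2
  have h4 : ‖lam‖ ^ 4 ≤ L ^ 4 * h ^ 2 := by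
    calc ‖lam‖ ^ 4 ≤ (L * h) ^ 4 := pow_le_pow_left₀ (norm_nonneg _) hlam 4
      _ = L ^ 4 * h ^ 4 := mul_pow _ _ _
      _ ≤ L ^ 4 * h ^ 2 := mul_le_mul_of_nonneg_left
          (pow_le_pow_of_le_one hh hh₁ (by norm_num)) (by positivity)
  have h5 : ‖lam‖ ^ 2 * |w| ≤ L ^ 2 * h ^ 2 * B :=
    mul_le_mul h2 hw (abs_nonneg _) (by positivity)
  have h6 : 0 ≤ ‖lam‖ ^ 2 * |w| := by positivity
  have h7 : 0 ≤ ‖lam‖ ^ 4 := by positivity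
  refine (norm_sub_le _ _).trans ?_
  simp only [norm_mul, norm_div, norm_pow, Complex.norm_I, Complex.norm_real, Real.norm_eq_abs,
    Complex.norm_ofNat, one_mul]
  linarith

theorem norm_lam_le {lam C : ℂ} {a β l h M K : ℝ} (hβ : 0 < β) (ha : 0 < a) (hh : 0 < h)
    (hh₁ : h ≤ 1) (hl : |l| ≤ M) (hC : ‖C‖ ≤ K)
    (hlam : lam = ((Real.pi * l * h / a : ℝ) : ℂ)
      + C * ((h ^ ((β + 4) / (β + 2)) : ℝ) : ℂ)) :
    ‖lam‖ ≤ (Real.pi * M / a + K) * h := by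
  have hpow : h ^ ((β + 4) / (β + 2)) ≤ h := by
    calc h ^ ((β + 4) / (β + 2)) ≤ h ^ (1 : ℝ) :=
          Real.rpow_le_rpow_of_exponent_ge hh hh₁ (by rw [le_div_iff₀] <;> linarith)
      _ = h := Real.rpow_one h
  have h1 : |Real.pi * l * h / a| ≤ Real.pi * M / a * h := by
    rw [abs_div, abs_mul, abs_mul, abs_of_pos Real.pi_pos, abs_of_pos hh, abs_of_pos ha,
      div_mul_eq_mul_div]
    gcongr
  have h2 : ‖C‖ * h ^ ((β + 4) / (β + 2)) ≤ K * h :=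
    mul_le_mul hC hpow (by positivity) ((norm_nonneg _).trans hC)
  rw [hlam]
  refine (norm_add_le _ _).trans ?_
  rw [norm_mul, Complex.norm_real, Complex.norm_real, Real.norm_eq_abs, Real.norm_eq_abs,
    abs_of_pos (Real.rpow_pos_of_pos hh _)]
  linarith

theorem sq_norm_far_le {h c B : ℝ} {f v v₁ : ℂ} (hh : 0 < h) (hh₁ : h ≤ 1)
    (hc : 0 < c) (hf : ‖f‖ ≤ B * (‖v₁‖ + ‖v‖ / h ^ 2)) :
    ‖f‖ ^ 2 ≤ 2 * B ^ 2 * (1 + 1 / c) / h ^ 2 * (‖v₁‖ ^ 2 + c / h ^ 2 * ‖v‖ ^ 2) := by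
  have h1 : ‖v₁‖ ^ 2 ≤ ‖v₁‖ ^ 2 / h ^ 2 :=
    le_div_self (by positivity) (by positivity) (pow_le_one₀ hh.le hh₁)
  calc ‖f‖ ^ 2 ≤ (B * (‖v₁‖ + ‖v‖ / h ^ 2)) ^ 2 := pow_le_pow_left₀ (norm_nonneg _) hf 2
    _ = B ^ 2 * (‖v₁‖ + ‖v‖ / h ^ 2) ^ 2 := mul_pow _ _ _
    _ ≤ B ^ 2 * (2 * (‖v₁‖ ^ 2 + (‖v‖ / h ^ 2) ^ 2)) :=
        mul_le_mul_of_nonneg_left add_sq_le (sq_nonneg _)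
    _ ≤ B ^ 2 * (2 * (‖v₁‖ ^ 2 / h ^ 2 + (‖v‖ / h ^ 2) ^ 2
          + (‖v₁‖ ^ 2 / h ^ 2 / c + c / h ^ 2 * ‖v‖ ^ 2 / h ^ 2))) := by
        have : 0 ≤ ‖v₁‖ ^ 2 / h ^ 2 / c + c / h ^ 2 * ‖v‖ ^ 2 / h ^ 2 := by positivity
        refine mul_le_mul_of_nonneg_left ?_ (sq_nonneg _)
        linarith
    _ = _ := by
        field_simp
        ring

theorem re_add_im_sq_le {z : ℂ} {r : ℝ} (hz : ‖z‖ ≤ r) :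
    (z ^ 2).re + (z ^ 2).im ≤ 2 * r ^ 2 := by
  have h1 := (Complex.re_le_norm (z ^ 2)).trans_eq (norm_pow z 2)
  have h2 := (Complex.im_le_norm (z ^ 2)).trans_eq (norm_pow z 2)
  have h3 := pow_le_pow_left₀ (norm_nonneg _) hz 2
  linarith

theorem exists_cutoff_bound {φ : ℝ → ℝ} (hφ : ContDiff ℝ (⊤ : ℕ∞) φ) (b : ℝ) :
    ∃ Φ : ℝ, 0 ≤ Φ ∧ ∀ x ∈ Icc 0 b,
      |φ x| ≤ Φ ∧ |deriv φ x| ≤ Φ ∧ |deriv (deriv φ) x| ≤ Φ := by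
  have hφ' : ContDiff ℝ (⊤ : ℕ∞) (deriv φ) := hφ.iterate_deriv 1
  have hφ'' : ContDiff ℝ (⊤ : ℕ∞) (deriv (deriv φ)) := hφ.iterate_deriv 2
  obtain ⟨B₀, hB₀⟩ := isCompact_Icc.exists_bound_of_continuousOn
    (s := Icc 0 b) hφ.continuous.continuousOn
  obtain ⟨B₁, hB₁⟩ := isCompact_Icc.exists_bound_of_continuousOn
    (s := Icc 0 b) hφ'.continuous.continuousOn
  obtain ⟨B₂, hB₂⟩ := isCompact_Icc.exists_bound_of_continuousOn
    (s := Icc 0 b) hφ''.continuous.continuousOn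
  refine ⟨max 0 (max B₀ (max B₁ B₂)), le_max_left _ _, fun x hx => ⟨?_, ?_, ?_⟩⟩
  · exact (hB₀ x hx).trans (by simp)
  · exact (hB₁ x hx).trans (by simp)
  · exact (hB₂ x hx).trans (by simp)

theorem deriv_eq_zero_of_eq_one {φ : ℝ → ℝ} {s x : ℝ} (hφ : ∀ x ≤ s, φ x = 1) (hx : x < s) :
    deriv φ x = 0 ∧ deriv (deriv φ) x = 0 := by
  have h1 : ∀ y < s, deriv φ y = 0 := fun y hy => by
    have : φ =ᶠ[nhds y] fun _ => 1 := by
      filter_upwards [Iio_mem_nhds hy] with z hz using hφ z (le_of_lt hz)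
    rw [this.deriv_eq, deriv_const]
  have : deriv φ =ᶠ[nhds x] fun _ => 0 := by
    filter_upwards [Iio_mem_nhds hx] with z hz using h1 z hz
  exact ⟨h1 x hx, by rw [this.deriv_eq, deriv_const]⟩

/-- A square integral is controlled by a bound with an extra term beyond `s`, when the energy
beyond `s` is controlled by the mass on an earlier interval. -/
theorem integral_sq_norm_le {b s y y₁ A B κ R : ℝ} {F u v v₁ : ℝ → ℂ}
    (hy : 0 ≤ y) (hy₁ : y ≤ y₁) (hy₁b : y₁ ≤ b) (hs : 0 ≤ s) (hsb : s ≤ b)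
    (hB : 0 ≤ B) (hR : 0 ≤ R)
    (hu : ContinuousOn u (Icc 0 b)) (hv : ContinuousOn v (Icc 0 b))
    (hv₁ : ContinuousOn v₁ (Icc 0 b))
    (huv : ∀ x ∈ Icc y y₁, u x = v x)
    (hF : ∀ᵐ x, x ∈ Ioo 0 b → ‖F x‖ ^ 2 ≤ A * ‖u x‖ ^ 2
      + (Ici s).indicator (fun x => B * (‖v₁ x‖ ^ 2 + κ * ‖v x‖ ^ 2)) x)
    (hE : ∫ x in s..b, (‖v₁ x‖ ^ 2 + κ * ‖v x‖ ^ 2) ≤ R * ∫ x in y..y₁, ‖v x‖ ^ 2) :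
    ∫ x in Ioo 0 b, ‖F x‖ ^ 2 ≤ (A + B * R) * ∫ x in Ioo 0 b, ‖u x‖ ^ 2 := by
  have hiu : IntegrableOn (fun x => ‖u x‖ ^ 2) (Ioo 0 b) :=
    (ContinuousOn.integrableOn_Icc (by fun_prop)).mono_set Ioo_subset_Icc_self
  have hiE : IntegrableOn (fun x => B * (‖v₁ x‖ ^ 2 + κ * ‖v x‖ ^ 2)) (Ioo 0 b) :=
    (ContinuousOn.integrableOn_Icc (by fun_prop)).mono_set Ioo_subset_Icc_self
  have hiI := hiE.indicator (measurableSet_Ici (a := s))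
  have h1 : ∫ x in Ioo 0 b, ‖F x‖ ^ 2 ≤ ∫ x in Ioo 0 b, (A * ‖u x‖ ^ 2
      + (Ici s).indicator (fun x => B * (‖v₁ x‖ ^ 2 + κ * ‖v x‖ ^ 2)) x) := by
    refine integral_mono_of_nonneg (Filter.Eventually.of_forall fun x => sq_nonneg _)
      ((hiu.const_mul A).add hiI) ?_
    exact (ae_restrict_iff' measurableSet_Ioo).2 hF
  have h2 : ∫ x in Ioo 0 b, (Ici s).indicator
      (fun x => B * (‖v₁ x‖ ^ 2 + κ * ‖v x‖ ^ 2)) x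
      = B * ∫ x in s..b, (‖v₁ x‖ ^ 2 + κ * ‖v x‖ ^ 2) := by
    rw [setIntegral_indicator measurableSet_Ici, integral_const_mul,
      intervalIntegral.integral_of_le hsb, integral_Ioc_eq_integral_Ioo]
    congr 1
    refine setIntegral_congr_set ?_
    have : Ioo s b =ᵐ[volume] Ico s b := Ioo_ae_eq_Ico
    refine Filter.EventuallyEq.trans ?_ this.symm
    have h0 : Ioo 0 b =ᵐ[volume] Ico 0 b := Ioo_ae_eq_Ico
    refine (h0.inter (Filter.EventuallyEq.refl _ (Ici s))).trans (Filter.EventuallyEq.of_eq ?_)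
    exact Set.ext fun x =>
      ⟨fun hx => ⟨hx.2, hx.1.2⟩, fun hx => ⟨⟨hs.trans hx.1, hx.2⟩, hx.1⟩⟩
  have h3 : ∫ x in y..y₁, ‖v x‖ ^ 2 ≤ ∫ x in Ioo 0 b, ‖u x‖ ^ 2 := by
    rw [intervalIntegral.integral_of_le hy₁, integral_Ioc_eq_integral_Ioo]
    calc ∫ x in Ioo y y₁, ‖v x‖ ^ 2 = ∫ x in Ioo y y₁, ‖u x‖ ^ 2 :=
          setIntegral_congr_fun measurableSet_Ioo fun x hx => by
            simp only [huv x (Ioo_subset_Icc_self hx)]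
      _ ≤ _ := setIntegral_mono_set hiu (Filter.Eventually.of_forall fun x => sq_nonneg _)
          (Ioo_subset_Ioo hy hy₁b).eventuallyLE
  rw [integral_add (hiu.const_mul A) hiI, integral_const_mul, h2] at h1
  have h4 := mul_le_mul_of_nonneg_left (hE.trans (mul_le_mul_of_nonneg_left h3 hR)) hB
  linarith

theorem abs_sub_le_of_bounds {w x a b β Wmax : ℝ} (hw : |w| ≤ Wmax) (hx : x ≤ b) (hb : 0 ≤ b)
    (hβ : 0 ≤ β) (ha : 0 ≤ a) : |w - (max (x - a) 0) ^ β| ≤ Wmax + b ^ β := by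
  have h1 : (max (x - a) 0) ^ β ≤ b ^ β :=
    Real.rpow_le_rpow (le_max_right _ _) (max_le (by linarith) hb) hβ
  refine (abs_sub _ _).trans (add_le_add hw ?_)
  rwa [abs_of_nonneg (by positivity)]

theorem norm_residual_far_le {h Φ S D w V p p₁ p₂ : ℝ} {v v₁ e : ℂ} (hh : 0 < h) (hh₁ : h ≤ 1)
    (hΦ : 0 ≤ Φ) (hD : 0 ≤ D) (hS : 0 ≤ S) (hp : |p| ≤ Φ) (hp₁ : |p₁| ≤ Φ) (hp₂ : |p₂| ≤ Φ)
    (hwV : |w - V| ≤ S) (he : ‖e‖ ≤ D * h ^ 2) :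
    ‖-((p₂ : ℂ) * v + 2 * (p₁ : ℂ) * v₁) + Complex.I / (h : ℂ) ^ 2 * ((w : ℂ) - V) * (p * v)
        + e * (p * v)‖ ≤ (3 * Φ + S * Φ + D * Φ) * (‖v₁‖ + ‖v‖ / h ^ 2) := by
  have hv : ‖v‖ ≤ ‖v‖ / h ^ 2 :=
    le_div_self (norm_nonneg _) (by positivity) (pow_le_one₀ hh.le hh₁)
  have h1 : |p₂| * ‖v‖ ≤ Φ * (‖v‖ / h ^ 2) := by gcongr
  have h2 : |p₁| * ‖v₁‖ ≤ Φ * ‖v₁‖ := by gcongr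
  have h3 : ‖Complex.I / (h : ℂ) ^ 2 * ((w : ℂ) - V) * (p * v)‖ ≤ S * Φ * (‖v‖ / h ^ 2) := by
    rw [← Complex.ofReal_sub, norm_mul, norm_mul, norm_mul, norm_div, norm_pow, Complex.norm_I,
      Complex.norm_real, Complex.norm_real, Complex.norm_real, Real.norm_eq_abs,
      Real.norm_eq_abs, Real.norm_eq_abs, abs_of_pos hh]
    calc 1 / h ^ 2 * |w - V| * (|p| * ‖v‖) ≤ 1 / h ^ 2 * S * (Φ * ‖v‖) := by gcongr
      _ = _ := by ring
  have h4 : ‖e * (p * v)‖ ≤ D * Φ * (‖v‖ / h ^ 2) := by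
    have he' : ‖e‖ ≤ D := he.trans (mul_le_of_le_one_right hD (pow_le_one₀ hh.le hh₁))
    rw [norm_mul, norm_mul, Complex.norm_real, Real.norm_eq_abs, mul_assoc]
    gcongr
  have h5 : ‖-((p₂ : ℂ) * v + 2 * (p₁ : ℂ) * v₁)‖ ≤ |p₂| * ‖v‖ + 2 * |p₁| * ‖v₁‖ := by
    rw [norm_neg]
    refine (norm_add_le _ _).trans_eq ?_
    simp
  have h6 : 0 ≤ Φ * (‖v‖ / h ^ 2) := by positivity
  have h7 : 0 ≤ Φ * ‖v₁‖ := by positivity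
  have h8 : 0 ≤ S * Φ * ‖v₁‖ := by positivity
  have h9 : 0 ≤ D * Φ * ‖v₁‖ := by positivity
  refine (norm_add₃_le).trans ?_
  linarith

theorem inv_sq_re_ge {h L : ℝ} {lam q : ℂ} (hh : 0 < h) (hh₁ : h ≤ 1)
    (hL : 2 * (L * h) ^ 2 ≤ 1) (hlam : ‖lam‖ ≤ L * h)
    (hq : q = ((1 / h ^ 2 : ℝ) : ℂ) + lam ^ 2 / 2) : h ^ 4 / 4 ≤ (q.re ^ 2)⁻¹ := by
  have h1 : |(lam ^ 2).re| ≤ 1 / 2 := by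
    have h2 := (Complex.abs_re_le_norm (lam ^ 2)).trans_eq (norm_pow lam 2)
    have h3 := pow_le_pow_left₀ (norm_nonneg _) hlam 2
    linarith
  have hre : q.re = 1 / h ^ 2 + (lam ^ 2).re / 2 := by
    rw [hq, Complex.add_re, Complex.ofReal_re, Complex.div_ofNat_re]
  have h4 : 1 ≤ 1 / h ^ 2 := one_le_one_div (by positivity) (pow_le_one₀ hh.le hh₁)
  obtain ⟨h5, h6⟩ := abs_le.1 h1
  have h7 : 0 < q.re := by linarith
  have h8 : q.re ≤ 2 / h ^ 2 := by
    rw [hre, show 2 / h ^ 2 = 1 / h ^ 2 + 1 / h ^ 2 by ring]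
    linarith
  rw [le_inv_comm₀ (by positivity) (by positivity)]
  calc q.re ^ 2 ≤ (2 / h ^ 2) ^ 2 := pow_le_pow_left₀ h7.le h8 2
    _ = _ := by
      field_simp
      norm_num

set_option maxHeartbeats 1000000 in
/-- Proposition 5 (cutoff quasimodes): solutions of the complex absorbing potential problem
with eigenvalue `λ = πlh/a + C h^{(β+4)/(β+2)}`, multiplied by the cutoff `φ`, are
`O(1/Re q)` quasimodes of the one-dimensional stationary damped wave operator with
`q = 1/h² + λ²/2`. -/
theorem stmt_14 (β a σ δ b c₀ : ℝ) (hβ : 0 < β) (ha : 0 < a) (hσ : 0 < σ) (hδ : 0 < δ)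
    (hb : 0 < b) (hab : a + σ < b - 2 * δ) (hc₀ : 0 < c₀)
    (W : ℝ → ℝ) (hWmeas : Measurable W)
    (hWbdd : ∃ Wmax : ℝ, ∀ x ∈ Ioo (0:ℝ) b, |W x| ≤ Wmax)
    (hW0 : ∀ x : ℝ, 0 < x → x ≤ a → W x = 0)
    (hW1 : ∀ x : ℝ, a < x → x < a + σ → W x = (x - a) ^ β)
    (hW2 : ∀ x : ℝ, a + σ ≤ x → x < b → c₀ ≤ W x)
    (φ : ℝ → ℝ) (hφ : ContDiff ℝ (⊤ : ℕ∞) φ)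
    (hφ1 : ∀ x : ℝ, x ≤ b - 2 * δ → φ x = 1)
    (hφ0 : ∀ x : ℝ, b - δ ≤ x → φ x = 0)
    (M K : ℝ) (hM : 0 < M) (hK : 0 < K) :
    ∃ h₀ > (0:ℝ), ∃ C'' > (0:ℝ), ∀ h : ℝ, 0 < h → h < h₀ →
      ∀ l : ℝ, |l| ≤ M → ∀ C : ℂ, ‖C‖ ≤ K →
      ∀ lam q : ℂ,
        lam = ((Real.pi * l * h / a : ℝ) : ℂ) + C * ((h ^ ((β + 4) / (β + 2)) : ℝ) : ℂ) →
        q = ((1 / h ^ 2 : ℝ) : ℂ) + lam ^ 2 / 2 →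
      ∀ v v' v'' : ℝ → ℂ,
        (∀ x ∈ Ici (0:ℝ), HasDerivWithinAt v (v' x) (Ici 0) x) →
        ContinuousOn v' (Ici 0) →
        IntegrableOn (fun x => ‖v x‖ ^ 2) (Ioi 0) →
        IntegrableOn (fun x => ‖v' x‖ ^ 2) (Ioi 0) →
        (∀ x ∈ Ioo (0:ℝ) a ∪ Ioi a, HasDerivAt v' (v'' x) x) →
        (v 0 = 0 ∨ v' 0 = 0) →
        (∀ x ∈ Ioo (0:ℝ) a ∪ Ioi a,
          -(h:ℂ) ^ 2 * v'' x + Complex.I * (((max (x - a) 0) ^ β : ℝ) : ℂ) * v x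
            - lam ^ 2 * v x = 0) →
        ∫ x in Ioo (0:ℝ) b,
            ‖-(((deriv (deriv φ) x : ℝ) : ℂ) * v x + 2 * ((deriv φ x : ℝ) : ℂ) * v' x
                + ((φ x : ℝ) : ℂ) * v'' x)
              + Complex.I * q * ((W x : ℝ) : ℂ) * (((φ x : ℝ) : ℂ) * v x)
              + (((1 / h ^ 4 : ℝ) : ℂ) - q ^ 2) * (((φ x : ℝ) : ℂ) * v x)‖ ^ 2
          ≤ C'' / q.re ^ 2 * ∫ x in Ioo (0:ℝ) b, ‖((φ x : ℝ) : ℂ) * v x‖ ^ 2 := by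
  obtain ⟨Wmax, hWmax⟩ := hWbdd
  obtain ⟨Φ, hΦ, hφb⟩ := exists_cutoff_bound hφ b
  set L : ℝ := Real.pi * M / a + K
  have hWmax0 : 0 ≤ Wmax := (abs_nonneg _).trans
    (hWmax (b / 2) ⟨by linarith, by linarith⟩)
  obtain ⟨d, hd, rfl⟩ : ∃ d > 0, σ = 5 * d := ⟨σ / 5, by positivity, by ring⟩
  set c : ℝ := d ^ β / 2
  have hc : 0 < c := by positivity
  set D : ℝ := L ^ 2 * Wmax + L ^ 4
  have hD : 0 ≤ D := by positivity
  set B : ℝ := 3 * Φ + (Wmax + b ^ β) * Φ + D * Φ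
  set R : ℝ := (2 / (d ^ 2 * c)) ^ 3 * (2 / d ^ 2)
  set Q : ℝ := D ^ 2 + 2 * B ^ 2 * (1 + 1 / c) * R
  have hQ : 0 ≤ Q := by positivity
  refine ⟨min 1 (min c 1 / (2 * (L ^ 2 + 1))), by positivity, 4 * Q + 1, by positivity, ?_⟩
  intro h hh hh₀ l hl C hC lam q hlam hq v v' v'' hv hv' hiv hiv' hv'' _ heq
  have hh₁ : h ≤ 1 := hh₀.le.trans (min_le_left _ _)
  have hLh : 2 * (L * h) ^ 2 ≤ min c 1 := by
    have h1 := (lt_div_iff₀ (by positivity)).1 (hh₀.trans_le (min_le_right _ _))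
    have h2 : L ^ 2 * h ^ 2 ≤ L ^ 2 * h := by
      gcongr
      exact pow_le_of_le_one hh.le hh₁ (by norm_num)
    rw [mul_pow]
    linarith
  have hlamL : ‖lam‖ ≤ L * h := norm_lam_le hβ ha hh hh₁ hl hC hlam
  have hhc : (h : ℂ) ≠ 0 := by exact_mod_cast hh.ne'
  have hderiv : ∀ x, 0 < x → HasDerivAt v (v' x) x := fun x hx =>
    (hv x hx.le).hasDerivAt (Ici_mem_nhds hx)
  set V : ℝ → ℝ := fun x => (max (x - a) 0) ^ β
  have hode : ∀ x ∈ Ici (a + d), HasDerivAt v'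
      ((((h ^ 2)⁻¹ : ℝ) : ℂ) * (Complex.I * (V x : ℂ) - lam ^ 2) * v x) x := fun x hx => by
    have hx' : x ∈ Ioo (0:ℝ) a ∪ Ioi a := Or.inr ((lt_add_of_pos_right a hd).trans_le hx)
    refine (hv'' x hx').congr_deriv ?_
    push_cast
    rw [mul_assoc, eq_inv_mul_iff_mul_eq₀ (pow_ne_zero 2 hhc)]
    linear_combination -heq x hx'
  have hμ : ∀ x ∈ Ici (a + d), c / h ^ 2
      ≤ ((((h ^ 2)⁻¹ : ℝ) : ℂ) * (Complex.I * (V x : ℂ) - lam ^ 2)).re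
        + ((((h ^ 2)⁻¹ : ℝ) : ℂ) * (Complex.I * (V x : ℂ) - lam ^ 2)).im := fun x hx => by
    have h1 : d ^ β ≤ V x := Real.rpow_le_rpow hd.le
      (le_max_of_le_left (by linarith [mem_Ici.1 hx])) hβ.le
    have h2 := re_add_im_sq_le hlamL
    have h3 := hLh.trans (min_le_left _ _)
    rw [Complex.re_ofReal_mul, Complex.im_ofReal_mul, ← mul_add, div_eq_inv_mul]
    refine mul_le_mul_of_nonneg_left ?_ (by positivity)
    simp only [Complex.sub_re, Complex.sub_im, Complex.mul_re, Complex.mul_im, Complex.I_re,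
      Complex.I_im, Complex.ofReal_re, Complex.ofReal_im]
    linarith [show d ^ β = 2 * c by ring]
  have hE := integral_energy_le_integral (z := b) (by positivity)
    (fun x hx => hderiv x (lt_of_lt_of_le (by positivity) hx)) hode hμ
    (hiv.mono_set (Ioi_subset_Ioi (by positivity)))
    (hiv'.mono_set (Ioi_subset_Ioi (by positivity))) hd (by linarith)
  rw [show a + d + 4 * d = a + 5 * d by ring] at hE
  have hcv : ContinuousOn v (Icc 0 b) := fun x hx =>
    (hv x hx.1).continuousWithinAt.mono Icc_subset_Ici_self
  have hcφ : Continuous φ := hφ.continuous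
  have hpt : ∀ᵐ x, x ∈ Ioo 0 b → ‖-(((deriv (deriv φ) x : ℝ) : ℂ) * v x
      + 2 * ((deriv φ x : ℝ) : ℂ) * v' x + ((φ x : ℝ) : ℂ) * v'' x)
      + Complex.I * q * ((W x : ℝ) : ℂ) * (((φ x : ℝ) : ℂ) * v x)
      + (((1 / h ^ 4 : ℝ) : ℂ) - q ^ 2) * (((φ x : ℝ) : ℂ) * v x)‖ ^ 2
      ≤ (D * h ^ 2) ^ 2 * ‖((φ x : ℝ) : ℂ) * v x‖ ^ 2
        + (Ici (a + 5 * d)).indicator (fun x => 2 * B ^ 2 * (1 + 1 / c) / h ^ 2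
          * (‖v' x‖ ^ 2 + c / h ^ 2 * ‖v x‖ ^ 2)) x := by
    filter_upwards [compl_mem_ae_iff.2 (measure_singleton a)] with x hxa hx
    have hxa : x ≠ a := hxa
    have hx' : x ∈ Ioo (0:ℝ) a ∪ Ioi a := by
      rcases hxa.lt_or_gt with h | h
      · exact Or.inl ⟨hx.1, h⟩
      · exact Or.inr h
    have herr := norm_damping_error_le hh.le hh₁ hlamL (hWmax x hx)
    have hres := residual_eq (v₁ := v' x) (w := W x) (p := φ x) (p₁ := (deriv φ x : ℝ))
      (p₂ := (deriv (deriv φ) x : ℝ)) hhc (hq.trans (by push_cast; rfl)) (heq x hx')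
    rw [show ((1 / h ^ 4 : ℝ) : ℂ) = 1 / (h : ℂ) ^ 4 by push_cast; rfl, hres]
    rcases lt_or_ge x (a + 5 * d) with hnear | hfar
    · obtain ⟨hφ', hφ''⟩ := deriv_eq_zero_of_eq_one hφ1 (hnear.trans hab)
      have hWV : W x = (max (x - a) 0) ^ β := by
        rcases hxa.lt_or_gt with h | h
        · rw [hW0 x hx.1 h.le, max_eq_right (by linarith), Real.zero_rpow hβ.ne']
        · rw [hW1 x h hnear, max_eq_left (by linarith)]
      rw [indicator_of_notMem (by simpa using hnear), add_zero, ← mul_pow, hφ', hφ'', ← hWV]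
      refine pow_le_pow_left₀ (norm_nonneg _) ?_ 2
      simpa using mul_le_mul_of_nonneg_right herr (norm_nonneg ((φ x : ℂ) * v x))
    · rw [indicator_of_mem (mem_Ici.2 hfar)]
      refine (sq_norm_far_le hh hh₁ hc ?_).trans (le_add_of_nonneg_left (by positivity))
      obtain ⟨hp, hp₁, hp₂⟩ := hφb x (Ioo_subset_Icc_self hx)
      exact norm_residual_far_le hh hh₁ hΦ hD (by positivity) hp hp₁ hp₂
        (abs_sub_le_of_bounds (hWmax x hx) hx.2.le hb.le hβ.le ha.le) herr
  have hmain := integral_sq_norm_le (κ := c / h ^ 2) (by positivity) (by linarith) (by linarith)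
    (by positivity) (by linarith) (by positivity) (by positivity)
    (by fun_prop) hcv (hv'.mono Icc_subset_Ici_self)
    (fun x hx => by rw [hφ1 x (by linarith [hx.2])]; simp) hpt hE
  have hU : 0 ≤ ∫ x in Ioo (0:ℝ) b, ‖((φ x : ℝ) : ℂ) * v x‖ ^ 2 :=
    integral_nonneg fun x => sq_nonneg _
  refine hmain.trans (mul_le_mul_of_nonneg_right ?_ hU)
  have hqre := inv_sq_re_ge hh hh₁ (hLh.trans (min_le_right _ _)) hlamL hq
  calc _ = h ^ 4 * Q := by
        simp only [Q, R]
        field_simp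
    _ ≤ (4 * Q + 1) * (h ^ 4 / 4) := by nlinarith [pow_pos hh 4]
    _ ≤ (4 * Q + 1) / q.re ^ 2 := by
        rw [div_eq_mul_inv _ (q.re ^ 2)]
        gcongr
end

section
/- Let β > 0, 0 < a, 0 < σ, δ > 0, b > 0 with a + σ < b − 2δ, and L > 0. Let φ : [0,∞) → ℝ be smooth with φ(x) = 1 for x ≤ b−2δ and φ(x) = 0 for x ≥ b−δ. Then for every natural number N there exists C_N > 0 such that: for all h ∈ (0, σ^{β/2}), all λ ∈ ℂ with |λ| ≤ L·h, and every v : [0,∞) → ℂ which is continuously differentiable with v, v' square-integrable on (0,∞), twice continuously differentiable on (a,∞) and on (0,a), satisfies v(0) = 0 or v'(0) = 0, and solves −h² v''(x) + i (x−a)₊^β v(x) − λ² v(x) = 0 on (0,a) ∪ (a,∞), one has ∫_{a+σ}^b ( |(φv)(x)|² + h²|(φv)'(x)|² + h⁴|(φv)''(x)|² ) dx ≤ C_N · h^N · ∫₀^b |(φv)(x)|² dx. -/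
open MeasureTheory Set

open Filter Topology

/-- `v` solves `v'' = (i (x - a)₊^β / h² - μ) v` on `(a, ∞)` with `‖μ‖ ≤ L²`, and `v`, `v'` are
square-integrable there. -/
structure IsDampedSolution (β a L h : ℝ) (μ : ℂ) (v v' : ℝ → ℂ) : Prop where
  norm_le : ‖μ‖ ≤ L ^ 2
  hasDerivAt : ∀ x, a < x → HasDerivAt v (v' x) x
  hasDerivAt' : ∀ x, a < x →
    HasDerivAt v' ((Complex.I * (((max (x - a) 0) ^ β / h ^ 2 : ℝ) : ℂ) - μ) * v x) x
  integrable : IntegrableOn (fun x => ‖v x‖ ^ 2) (Ioi a)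
  integrable' : IntegrableOn (fun x => ‖v' x‖ ^ 2) (Ioi a)

/-- An integrable function has no positive lower bound near infinity, so it drops out of an
upper bound for the partial integrals of `f`. -/
lemma setIntegral_Ioi_le_of_intervalIntegral_le {f k : ℝ → ℝ} {q C : ℝ}
    (hf : IntegrableOn f (Ioi q)) (hk : IntegrableOn k (Ioi q))
    (hle : ∀ r, q ≤ r → ∫ x in q..r, f x ≤ k r + C) :
    ∫ x in Ioi q, f x ≤ C := by
  by_contra! hlt
  set I := ∫ x in Ioi q, f x with hI
  have ht := intervalIntegral_tendsto_integral_Ioi q hf tendsto_id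
  have hev : ∀ᶠ r in atTop, C + (I - C) / 2 < ∫ x in q..r, f x :=
    ht.eventually (lt_mem_nhds (by linarith))
  obtain ⟨R, hR⟩ := eventually_atTop.1 hev
  set S := max q R
  have hkS : IntegrableOn k (Ioi S) := hk.mono_set (Ioi_subset_Ioi (le_max_left _ _))
  have hconst : IntegrableOn (fun _ : ℝ => (I - C) / 2) (Ioi S) := by
    refine Integrable.mono' hkS aestronglyMeasurable_const ?_
    refine (ae_restrict_iff' measurableSet_Ioi).2 (Eventually.of_forall fun x hx => ?_)
    have h1 : S < x := hx
    have h2 := hR x ((le_max_right _ _).trans h1.le)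
    have h3 := hle x ((le_max_left _ _).trans h1.le)
    rw [Real.norm_of_nonneg (by linarith)]
    linarith
  have hne : (I - C) / 2 ≠ 0 := by linarith
  rw [integrableOn_const_iff (by simp)] at hconst
  simp [hne] at hconst

namespace IsDampedSolution

variable {β a L h : ℝ} {μ : ℂ} {v v' : ℝ → ℂ}

lemma continuousOn (hv : IsDampedSolution β a L h μ v v') : ContinuousOn v (Ioi a) :=
  fun x hx => (hv.hasDerivAt x hx).continuousAt.continuousWithinAt

lemma continuousOn' (hv : IsDampedSolution β a L h μ v v') : ContinuousOn v' (Ioi a) :=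
  fun x hx => (hv.hasDerivAt' x hx).continuousAt.continuousWithinAt

lemma setIntegral_Ioi_nonneg (f : ℝ → ℂ) (p : ℝ) : 0 ≤ ∫ x in Ioi p, ‖f x‖ ^ 2 :=
  integral_nonneg fun _ => by positivity

/-- The energy inequality for `v`, localized by a weight `χ`. -/
lemma integral_energy_le (hβ : 0 < β) (hv : IsDampedSolution β a L h μ v v')
    {χ χ' : ℝ → ℝ} (hχ : ∀ x, HasDerivAt χ (χ' x) x) (hχ' : Continuous χ') {p r : ℝ}
    (hp : a < p) (hpr : p ≤ r) :
    ∫ x in p..r, (χ x ^ 2 * (‖v' x‖ ^ 2 / 2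
        + ((max (x - a) 0) ^ β / h ^ 2 - 2 * L ^ 2) * ‖v x‖ ^ 2) - 8 * χ' x ^ 2 * ‖v x‖ ^ 2)
      ≤ χ r ^ 2 * ((v' r * star (v r)).re + (v' r * star (v r)).im)
        - χ p ^ 2 * ((v' p * star (v p)).re + (v' p * star (v p)).im) := by
  have hsub : Icc p r ⊆ Ioi a := fun x hx => hp.trans_le hx.1
  have hc := hv.continuousOn.mono hsub
  have hc' := hv.continuousOn'.mono hsub
  have hχc : Continuous χ := continuous_iff_continuousAt.2 fun x => (hχ x).continuousAt
  have hW : Continuous fun x : ℝ => (max (x - a) 0) ^ β :=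
    Continuous.rpow_const (by fun_prop) fun _ => Or.inr hβ.le
  refine intervalIntegral.integral_le_sub_of_hasDeriv_right_of_le hpr
    (g := fun x => χ x ^ 2 * ((v' x * star (v x)).re + (v' x * star (v x)).im))
    (g' := fun x => 2 * χ x * χ' x * ((v' x * star (v x)).re + (v' x * star (v x)).im)
      + χ x ^ 2 * (((Complex.I * (((max (x - a) 0) ^ β / h ^ 2 : ℝ) : ℂ) - μ) * v x * star (v x)
          + v' x * star (v' x)).re
        + ((Complex.I * (((max (x - a) 0) ^ β / h ^ 2 : ℝ) : ℂ) - μ) * v x * star (v x)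
          + v' x * star (v' x)).im)) ?_ ?_ ?_ ?_
  · have h1 : ContinuousOn (fun x => v' x * star (v x)) (Icc p r) := hc'.mul hc.star
    exact (hχc.pow 2).continuousOn.mul
      ((Complex.continuous_re.comp_continuousOn h1).add (Complex.continuous_im.comp_continuousOn h1))
  · intro x hx
    have hx' : a < x := hp.trans hx.1
    have h1 := (hv.hasDerivAt' x hx').mul (hv.hasDerivAt x hx').star
    have hre := Complex.reCLM.hasFDerivAt.comp_hasDerivAt x h1
    have him := Complex.imCLM.hasFDerivAt.comp_hasDerivAt x h1
    have h2 := ((hχ x).pow 2).mul (hre.add him)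
    refine HasDerivAt.hasDerivWithinAt (h2.congr_deriv ?_)
    simp
  · refine ContinuousOn.integrableOn_Icc ?_
    have h3 := hc.norm.pow 2
    have h4 := hc'.norm.pow 2
    refine ContinuousOn.sub (ContinuousOn.mul (by fun_prop) (ContinuousOn.add (h4.div_const 2)
      (((hW.div_const _).sub continuous_const).continuousOn.mul h3))) (ContinuousOn.mul (by fun_prop) h3)
  · intro x hx
    have hμ := hv.norm_le
    have hr := (abs_le.1 ((Complex.abs_re_le_norm μ).trans hμ)).2
    have hi := (abs_le.1 ((Complex.abs_im_le_norm μ).trans hμ)).2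
    set w := (max (x - a) 0) ^ β / h ^ 2
    have e1 : ‖v x‖ ^ 2 = (v x).re ^ 2 + (v x).im ^ 2 := by
      rw [Complex.sq_norm, Complex.normSq_apply]; ring
    have e2 : ‖v' x‖ ^ 2 = (v' x).re ^ 2 + (v' x).im ^ 2 := by
      rw [Complex.sq_norm, Complex.normSq_apply]; ring
    rw [e1, e2]
    simp
    generalize (v x).re = s at *
    generalize (v x).im = t at *
    generalize (v' x).re = s' at *
    generalize (v' x).im = t' at *
    generalize χ x = c at *
    generalize χ' x = d at *
    have n : 0 ≤ c ^ 2 * (s ^ 2 + t ^ 2) := by positivity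
    have n1 := mul_nonneg (sub_nonneg.2 hr) n
    have n2 := mul_nonneg (sub_nonneg.2 hi) n
    nlinarith [sq_nonneg (c * s' + 2 * d * (s - t)), sq_nonneg (c * t' + 2 * d * (s + t)),
      sq_nonneg (d * s), sq_nonneg (d * t)]

lemma re_add_im_mul_star_le (z w : ℂ) :
    (z * star w).re + (z * star w).im ≤ ‖w‖ ^ 2 + ‖z‖ ^ 2 := by
  rw [Complex.sq_norm, Complex.normSq_apply, Complex.sq_norm, Complex.normSq_apply]
  simp
  nlinarith [sq_nonneg (z.re - w.re + w.im), sq_nonneg (z.im - w.im - w.re)]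

/-- The energy inequality on a half-line, with the weight `1 - exp (p - x)`. -/
lemma setIntegral_Ioi_le_of_le_energy (hβ : 0 < β) (hv : IsDampedSolution β a L h μ v v')
    {p q : ℝ} (hp : a < p) (hpq : p < q) {f : ℝ → ℝ} (hf : IntegrableOn f (Ioi q))
    (hfle : ∀ x, q ≤ x → ∀ s e : ℝ, (1 - Real.exp (p - q)) ^ 2 ≤ s → s ≤ 1 → 0 ≤ e → e ≤ 1 →
      f x ≤ s * (‖v' x‖ ^ 2 / 2 + ((max (x - a) 0) ^ β / h ^ 2 - 2 * L ^ 2) * ‖v x‖ ^ 2)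
        - 8 * e * ‖v x‖ ^ 2) :
    ∫ x in Ioi q, f x ≤ (2 * L ^ 2 + 8) * ∫ x in p..q, ‖v x‖ ^ 2 := by
  have hsub : Ioi q ⊆ Ioi a := Ioi_subset_Ioi (hp.trans hpq).le
  have hexp : ∀ x, p ≤ x → Real.exp (p - x) ≤ 1 := fun x hx =>
    Real.exp_le_one_iff.2 (by linarith)
  refine setIntegral_Ioi_le_of_intervalIntegral_le hf
    ((hv.integrable.mono_set hsub).add (hv.integrable'.mono_set hsub)) fun r hr => ?_
  have hχ : ∀ x, HasDerivAt (fun x => 1 - Real.exp (p - x)) (Real.exp (p - x)) x := by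
    intro x
    have := (((hasDerivAt_id x).const_sub p).exp).const_sub 1
    simpa using this
  have key := hv.integral_energy_le hβ hχ (by fun_prop) hp (hpq.le.trans hr)
  have hbd : (1 - Real.exp (p - r)) ^ 2 * ((v' r * star (v r)).re + (v' r * star (v r)).im)
      ≤ ‖v r‖ ^ 2 + ‖v' r‖ ^ 2 := by
    have h1 := re_add_im_mul_star_le (v' r) (v r)
    have h2 := hexp r (hpq.le.trans hr)
    have h3 := Real.exp_pos (p - r)
    have h4 : (1 - Real.exp (p - r)) ^ 2 ≤ 1 := by nlinarith
    calc _ ≤ (1 - Real.exp (p - r)) ^ 2 * (‖v r‖ ^ 2 + ‖v' r‖ ^ 2) := by gcongr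
      _ ≤ 1 * (‖v r‖ ^ 2 + ‖v' r‖ ^ 2) := by gcongr
      _ = _ := one_mul _
  have hsubI : Icc p r ⊆ Ioi a := fun x hx => hp.trans_le hx.1
  have h3 := (hv.continuousOn.mono hsubI).norm.pow 2
  have h4 := (hv.continuousOn'.mono hsubI).norm.pow 2
  have hW : Continuous fun x : ℝ => (max (x - a) 0) ^ β :=
    Continuous.rpow_const (by fun_prop) fun _ => Or.inr hβ.le
  set F : ℝ → ℝ := fun x => (1 - Real.exp (p - x)) ^ 2 * (‖v' x‖ ^ 2 / 2
        + ((max (x - a) 0) ^ β / h ^ 2 - 2 * L ^ 2) * ‖v x‖ ^ 2)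
        - 8 * Real.exp (p - x) ^ 2 * ‖v x‖ ^ 2 with hF
  have hFc : ContinuousOn F (Icc p r) :=
    ContinuousOn.sub (ContinuousOn.mul (by fun_prop) (ContinuousOn.add (h4.div_const 2)
      (((hW.div_const _).sub continuous_const).continuousOn.mul h3)))
      (ContinuousOn.mul (by fun_prop) h3)
  have hF1 : IntervalIntegrable F volume p q :=
    (hFc.mono (Icc_subset_Icc_right hr)).intervalIntegrable_of_Icc hpq.le
  have hF2 : IntervalIntegrable F volume q r :=
    (hFc.mono (Icc_subset_Icc_left hpq.le)).intervalIntegrable_of_Icc hr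
  have hv1 : IntervalIntegrable (fun x => ‖v x‖ ^ 2) volume p q :=
    (h3.mono (Icc_subset_Icc_right hr)).intervalIntegrable_of_Icc hpq.le
  have hf1 : IntervalIntegrable f volume q r :=
    (intervalIntegrable_iff_integrableOn_Ioc_of_le hr).2 (hf.mono_set Ioc_subset_Ioi_self)
  have i1 : ∫ x in p..q, -((2 * L ^ 2 + 8) * ‖v x‖ ^ 2) ≤ ∫ x in p..q, F x := by
    refine intervalIntegral.integral_mono_on hpq.le (hv1.const_mul _).neg hF1 fun x hx => ?_
    have e1 := hexp x hx.1
    have e2 := Real.exp_pos (p - x)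
    have e3 : 0 ≤ (max (x - a) 0) ^ β / h ^ 2 := by positivity
    have e4 : (1 - Real.exp (p - x)) ^ 2 ≤ 1 := by nlinarith
    have e5 : Real.exp (p - x) ^ 2 ≤ 1 := by nlinarith
    have e6 : 0 ≤ (1 - Real.exp (p - x)) ^ 2 := sq_nonneg _
    simp only [hF]
    generalize (1 - Real.exp (p - x)) ^ 2 = s at *
    generalize Real.exp (p - x) ^ 2 = e at *
    generalize (max (x - a) 0) ^ β / h ^ 2 = w at *
    have m1 : 0 ≤ s * ‖v' x‖ ^ 2 := by positivity
    have m2 : 0 ≤ s * w * ‖v x‖ ^ 2 := by positivity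
    have m3 : 0 ≤ (1 - s) * (L ^ 2 * ‖v x‖ ^ 2) := mul_nonneg (by linarith) (by positivity)
    have m4 : 0 ≤ (1 - e) * (‖v x‖ ^ 2) := mul_nonneg (by linarith) (by positivity)
    nlinarith
  have i2 : ∫ x in q..r, f x ≤ ∫ x in q..r, F x := by
    refine intervalIntegral.integral_mono_on hr hf1 hF2 fun x hx => ?_
    have e1 := hexp x (hpq.le.trans hx.1)
    have e2 := Real.exp_pos (p - x)
    have e3 : Real.exp (p - x) ≤ Real.exp (p - q) := Real.exp_le_exp.2 (by linarith [hx.1])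
    have e4 := hexp q hpq.le
    exact hfle x hx.1 _ _ (pow_le_pow_left₀ (by linarith) (by linarith) 2) (by nlinarith)
      (by positivity) (by nlinarith)
  rw [← intervalIntegral.integral_add_adjacent_intervals hF1 hF2] at key
  rw [intervalIntegral.integral_neg, intervalIntegral.integral_const_mul] at i1
  simp only [sub_self, Real.exp_zero] at key
  simp only [Pi.add_apply]
  linarith

lemma rpow_le_damping (hβ : 0 < β) {p x : ℝ} (hp : a < p) (hx : p ≤ x) :
    (p - a) ^ β ≤ (max (x - a) 0) ^ β :=
  Real.rpow_le_rpow (by linarith) (le_max_of_le_left (by linarith)) hβ.le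

/-- Away from the edge of the damped region the energy gains a factor `h²`. -/
lemma exists_energy_Ioi_le (hβ : 0 < β) (L : ℝ) {p q : ℝ} (hp : a < p) (hpq : p < q) :
    ∃ C > 0, ∀ h μ v v', 0 < h → IsDampedSolution β a L h μ v v' →
      (∫ x in Ioi q, ‖v x‖ ^ 2) + h ^ 2 * (∫ x in Ioi q, ‖v' x‖ ^ 2)
        ≤ C * h ^ 2 * ∫ x in Ioi p, ‖v x‖ ^ 2 := by
  have hc : 0 < 1 - Real.exp (p - q) := by
    have := Real.exp_lt_one_iff.2 (show p - q < 0 by linarith)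
    linarith
  set c := (1 - Real.exp (p - q)) ^ 2
  have hcpos : 0 < c := by positivity
  have hw : 0 < (p - a) ^ β := Real.rpow_pos_of_pos (by linarith) _
  set w := (p - a) ^ β
  refine ⟨(2 * L ^ 2 + 8) / c * (2 + 1 / w), by positivity, fun h μ v v' hh hv => ?_⟩
  have hsub : Ioi q ⊆ Ioi a := Ioi_subset_Ioi (hp.trans hpq).le
  have j1 := hv.integrable.mono_set hsub
  have j2 := hv.integrable'.mono_set hsub
  have key := hv.setIntegral_Ioi_le_of_le_energy hβ hp hpq
    (f := fun x => c / 2 * ‖v' x‖ ^ 2 + (c * (w / h ^ 2) - (2 * L ^ 2 + 8)) * ‖v x‖ ^ 2)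
    (Integrable.fun_add (j2.const_mul _) (j1.const_mul _)) (by
      intro x hx s e hs1 hs2 he1 he2
      have hW := rpow_le_damping hβ hp (hpq.le.trans hx)
      have hW' : w / h ^ 2 ≤ (max (x - a) 0) ^ β / h ^ 2 := by gcongr
      generalize (max (x - a) 0) ^ β / h ^ 2 = W at *
      have hw2 : 0 < w / h ^ 2 := by positivity
      generalize w / h ^ 2 = w' at *
      have m1 : 0 ≤ (s - c) * ‖v' x‖ ^ 2 := mul_nonneg (by linarith) (by positivity)
      have m2 : 0 ≤ (s * W - c * w') * ‖v x‖ ^ 2 :=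
        mul_nonneg (sub_nonneg.2 (mul_le_mul hs1 hW' hw2.le (by linarith))) (by positivity)
      have m3 : 0 ≤ (1 - s) * (L ^ 2 * ‖v x‖ ^ 2) := mul_nonneg (by linarith) (by positivity)
      have m4 : 0 ≤ (1 - e) * (‖v x‖ ^ 2) := mul_nonneg (by linarith) (by positivity)
      nlinarith)
  rw [integral_add (j2.const_mul _) (j1.const_mul _), integral_const_mul,
    integral_const_mul] at key
  have hsplit := intervalIntegral.integral_interval_add_Ioi
    (hv.integrable.mono_set (Ioi_subset_Ioi hp.le)) j1
  have hA := setIntegral_Ioi_nonneg v' q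
  have hB := setIntegral_Ioi_nonneg v q
  set A := ∫ x in Ioi q, ‖v' x‖ ^ 2
  set B := ∫ x in Ioi q, ‖v x‖ ^ 2
  rw [← hsplit]
  set T := ∫ x in p..q, ‖v x‖ ^ 2
  have key2 : c * (A / 2 + w / h ^ 2 * B) ≤ (2 * L ^ 2 + 8) * (T + B) := by nlinarith
  have key3 : A / 2 + w / h ^ 2 * B ≤ (2 * L ^ 2 + 8) / c * (T + B) := by
    rw [div_mul_eq_mul_div (2 * L ^ 2 + 8), le_div_iff₀ hcpos]
    linarith
  have hwB : 0 ≤ w / h ^ 2 * B := by positivity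
  have k1 : A ≤ 2 * ((2 * L ^ 2 + 8) / c * (T + B)) := by linarith
  have k2 : w / h ^ 2 * B ≤ (2 * L ^ 2 + 8) / c * (T + B) := by linarith
  set Q := (2 * L ^ 2 + 8) / c * (T + B)
  have k3 : B ≤ h ^ 2 * (1 / w) * Q := by
    have : B = h ^ 2 * (1 / w) * (w / h ^ 2 * B) := by field_simp
    rw [this]; gcongr
  calc B + h ^ 2 * A ≤ h ^ 2 * (1 / w) * Q + h ^ 2 * (2 * Q) := by gcongr
    _ = _ := by ring

/-- Iterating the gain of `h²` on nested half-lines. -/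
lemma exists_integral_Ioi_le_pow (hβ : 0 < β) (L : ℝ) (N : ℕ) :
    ∀ {p q : ℝ}, a < p → p < q →
    ∃ C > 0, ∀ h μ v v', 0 < h → IsDampedSolution β a L h μ v v' →
      (∫ x in Ioi q, ‖v x‖ ^ 2) ≤ C * h ^ (2 * N) * ∫ x in Ioi p, ‖v x‖ ^ 2 := by
  induction N with
  | zero =>
    intro p q hp hpq
    refine ⟨1, one_pos, fun h μ v v' hh hv => ?_⟩
    simp only [mul_zero, pow_zero, mul_one, one_mul]
    exact setIntegral_mono_set (hv.integrable.mono_set (Ioi_subset_Ioi hp.le))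
      (Eventually.of_forall fun x => by positivity) (Ioi_subset_Ioi hpq.le).eventuallyLE
  | succ N ih =>
    intro p q hp hpq
    obtain ⟨C₁, hC₁, h₁⟩ := ih hp (left_lt_add_div_two.2 hpq)
    obtain ⟨C₂, hC₂, h₂⟩ := exists_energy_Ioi_le hβ L (hp.trans (left_lt_add_div_two.2 hpq))
      (add_div_two_lt_right.2 hpq)
    refine ⟨C₂ * C₁, by positivity, fun h μ v v' hh hv => ?_⟩
    have e1 := h₁ h μ v v' hh hv
    have e2 := h₂ h μ v v' hh hv
    have hA : 0 ≤ h ^ 2 * (∫ x in Ioi q, ‖v' x‖ ^ 2) :=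
      mul_nonneg (by positivity) (setIntegral_Ioi_nonneg v' q)
    calc (∫ x in Ioi q, ‖v x‖ ^ 2) ≤ _ := (le_add_of_nonneg_right hA).trans e2
      _ ≤ C₂ * h ^ 2 * (C₁ * h ^ (2 * N) * ∫ x in Ioi p, ‖v x‖ ^ 2) := by gcongr
      _ = _ := by ring

/-- Where the damping dominates, the mass near infinity is controlled by the mass before it. -/
lemma integral_Ioi_le_of_damping (hβ : 0 < β) (hv : IsDampedSolution β a L h μ v v')
    {p q c : ℝ} (hp : a < p) (hpq : p < q) (hc : 0 < c) (hcq : c ≤ (1 - Real.exp (p - q)) ^ 2)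
    (hdamp : 2 * L ^ 2 + 9 / c ≤ (q - a) ^ β / h ^ 2) :
    ∫ x in Ioi q, ‖v x‖ ^ 2 ≤ (2 * L ^ 2 + 8) * ∫ x in p..q, ‖v x‖ ^ 2 := by
  refine hv.setIntegral_Ioi_le_of_le_energy hβ hp hpq
    (hv.integrable.mono_set (Ioi_subset_Ioi (hp.trans hpq).le)) ?_
  intro x hx s e hs1 hs2 he1 he2
  have hW := rpow_le_damping hβ (hp.trans hpq) hx
  have hW' : (q - a) ^ β / h ^ 2 ≤ (max (x - a) 0) ^ β / h ^ 2 := by gcongr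
  generalize (max (x - a) 0) ^ β / h ^ 2 = W at *
  have h1 : 9 / c ≤ W - 2 * L ^ 2 := by linarith
  have h2 : 9 ≤ s * (W - 2 * L ^ 2) := by
    calc 9 = c * (9 / c) := by field_simp
      _ ≤ s * (W - 2 * L ^ 2) := mul_le_mul (hcq.trans hs1) h1 (by positivity) (by linarith)
  have m1 : 0 ≤ s * ‖v' x‖ ^ 2 := mul_nonneg (by linarith) (by positivity)
  have m2 : 0 ≤ (s * (W - 2 * L ^ 2) - 9) * ‖v x‖ ^ 2 :=
    mul_nonneg (by linarith) (by positivity)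
  have m4 : 0 ≤ (1 - e) * (‖v x‖ ^ 2) := mul_nonneg (by linarith) (by positivity)
  nlinarith

/-- Grönwall's inequality for the first-order system satisfied by `(v, v')`. -/
lemma norm_le_exp (hβ : 0 < β) (hv : IsDampedSolution β a L h μ v v') {y x R K : ℝ} (hy : a < y)
    (hyx : y ≤ x) (hxR : x ≤ R) (hK1 : 1 ≤ K) (hK : (R - a) ^ β / h ^ 2 + L ^ 2 ≤ K) :
    ‖v x‖ ≤ max ‖v y‖ ‖v' y‖ * Real.exp (K * (x - y)) := by
  have hsub : Icc y x ⊆ Ioi a := fun t ht => hy.trans_le ht.1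
  have key := norm_le_gronwallBound_of_norm_deriv_right_le (f := fun t => (v t, v' t))
    (f' := fun t => (v' t,
      (Complex.I * (((max (t - a) 0) ^ β / h ^ 2 : ℝ) : ℂ) - μ) * v t))
    (δ := max ‖v y‖ ‖v' y‖) (K := K) (ε := 0) (a := y) (b := x)
    ((hv.continuousOn.mono hsub).prodMk (hv.continuousOn'.mono hsub))
    (fun t ht => ((hv.hasDerivAt t (hy.trans_le ht.1)).prodMk
      (hv.hasDerivAt' t (hy.trans_le ht.1))).hasDerivWithinAt)
    le_rfl ?_ x ⟨hyx, le_rfl⟩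
  · rw [gronwallBound_ε0] at key
    exact (norm_fst_le (v x, v' x)).trans key
  · intro t ht
    have hV : ‖Complex.I * (((max (t - a) 0) ^ β / h ^ 2 : ℝ) : ℂ) - μ‖ ≤ K := by
      refine (norm_sub_le _ _).trans (le_trans (add_le_add ?_ hv.norm_le) hK)
      rw [norm_mul, Complex.norm_I, one_mul, Complex.norm_real,
        Real.norm_of_nonneg (by positivity), max_eq_left (by linarith [ht.1])]
      gcongr
      · linarith [ht.1]
      · linarith [ht.2]
    rw [add_zero, Prod.norm_def, Prod.norm_def]
    refine max_le ?_ ?_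
    · calc ‖v' t‖ ≤ 1 * max ‖v t‖ ‖v' t‖ := by rw [one_mul]; exact le_max_right _ _
        _ ≤ K * max ‖v t‖ ‖v' t‖ := by gcongr
    · dsimp only
      rw [norm_mul]
      exact mul_le_mul hV (le_max_left _ _) (norm_nonneg _) (by linarith)

/-- The mass on `(q, R)` is controlled by the mass on `(p, q)` as long as the damping stays
bounded on `(p, R)`. -/
lemma exists_integral_le_of_bounded (hβ : 0 < β) (L K : ℝ) (hK1 : 1 ≤ K) {p q R : ℝ}
    (hp : a < p) (hpq : p < q) (hqR : q ≤ R) :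
    ∃ C > 0, ∀ h μ v v', IsDampedSolution β a L h μ v v' →
      (R - a) ^ β / h ^ 2 + L ^ 2 ≤ K →
      ∫ x in q..R, ‖v x‖ ^ 2 ≤ C * ∫ x in p..q, ‖v x‖ ^ 2 := by
  set D := q - p with hD
  have hDpos : 0 < D := by linarith
  have hJ : 0 < ∫ y in p..q, ((y - p) * (q - y)) ^ 2 := by
    refine intervalIntegral.intervalIntegral_pos_of_pos_on
      (Continuous.intervalIntegrable (by fun_prop) _ _) (fun y hy => ?_) hpq
    have h1 : 0 < y - p := by linarith [hy.1]
    have h2 : 0 < q - y := by linarith [hy.2]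
    positivity
  set J := ∫ y in p..q, ((y - p) * (q - y)) ^ 2 with hJdef
  set E := Real.exp (K * (R - p)) ^ 2 with hE
  set M := 2 * (D ^ 4 * (2 * L ^ 2 + 1) + 8 * D ^ 2) with hM
  have hMpos : 0 < M := by positivity
  have hEpos : 0 < E := by positivity
  refine ⟨(R - q) * (E * M / J) + 1,
    add_pos_of_nonneg_of_pos (mul_nonneg (by linarith) (by positivity)) one_pos,
    fun h μ v v' hv hK => ?_⟩
  have hsub : Icc p q ⊆ Ioi a := fun x hx => hp.trans_le hx.1
  have h3 := (hv.continuousOn.mono hsub).norm.pow 2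
  have h4 := (hv.continuousOn'.mono hsub).norm.pow 2
  have hW : Continuous fun x : ℝ => (max (x - a) 0) ^ β :=
    Continuous.rpow_const (by fun_prop) fun _ => Or.inr hβ.le
  have hv1 : IntervalIntegrable (fun x => ‖v x‖ ^ 2) volume p q :=
    h3.intervalIntegrable_of_Icc hpq.le
  have hχ : ∀ x, HasDerivAt (fun x => (x - p) * (q - x)) ((q - x) - (x - p)) x := by
    intro x
    refine (((hasDerivAt_id x).sub_const p).mul ((hasDerivAt_id x).const_sub q)).congr_deriv ?_
    simp
    ring
  have hlc : IntervalIntegrable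
      (fun y => ((y - p) * (q - y)) ^ 2 * (‖v y‖ ^ 2 + ‖v' y‖ ^ 2)) volume p q :=
    (ContinuousOn.mul (by fun_prop) (h3.add h4)).intervalIntegrable_of_Icc hpq.le
  have hlocal : ∫ y in p..q, ((y - p) * (q - y)) ^ 2 * (‖v y‖ ^ 2 + ‖v' y‖ ^ 2)
      ≤ M * ∫ y in p..q, ‖v y‖ ^ 2 := by
    have key := hv.integral_energy_le hβ hχ (by fun_prop) hp hpq.le
    simp only [sub_self, zero_mul, mul_zero, ne_eq, OfNat.ofNat_ne_zero, not_false_eq_true,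
      zero_pow] at key
    have hmono := intervalIntegral.integral_mono_on hpq.le
      ((hlc.const_mul (1 / 2)).sub (hv1.const_mul (M / 2)))
      (ContinuousOn.intervalIntegrable_of_Icc hpq.le
        (ContinuousOn.sub (ContinuousOn.mul (by fun_prop) (ContinuousOn.add (h4.div_const 2)
        (((hW.div_const _).sub continuous_const).continuousOn.mul h3)))
        (ContinuousOn.mul (by fun_prop) h3))) (fun x hx => ?_) |>.trans key
    · rw [intervalIntegral.integral_sub (hlc.const_mul _) (hv1.const_mul _),
        intervalIntegral.integral_const_mul, intervalIntegral.integral_const_mul] at hmono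
      linarith
    · have b1 : 0 ≤ x - p := by linarith [hx.1]
      have b2 : 0 ≤ q - x := by linarith [hx.2]
      have b3 : (x - p) * (q - x) ≤ D ^ 2 := by
        rw [sq]; exact mul_le_mul (by linarith) (by linarith) b2 hDpos.le
      have b4 : ((x - p) * (q - x)) ^ 2 ≤ D ^ 4 := by
        calc _ ≤ (D ^ 2) ^ 2 := by gcongr
          _ = D ^ 4 := by ring
      have b5 : (q - x - (x - p)) ^ 2 ≤ D ^ 2 := by
        rw [sq_le_sq, abs_of_pos hDpos, abs_le]; constructor <;> linarith
      have b6 : 0 ≤ ((x - p) * (q - x)) ^ 2 := by positivity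
      have e3 : 0 ≤ (max (x - a) 0) ^ β / h ^ 2 := by positivity
      simp only [hM, Pi.sub_apply, Pi.mul_apply, Pi.add_apply, Pi.pow_apply]
      generalize ((x - p) * (q - x)) ^ 2 = s at *
      generalize (q - x - (x - p)) ^ 2 = e at *
      generalize (max (x - a) 0) ^ β / h ^ 2 = w at *
      have m2 : 0 ≤ s * w * ‖v x‖ ^ 2 := by positivity
      have m3 : 0 ≤ (D ^ 4 - s) * ((2 * L ^ 2 + 1) * ‖v x‖ ^ 2) :=
        mul_nonneg (by linarith) (by positivity)
      have m4 : 0 ≤ (D ^ 2 - e) * (‖v x‖ ^ 2) := mul_nonneg (by linarith) (by positivity)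
      have m5 : 0 ≤ s * ‖v x‖ ^ 2 := by positivity
      nlinarith
  have hT : 0 ≤ ∫ y in p..q, ‖v y‖ ^ 2 :=
    intervalIntegral.integral_nonneg hpq.le fun _ _ => by positivity
  have hpt : ∀ x ∈ Icc q R, ‖v x‖ ^ 2 ≤ E * M / J * ∫ y in p..q, ‖v y‖ ^ 2 := by
    intro x hx
    have hmono := intervalIntegral.integral_mono_on (μ := volume) hpq.le
      (f := fun y => ((y - p) * (q - y)) ^ 2 * ‖v x‖ ^ 2)
      (g := fun y => E * (((y - p) * (q - y)) ^ 2 * (‖v y‖ ^ 2 + ‖v' y‖ ^ 2)))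
      (Continuous.intervalIntegrable (by fun_prop) _ _) (hlc.const_mul _) (fun y hy => ?_)
    · rw [intervalIntegral.integral_mul_const, intervalIntegral.integral_const_mul,
        ← hJdef] at hmono
      have : J * ‖v x‖ ^ 2 ≤ E * (M * ∫ y in p..q, ‖v y‖ ^ 2) :=
        hmono.trans (by gcongr)
      rw [div_mul_eq_mul_div, le_div_iff₀ hJ]
      linarith
    · have g1 := hv.norm_le_exp hβ (hp.trans_le hy.1) (hy.2.trans hx.1) hx.2 hK1 hK
      have g2 : Real.exp (K * (x - y)) ≤ Real.exp (K * (R - p)) := by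
        apply Real.exp_le_exp.2
        have := hx.2
        have := hy.1
        gcongr
      have g3 : max ‖v y‖ ‖v' y‖ ^ 2 ≤ ‖v y‖ ^ 2 + ‖v' y‖ ^ 2 := by
        rcases max_choice ‖v y‖ ‖v' y‖ with hm | hm <;> rw [hm] <;>
          nlinarith [sq_nonneg ‖v y‖, sq_nonneg ‖v' y‖]
      have g4 : ‖v x‖ ^ 2 ≤ E * (‖v y‖ ^ 2 + ‖v' y‖ ^ 2) := by
        calc ‖v x‖ ^ 2 ≤ (max ‖v y‖ ‖v' y‖ * Real.exp (K * (x - y))) ^ 2 := by gcongr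
          _ = max ‖v y‖ ‖v' y‖ ^ 2 * Real.exp (K * (x - y)) ^ 2 := by ring
          _ ≤ (‖v y‖ ^ 2 + ‖v' y‖ ^ 2) * E := by rw [hE]; gcongr
          _ = _ := mul_comm _ _
      calc _ ≤ ((y - p) * (q - y)) ^ 2 * (E * (‖v y‖ ^ 2 + ‖v' y‖ ^ 2)) := by gcongr
        _ = _ := by ring
  have hvqR : IntervalIntegrable (fun x => ‖v x‖ ^ 2) volume q R :=
    ((hv.continuousOn.mono fun x hx => (hp.trans hpq).trans_le hx.1).norm.pow
      2).intervalIntegrable_of_Icc hqR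
  have hfin := intervalIntegral.integral_mono_on hqR hvqR
    (intervalIntegrable_const (c := E * M / J * ∫ y in p..q, ‖v y‖ ^ 2)) hpt
  rw [intervalIntegral.integral_const, smul_eq_mul] at hfin
  calc _ ≤ _ := hfin
    _ ≤ (R - q) * (E * M / J * ∫ y in p..q, ‖v y‖ ^ 2) + ∫ y in p..q, ‖v y‖ ^ 2 := by linarith
    _ = _ := by ring

/-- The mass of `v` on a half-line is controlled by its mass on an interval preceding it,
uniformly for bounded `h`. -/
lemma exists_integral_Ioi_le (hβ : 0 < β) (L : ℝ) {p q H : ℝ} (hp : a < p) (hpq : p < q)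
    (hH : 0 < H) :
    ∃ C > 0, ∀ h μ v v', 0 < h → h < H → IsDampedSolution β a L h μ v v' →
      ∫ x in Ioi q, ‖v x‖ ^ 2 ≤ C * ∫ x in p..q, ‖v x‖ ^ 2 := by
  have hc : 0 < 1 - Real.exp (p - q) := by
    have := Real.exp_lt_one_iff.2 (show p - q < 0 by linarith)
    linarith
  set c := (1 - Real.exp (p - q)) ^ 2
  have hcpos : 0 < c := by positivity
  set m := 2 * L ^ 2 + 9 / c with hm
  have hmpos : 0 < m := by positivity
  have hw : 0 < (q - a) ^ β := Real.rpow_pos_of_pos (by linarith) _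
  set R := max q (a + (H ^ 2 * m) ^ β⁻¹)
  have hqR : q ≤ R := le_max_left _ _
  have hRa : 0 ≤ R - a := by linarith
  have hRm : H ^ 2 * m ≤ (R - a) ^ β := by
    have h1 : (H ^ 2 * m) ^ β⁻¹ ≤ R - a := by
      have := le_max_right q (a + (H ^ 2 * m) ^ β⁻¹); linarith
    calc H ^ 2 * m = ((H ^ 2 * m) ^ β⁻¹) ^ β := (Real.rpow_inv_rpow (by positivity) hβ.ne').symm
      _ ≤ _ := Real.rpow_le_rpow (by positivity) h1 hβ.le
  set K := 1 + (R - a) ^ β / ((q - a) ^ β / m) + L ^ 2 with hK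
  have hRβ : 0 ≤ (R - a) ^ β := Real.rpow_nonneg hRa _
  obtain ⟨C, hC, hCle⟩ := exists_integral_le_of_bounded hβ L K
    (by have : 0 ≤ (R - a) ^ β / ((q - a) ^ β / m) + L ^ 2 := by positivity
        linarith) hp hpq hqR
  refine ⟨(2 * L ^ 2 + 8) * (1 + C) + C, by positivity, fun h μ v v' hh hhH hv => ?_⟩
  have hT : 0 ≤ ∫ y in p..q, ‖v y‖ ^ 2 :=
    intervalIntegral.integral_nonneg hpq.le fun _ _ => by positivity
  by_cases hsmall : m ≤ (q - a) ^ β / h ^ 2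
  · refine (hv.integral_Ioi_le_of_damping hβ hp hpq hcpos le_rfl hsmall).trans ?_
    have := mul_nonneg (show 0 ≤ 2 * L ^ 2 + 8 by positivity) hC.le
    exact mul_le_mul_of_nonneg_right (by linarith) hT
  · have hlarge : (q - a) ^ β / m ≤ h ^ 2 := by
      rw [not_le, div_lt_iff₀ (by positivity)] at hsmall
      rw [div_le_iff₀ hmpos]
      linarith
    have i1 := hCle h μ v v' hv (by
      have : (R - a) ^ β / h ^ 2 ≤ (R - a) ^ β / ((q - a) ^ β / m) := by gcongr
      linarith)
    have i2 := hv.integral_Ioi_le_of_damping hβ hp (hpq.trans_le hqR) hcpos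
      (pow_le_pow_left₀ hc.le (sub_le_sub_left (Real.exp_le_exp.2 (by linarith)) 1) 2) (by
        rw [← hm, le_div_iff₀ (by positivity)]
        calc m * h ^ 2 ≤ m * H ^ 2 := by gcongr
          _ ≤ _ := by linarith)
    have hcont : ∀ {s t : ℝ}, a < s → s ≤ t →
        IntervalIntegrable (fun x => ‖v x‖ ^ 2) volume s t := fun hs hst =>
      ((hv.continuousOn.mono fun x hx => hs.trans_le hx.1).norm.pow
        2).intervalIntegrable_of_Icc hst
    rw [← intervalIntegral.integral_add_adjacent_intervals (hcont hp hpq.le)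
      (hcont (hp.trans hpq) hqR)] at i2
    rw [← intervalIntegral.integral_interval_add_Ioi
      (hv.integrable.mono_set (Ioi_subset_Ioi (hp.trans hpq).le))
      (hv.integrable.mono_set (Ioi_subset_Ioi ((hp.trans hpq).le.trans hqR)))]
    have i3 : (2 * L ^ 2 + 8) * ∫ x in q..R, ‖v x‖ ^ 2
        ≤ (2 * L ^ 2 + 8) * (C * ∫ x in p..q, ‖v x‖ ^ 2) := by gcongr
    linarith

/-- Rapid decay of the energy of `v` inside the damped region. -/
lemma exists_energy_Ioi_le_pow (hβ : 0 < β) (L : ℝ) {p q H : ℝ} (hp : a < p) (hpq : p < q)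
    (hH : 0 < H) (N : ℕ) :
    ∃ C > 0, ∀ h μ v v', 0 < h → h < H → IsDampedSolution β a L h μ v v' →
      (∫ x in Ioi q, ‖v x‖ ^ 2) + h ^ 2 * (∫ x in Ioi q, ‖v' x‖ ^ 2)
        ≤ C * h ^ N * ∫ x in p..q, ‖v x‖ ^ 2 := by
  obtain ⟨s, hps, hsq⟩ := exists_between hpq
  obtain ⟨t, hst, htq⟩ := exists_between hsq
  obtain ⟨C₁, hC₁, h₁⟩ := exists_integral_Ioi_le hβ L hp hps hH
  obtain ⟨C₂, hC₂, h₂⟩ := exists_integral_Ioi_le_pow hβ L N (hp.trans hps) hst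
  obtain ⟨C₃, hC₃, h₃⟩ := exists_energy_Ioi_le hβ L (hp.trans (hps.trans hst)) htq
  refine ⟨C₃ * H ^ 2 * (C₂ * H ^ N * C₁), by positivity, fun h μ v v' hh hhH hv => ?_⟩
  have hT : ∫ x in p..s, ‖v x‖ ^ 2 ≤ ∫ x in p..q, ‖v x‖ ^ 2 := by
    refine intervalIntegral.integral_mono_interval le_rfl hps.le hsq.le
      (Eventually.of_forall fun x => by positivity) ?_
    exact ((hv.continuousOn.mono fun x hx => hp.trans_le hx.1).norm.pow
      2).intervalIntegrable_of_Icc hpq.le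
  have hT0 : 0 ≤ ∫ x in p..q, ‖v x‖ ^ 2 :=
    intervalIntegral.integral_nonneg hpq.le fun _ _ => by positivity
  calc _ ≤ C₃ * h ^ 2 * ∫ x in Ioi t, ‖v x‖ ^ 2 := h₃ h μ v v' hh hv
    _ ≤ C₃ * h ^ 2 * (C₂ * h ^ (2 * N) * ∫ x in Ioi s, ‖v x‖ ^ 2) := by
      gcongr; exact h₂ h μ v v' hh hv
    _ ≤ C₃ * h ^ 2 * (C₂ * h ^ (2 * N) * (C₁ * ∫ x in p..q, ‖v x‖ ^ 2)) := by
      gcongr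
      exact (h₁ h μ v v' hh hhH hv).trans (by gcongr)
    _ = C₃ * h ^ 2 * (C₂ * h ^ N * C₁) * (h ^ N * ∫ x in p..q, ‖v x‖ ^ 2) := by ring
    _ ≤ C₃ * H ^ 2 * (C₂ * H ^ N * C₁) * (h ^ N * ∫ x in p..q, ‖v x‖ ^ 2) := by gcongr
    _ = _ := by ring

end IsDampedSolution

/-- Pointwise bound of the `H²_h` density of a product by its first-order energy density. -/
lemma sq_norm_sum_le {c₀ c₁ c₂ z₀ z₁ z₂ : ℂ} {M Q h H : ℝ} (n₀ : ‖c₀‖ ≤ M) (n₁ : ‖c₁‖ ≤ M)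
    (n₂ : ‖c₂‖ ≤ M) (hh : 0 ≤ h) (hhH : h ≤ H) (hz : h ^ 2 * ‖z₂‖ ≤ Q * ‖z₀‖) :
    ‖c₀ * z₀‖ ^ 2 + h ^ 2 * ‖c₁ * z₀ + c₀ * z₁‖ ^ 2
        + h ^ 4 * ‖c₂ * z₀ + 2 * c₁ * z₁ + c₀ * z₂‖ ^ 2
      ≤ M ^ 2 * (2 + 14 * H ^ 2 + 3 * H ^ 4 + 3 * Q ^ 2) * (‖z₀‖ ^ 2 + h ^ 2 * ‖z₁‖ ^ 2) := by
  have hM : 0 ≤ M := (norm_nonneg _).trans n₀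
  have t₀ : ‖c₀ * z₀‖ ^ 2 ≤ M ^ 2 * ‖z₀‖ ^ 2 := by
    rw [norm_mul, ← mul_pow]
    gcongr
  have t₁ : ‖c₁ * z₀ + c₀ * z₁‖ ^ 2
      ≤ 2 * M ^ 2 * (‖z₀‖ ^ 2 + ‖z₁‖ ^ 2) := by
    calc _ ≤ (M * ‖z₀‖ + M * ‖z₁‖) ^ 2 := by
          gcongr
          refine (norm_add_le _ _).trans ?_
          rw [norm_mul, norm_mul]
          gcongr
      _ ≤ _ := by nlinarith [sq_nonneg (M * (‖z₀‖ - ‖z₁‖))]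
  have t₂ : ‖c₂ * z₀
          + 2 * c₁ * z₁ + c₀ * z₂‖ ^ 2
      ≤ 3 * M ^ 2 * (‖z₀‖ ^ 2 + 4 * ‖z₁‖ ^ 2 + ‖z₂‖ ^ 2) := by
    calc _ ≤ (M * ‖z₀‖ + 2 * M * ‖z₁‖ + M * ‖z₂‖) ^ 2 := by
          gcongr
          refine (norm_add₃_le).trans ?_
          rw [norm_mul, norm_mul, norm_mul, norm_mul, Complex.norm_ofNat]
          gcongr
      _ ≤ _ := by
        nlinarith [sq_nonneg (M * (‖z₀‖ - 2 * ‖z₁‖)), sq_nonneg (M * (‖z₀‖ - ‖z₂‖)),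
          sq_nonneg (M * (2 * ‖z₁‖ - ‖z₂‖))]
  have t₃ : h ^ 4 * ‖z₂‖ ^ 2 ≤ Q ^ 2 * ‖z₀‖ ^ 2 := by
    calc h ^ 4 * ‖z₂‖ ^ 2 = (h ^ 2 * ‖z₂‖) ^ 2 := by ring
      _ ≤ (Q * ‖z₀‖) ^ 2 := by gcongr
      _ = _ := by ring
  calc _ ≤ M ^ 2 * ‖z₀‖ ^ 2 + h ^ 2 * (2 * M ^ 2 * (‖z₀‖ ^ 2 + ‖z₁‖ ^ 2))
        + h ^ 4 * (3 * M ^ 2 * (‖z₀‖ ^ 2 + 4 * ‖z₁‖ ^ 2 + ‖z₂‖ ^ 2)) := by gcongr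
    _ = M ^ 2 * ((1 + 2 * h ^ 2 + 3 * h ^ 4) * ‖z₀‖ ^ 2 + 3 * (h ^ 4 * ‖z₂‖ ^ 2)
        + (2 + 12 * h ^ 2) * (h ^ 2 * ‖z₁‖ ^ 2)) := by ring
    _ ≤ M ^ 2 * ((1 + 2 * H ^ 2 + 3 * H ^ 4) * ‖z₀‖ ^ 2 + 3 * (Q ^ 2 * ‖z₀‖ ^ 2)
        + (2 + 12 * H ^ 2) * (h ^ 2 * ‖z₁‖ ^ 2)) := by gcongr
    _ = M ^ 2 * ((1 + 2 * H ^ 2 + 3 * H ^ 4 + 3 * Q ^ 2) * ‖z₀‖ ^ 2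
        + (2 + 12 * H ^ 2) * (h ^ 2 * ‖z₁‖ ^ 2)) := by ring
    _ ≤ M ^ 2 * ((2 + 14 * H ^ 2 + 3 * H ^ 4 + 3 * Q ^ 2) * ‖z₀‖ ^ 2
        + (2 + 14 * H ^ 2 + 3 * H ^ 4 + 3 * Q ^ 2) * (h ^ 2 * ‖z₁‖ ^ 2)) := by
      gcongr ?_ * (?_ * _ + ?_ * _) <;> nlinarith [sq_nonneg H, sq_nonneg Q, sq_nonneg (H ^ 2)]
    _ = _ := by ring

/-- Lemma 6 (rapid decay on the damped region): for solutions of the complex absorbing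
potential problem with `|λ| ≤ L h` and `0 < h < σ^{β/2}`, the semiclassical `H²_h` norm of
`φv` on `(a+σ, b)` is `O(h^N)` times the `L²` norm of `φv` on `(0,b)`, for every `N`. -/
theorem stmt_15 (β a σ δ b L : ℝ) (hβ : 0 < β) (ha : 0 < a) (hσ : 0 < σ) (hδ : 0 < δ)
    (hb : 0 < b) (hab : a + σ < b - 2 * δ) (hL : 0 < L)
    (φ : ℝ → ℝ) (hφ : ContDiff ℝ (⊤ : ℕ∞) φ)
    (hφ1 : ∀ x : ℝ, x ≤ b - 2 * δ → φ x = 1)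
    (hφ0 : ∀ x : ℝ, b - δ ≤ x → φ x = 0) :
    ∀ N : ℕ, ∃ C_N > (0:ℝ), ∀ h : ℝ, 0 < h → h < σ ^ (β / 2) →
      ∀ lam : ℂ, ‖lam‖ ≤ L * h →
      ∀ v v' v'' : ℝ → ℂ,
        (∀ x ∈ Ici (0:ℝ), HasDerivWithinAt v (v' x) (Ici 0) x) →
        ContinuousOn v' (Ici 0) →
        IntegrableOn (fun x => ‖v x‖ ^ 2) (Ioi 0) →
        IntegrableOn (fun x => ‖v' x‖ ^ 2) (Ioi 0) →
        (∀ x ∈ Ioo (0:ℝ) a ∪ Ioi a, HasDerivAt v' (v'' x) x) →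
        ContinuousOn v'' (Ioo 0 a) →
        ContinuousOn v'' (Ioi a) →
        (v 0 = 0 ∨ v' 0 = 0) →
        (∀ x ∈ Ioo (0:ℝ) a ∪ Ioi a,
          -(h:ℂ) ^ 2 * v'' x + Complex.I * (((max (x - a) 0) ^ β : ℝ) : ℂ) * v x
            - lam ^ 2 * v x = 0) →
        ∫ x in Ioo (a + σ) b,
            (‖((φ x : ℝ) : ℂ) * v x‖ ^ 2
              + h ^ 2 * ‖((deriv φ x : ℝ) : ℂ) * v x + ((φ x : ℝ) : ℂ) * v' x‖ ^ 2
              + h ^ 4 * ‖((deriv (deriv φ) x : ℝ) : ℂ) * v x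
                  + 2 * ((deriv φ x : ℝ) : ℂ) * v' x + ((φ x : ℝ) : ℂ) * v'' x‖ ^ 2)
          ≤ C_N * h ^ N * ∫ x in Ioo (0:ℝ) b, ‖((φ x : ℝ) : ℂ) * v x‖ ^ 2 := by
  intro N
  set H := σ ^ (β / 2)
  have hH : 0 < H := Real.rpow_pos_of_pos hσ _
  obtain ⟨C, hC, hdecay⟩ := IsDampedSolution.exists_energy_Ioi_le_pow (a := a) hβ L
    (show a < a + σ / 2 by linarith) (show a + σ / 2 < a + σ by linarith) hH N
  have hφ' : ContDiff ℝ (⊤ : ℕ∞) (deriv φ) := (contDiff_infty_iff_deriv.1 hφ).2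
  have hφ'' : ContDiff ℝ (⊤ : ℕ∞) (deriv (deriv φ)) := (contDiff_infty_iff_deriv.1 hφ').2
  obtain ⟨M₀, hM₀⟩ := (isCompact_Icc (a := a + σ) (b := b)).exists_bound_of_continuousOn
    hφ.continuous.continuousOn
  obtain ⟨M₁, hM₁⟩ := (isCompact_Icc (a := a + σ) (b := b)).exists_bound_of_continuousOn
    hφ'.continuous.continuousOn
  obtain ⟨M₂, hM₂⟩ := (isCompact_Icc (a := a + σ) (b := b)).exists_bound_of_continuousOn
    hφ''.continuous.continuousOn
  set M := max 1 (max M₀ (max M₁ M₂))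
  have hM : 1 ≤ M := le_max_left _ _
  have hMM₀ : M₀ ≤ M := by simp [M]
  have hMM₁ : M₁ ≤ M := by simp [M]
  have hMM₂ : M₂ ≤ M := by simp [M]
  set Q := (b - a) ^ β + L ^ 2 * H ^ 2
  have hba : 0 < b - a := by linarith
  have hbβ : 0 < (b - a) ^ β := Real.rpow_pos_of_pos hba _
  have hQpos : 0 < Q := by positivity
  set C' := M ^ 2 * (2 + 14 * H ^ 2 + 3 * H ^ 4 + 3 * Q ^ 2)
  have hC'pos : 0 < C' := by positivity
  refine ⟨C' * C, by positivity, fun h hh hhH lam hlam v v' v'' hv hv'c hvi hvi' hv' _ _ _ heq => ?_⟩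
  have hhC : (h : ℂ) ≠ 0 := by exact_mod_cast hh.ne'
  have hsol : IsDampedSolution β a L h (lam ^ 2 / h ^ 2) v v' := by
    refine ⟨?_, fun x hx => ?_, fun x hx => ?_, hvi.mono_set (Ioi_subset_Ioi ha.le),
      hvi'.mono_set (Ioi_subset_Ioi ha.le)⟩
    · rw [norm_div, norm_pow, norm_pow, Complex.norm_real, Real.norm_of_nonneg hh.le,
        div_le_iff₀ (by positivity), ← mul_pow]
      gcongr
    · exact (hv x (ha.trans hx).le).hasDerivAt (Ici_mem_nhds (ha.trans hx))
    · refine (hv' x (Or.inr hx)).congr_deriv ?_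
      have := heq x (Or.inr hx)
      push_cast
      field_simp
      linear_combination -this
  have hsub : Ioi (a + σ) ⊆ Ioi a := Ioi_subset_Ioi (by linarith)
  have j1 := hsol.integrable.mono_set hsub
  have j2 := hsol.integrable'.mono_set hsub
  have hbound : ∀ x ∈ Ioo (a + σ) b,
      ‖((φ x : ℝ) : ℂ) * v x‖ ^ 2
        + h ^ 2 * ‖((deriv φ x : ℝ) : ℂ) * v x + ((φ x : ℝ) : ℂ) * v' x‖ ^ 2
        + h ^ 4 * ‖((deriv (deriv φ) x : ℝ) : ℂ) * v x
            + 2 * ((deriv φ x : ℝ) : ℂ) * v' x + ((φ x : ℝ) : ℂ) * v'' x‖ ^ 2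
      ≤ C' * (‖v x‖ ^ 2 + h ^ 2 * ‖v' x‖ ^ 2) := by
    intro x hx
    have hx' : a < x := by linarith [hx.1]
    have n₀ : ‖((φ x : ℝ) : ℂ)‖ ≤ M := by
      rw [Complex.norm_real]
      exact (hM₀ x (Ioo_subset_Icc_self hx)).trans hMM₀
    have n₁ : ‖((deriv φ x : ℝ) : ℂ)‖ ≤ M := by
      rw [Complex.norm_real]
      exact (hM₁ x (Ioo_subset_Icc_self hx)).trans hMM₁
    have n₂ : ‖((deriv (deriv φ) x : ℝ) : ℂ)‖ ≤ M := by
      rw [Complex.norm_real]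
      exact (hM₂ x (Ioo_subset_Icc_self hx)).trans hMM₂
    have hv'' : h ^ 2 * ‖v'' x‖ ≤ Q * ‖v x‖ := by
      have e : (h : ℂ) ^ 2 * v'' x
          = (Complex.I * (((max (x - a) 0) ^ β : ℝ) : ℂ) - lam ^ 2) * v x := by
        linear_combination -(heq x (Or.inr hx'))
      have e' := congrArg norm e
      rw [norm_mul, norm_mul, norm_pow, Complex.norm_real, Real.norm_of_nonneg hh.le] at e'
      rw [e']
      gcongr
      refine (norm_sub_le _ _).trans (add_le_add ?_ ?_)
      · rw [norm_mul, Complex.norm_I, one_mul, Complex.norm_real,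
          Real.norm_of_nonneg (by positivity), max_eq_left (by linarith)]
        exact Real.rpow_le_rpow (by linarith) (by linarith [hx.2]) hβ.le
      · rw [norm_pow, ← mul_pow]
        gcongr
        exact hlam.trans (by gcongr)
    exact sq_norm_sum_le n₀ n₁ n₂ hh.le hhH.le hv''
  have hgi : IntegrableOn (fun x => C' * (‖v x‖ ^ 2 + h ^ 2 * ‖v' x‖ ^ 2)) (Ioi (a + σ)) :=
    (Integrable.add j1 (j2.const_mul (h ^ 2))).const_mul C'
  have hleft : ∫ x in Ioo (a + σ) b,
            (‖((φ x : ℝ) : ℂ) * v x‖ ^ 2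
              + h ^ 2 * ‖((deriv φ x : ℝ) : ℂ) * v x + ((φ x : ℝ) : ℂ) * v' x‖ ^ 2
              + h ^ 4 * ‖((deriv (deriv φ) x : ℝ) : ℂ) * v x
                  + 2 * ((deriv φ x : ℝ) : ℂ) * v' x + ((φ x : ℝ) : ℂ) * v'' x‖ ^ 2)
      ≤ C' * ((∫ x in Ioi (a + σ), ‖v x‖ ^ 2) + h ^ 2 * ∫ x in Ioi (a + σ), ‖v' x‖ ^ 2) := by
    calc _ ≤ ∫ x in Ioo (a + σ) b, C' * (‖v x‖ ^ 2 + h ^ 2 * ‖v' x‖ ^ 2) := by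
          refine integral_mono_of_nonneg (Eventually.of_forall fun x => by positivity)
            (hgi.mono_set Ioo_subset_Ioi_self) ?_
          exact (ae_restrict_iff' measurableSet_Ioo).2 (Eventually.of_forall hbound)
      _ ≤ ∫ x in Ioi (a + σ), C' * (‖v x‖ ^ 2 + h ^ 2 * ‖v' x‖ ^ 2) :=
          setIntegral_mono_set hgi (Eventually.of_forall fun x => by positivity)
            Ioo_subset_Ioi_self.eventuallyLE
      _ = _ := by
          rw [integral_const_mul, integral_add j1 (j2.const_mul _), integral_const_mul]
  have hright : ∫ x in (a + σ / 2)..(a + σ), ‖v x‖ ^ 2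
      ≤ ∫ x in Ioo (0:ℝ) b, ‖((φ x : ℝ) : ℂ) * v x‖ ^ 2 := by
    have hint : IntegrableOn (fun x => ‖((φ x : ℝ) : ℂ) * v x‖ ^ 2) (Ioo 0 b) := by
      have hvc : ContinuousOn v (Icc 0 b) := fun x hx =>
        ((hv x hx.1).continuousWithinAt).mono Icc_subset_Ici_self
      exact ((((Complex.continuous_ofReal.comp hφ.continuous).continuousOn.mul hvc).norm.pow
        2).integrableOn_Icc).mono_set Ioo_subset_Icc_self
    have hsub' : Ioc (a + σ / 2) (a + σ) ⊆ Ioo 0 b := fun x hx =>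
      ⟨by linarith [hx.1], by linarith [hx.2]⟩
    rw [intervalIntegral.integral_of_le (by linarith)]
    calc _ = ∫ x in Ioc (a + σ / 2) (a + σ), ‖((φ x : ℝ) : ℂ) * v x‖ ^ 2 := by
          refine setIntegral_congr_fun measurableSet_Ioc fun x hx => ?_
          have : φ x = 1 := hφ1 x (by linarith [hx.2])
          simp [this]
      _ ≤ _ := setIntegral_mono_set hint (Eventually.of_forall fun x => by positivity)
          hsub'.eventuallyLE
  calc _ ≤ _ := hleft
    _ ≤ C' * (C * h ^ N * ∫ x in (a + σ / 2)..(a + σ), ‖v x‖ ^ 2) := by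
      gcongr
      exact hdecay h _ v v' hh hhH hsol
    _ ≤ C' * (C * h ^ N * ∫ x in Ioo (0:ℝ) b, ‖((φ x : ℝ) : ℂ) * v x‖ ^ 2) := by gcongr
    _ = _ := by ring
end

section
/- Let β > 0, 0 < a, 0 < σ, b > 0 with a + σ < b, and c₀ > 0. Let W : [−b,b] × [−b,b] → ℝ be given by W(x,y) = W₀(|x|) where W₀(s) = 0 for s ≤ a, W₀(s) = (s−a)^β for a < s < a+σ, and W₀ bounded measurable with W₀(s) ≥ c₀ for a+σ ≤ s ≤ b. Then there exist C > 0 and q₀ > 0 such that for every real q with |q| ≥ q₀ and every twice continuously differentiable u : [−b,b]² → ℂ vanishing on the boundary of the square, setting f := −Δu + i q W u − q² u (with Δu = ∂²u/∂x² + ∂²u/∂y²), one has ‖u‖_{L²([−b,b]²)} ≤ C·|q|^{2/(β+2)}·‖f‖_{L²([−b,b]²)}. -/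
open MeasureTheory Set

open scoped RealInnerProductSpace

/-- Fundamental theorem of calculus on `Icc c d`. -/
theorem setIntegral_Icc_eq_sub_of_hasDerivAt {c d : ℝ} (hcd : c ≤ d) {F F' : ℝ → ℝ}
    (hF : ContinuousOn F (Icc c d)) (hF' : ContinuousOn F' (Icc c d))
    (hd : ∀ x ∈ Ioo c d, HasDerivAt F (F' x) x) :
    ∫ x in Icc c d, F' x = F d - F c := by
  rw [integral_Icc_eq_integral_Ioc, ← intervalIntegral.integral_of_le hcd]
  exact intervalIntegral.integral_eq_sub_of_hasDerivAt_of_le hcd hF hd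
    (hF'.intervalIntegrable_of_Icc hcd)

theorem inner_I_mul_self (z : ℂ) : ⟪Complex.I * z, z⟫ = 0 := by
  simp [Complex.inner]; ring

/-- Inner products of `Iz` and `z` with the second derivative in the damped equation. -/
theorem inner_damped (z g : ℂ) (t μ : ℝ) :
    ⟪Complex.I * z, Complex.I * t * z - μ * z - g⟫ = t * ‖z‖ ^ 2 - ⟪Complex.I * z, g⟫ ∧
    ⟪z, Complex.I * t * z - μ * z - g⟫ = -μ * ‖z‖ ^ 2 - ⟪z, g⟫ := by
  simp only [Complex.inner, Complex.sq_norm, Complex.normSq_apply]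
  constructor <;> simp <;> ring

/-- The damped region controls `u` by the energy identity. -/
theorem integral_damping_le {b μ s : ℝ} (hb : 0 < b) (hs : s = 1 ∨ s = -1)
    {v v1 v2 g : ℝ → ℂ} {w : ℝ → ℝ}
    (hv : ContinuousOn v (Icc (-b) b)) (hv1 : ContinuousOn v1 (Icc (-b) b))
    (hv2 : ContinuousOn v2 (Icc (-b) b))
    (hd : ∀ x ∈ Ioo (-b) b, HasDerivAt v (v1 x) x)
    (hd1 : ∀ x ∈ Ioo (-b) b, HasDerivAt v1 (v2 x) x)
    (hl : v (-b) = 0) (hr : v b = 0)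
    (heq : ∀ x ∈ Icc (-b) b, v2 x = Complex.I * ((s * w x : ℝ) : ℂ) * v x - μ * v x - g x)
    (hw : IntegrableOn w (Icc (-b) b)) (hg : IntegrableOn g (Icc (-b) b)) :
    ∫ x in Icc (-b) b, w x * ‖v x‖ ^ 2 ≤ ∫ x in Icc (-b) b, ‖g x‖ * ‖v x‖ := by
  have hIv : ContinuousOn (fun x => Complex.I * v x) (Icc (-b) b) := continuousOn_const.mul hv
  have key := setIntegral_Icc_eq_sub_of_hasDerivAt (c := -b) (d := b) (by linarith)
    (F := fun x => ⟪Complex.I * v x, v1 x⟫) (F' := fun x => ⟪Complex.I * v x, v2 x⟫)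
    (hIv.inner hv1) (hIv.inner hv2) (by
      intro x hx
      have h := ((hd x hx).const_mul Complex.I).inner ℝ (hd1 x hx)
      rwa [inner_I_mul_self, add_zero] at h)
  rw [hl, hr] at key
  simp only [mul_zero, inner_zero_left, sub_zero] at key
  have hwv : IntegrableOn (fun x => w x * ‖v x‖ ^ 2) (Icc (-b) b) :=
    hw.mul_continuousOn (hv.norm.pow 2) isCompact_Icc
  have hgv : IntegrableOn (fun x => ‖g x‖ * ‖v x‖) (Icc (-b) b) :=
    IntegrableOn.mul_continuousOn hg.norm hv.norm isCompact_Icc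
  have hss : s * s = 1 := by rcases hs with rfl | rfl <;> norm_num
  have h1 : ∫ x in Icc (-b) b, (w x * ‖v x‖ ^ 2 - ‖g x‖ * ‖v x‖)
      ≤ ∫ x in Icc (-b) b, s * ⟪Complex.I * v x, v2 x⟫ := by
    refine setIntegral_mono_on (hwv.sub hgv)
      (((hIv.inner hv2).const_smul s).integrableOn_compact isCompact_Icc) measurableSet_Icc ?_
    intro x hx
    rw [heq x hx, (inner_damped _ _ _ _).1]
    have h2 : |s * ⟪Complex.I * v x, g x⟫| ≤ ‖g x‖ * ‖v x‖ := by
      have : |s| = 1 := by rcases hs with rfl | rfl <;> norm_num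
      have h := abs_real_inner_le_norm (Complex.I * v x) (g x)
      rw [abs_mul, this, one_mul, mul_comm ‖g x‖]
      rwa [norm_mul, Complex.norm_I, one_mul] at h
    have h3 : s * (s * w x * ‖v x‖ ^ 2) = w x * ‖v x‖ ^ 2 := by
      linear_combination hss * (w x * ‖v x‖ ^ 2)
    rw [mul_sub, h3]
    linarith [(abs_le.1 h2).2]
  rw [integral_sub hwv hgv, integral_const_mul, key] at h1
  linarith

/-- For spectral parameters below the Dirichlet ground state, the Poincaré inequality suffices. -/
theorem integral_sq_le_of_small {b μ s : ℝ} (hb : 0 < b) (hμ : μ ≤ 1 / (8 * b ^ 2))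
    {v v1 v2 g : ℝ → ℂ} {w : ℝ → ℝ}
    (hv : ContinuousOn v (Icc (-b) b)) (hv1 : ContinuousOn v1 (Icc (-b) b))
    (hv2 : ContinuousOn v2 (Icc (-b) b))
    (hd : ∀ x ∈ Ioo (-b) b, HasDerivAt v (v1 x) x)
    (hd1 : ∀ x ∈ Ioo (-b) b, HasDerivAt v1 (v2 x) x)
    (hl : v (-b) = 0) (hr : v b = 0)
    (heq : ∀ x ∈ Icc (-b) b, v2 x = Complex.I * ((s * w x : ℝ) : ℂ) * v x - μ * v x - g x)
    (hg : IntegrableOn g (Icc (-b) b)) :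
    ∫ x in Icc (-b) b, ‖v x‖ ^ 2 ≤ 8 * b ^ 2 * ∫ x in Icc (-b) b, ‖g x‖ * ‖v x‖ := by
  have hbb : -b ≤ b := by linarith
  have hvv : IntegrableOn (fun x => ‖v x‖ ^ 2) (Icc (-b) b) :=
    (hv.norm.pow 2).integrableOn_compact isCompact_Icc
  have hv11 : IntegrableOn (fun x => ‖v1 x‖ ^ 2) (Icc (-b) b) :=
    (hv1.norm.pow 2).integrableOn_compact isCompact_Icc
  have hgv : IntegrableOn (fun x => ‖g x‖ * ‖v x‖) (Icc (-b) b) :=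
    IntegrableOn.mul_continuousOn hg.norm hv.norm isCompact_Icc
  have key := setIntegral_Icc_eq_sub_of_hasDerivAt hbb
    (F := fun x => ⟪v x, v1 x⟫) (F' := fun x => ⟪v x, v2 x⟫ + ⟪v1 x, v1 x⟫)
    (hv.inner hv1) ((hv.inner hv2).add (hv1.inner hv1))
    (fun x hx => (hd x hx).inner ℝ (hd1 x hx))
  have poinc := setIntegral_Icc_eq_sub_of_hasDerivAt hbb
    (F := fun x => x * ‖v x‖ ^ 2) (F' := fun x => 1 * ‖v x‖ ^ 2 + x * (2 * ⟪v x, v1 x⟫))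
    (continuousOn_id.mul (hv.norm.pow 2))
    ((continuousOn_const.mul (hv.norm.pow 2)).add
      (continuousOn_id.mul (continuousOn_const.mul (hv.inner hv1))))
    (fun x hx => (hasDerivAt_id x).mul (hd x hx).norm_sq)
  simp only [hl, hr, inner_zero_left, sub_zero, norm_zero, zero_pow two_ne_zero, mul_zero]
    at key poinc
  have h1 : ∫ x in Icc (-b) b, (‖v1 x‖ ^ 2 - μ * ‖v x‖ ^ 2 - ‖g x‖ * ‖v x‖) ≤ 0 := by
    rw [← key]
    refine setIntegral_mono_on ((hv11.sub (hvv.const_mul μ)).sub hgv)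
      (((hv.inner hv2).add (hv1.inner hv1)).integrableOn_compact isCompact_Icc)
      measurableSet_Icc ?_
    intro x hx
    rw [heq x hx, (inner_damped _ _ _ _).2, real_inner_self_eq_norm_sq]
    linarith [(abs_le.1 (abs_real_inner_le_norm (v x) (g x))).2]
  have hve : IntegrableOn (fun x => ‖v1 x‖ ^ 2 - μ * ‖v x‖ ^ 2) (Icc (-b) b) :=
    hv11.sub (hvv.const_mul μ)
  rw [integral_sub hve hgv, integral_sub hv11 (hvv.const_mul μ), integral_const_mul] at h1
  have h2 : ∫ x in Icc (-b) b, (2⁻¹ * ‖v x‖ ^ 2 - 2 * b ^ 2 * ‖v1 x‖ ^ 2) ≤ 0 := by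
    rw [← poinc]
    refine setIntegral_mono_on ((hvv.const_mul _).sub (hv11.const_mul _))
      (ContinuousOn.integrableOn_compact isCompact_Icc ?_) measurableSet_Icc ?_
    · exact ((continuousOn_const.mul (hv.norm.pow 2)).add
        (continuousOn_id.mul (continuousOn_const.mul (hv.inner hv1))))
    intro x hx
    have h3 : |x * ⟪v x, v1 x⟫| ≤ b * (‖v x‖ * ‖v1 x‖) := by
      rw [abs_mul]
      exact mul_le_mul (abs_le.2 hx) (abs_real_inner_le_norm _ _) (abs_nonneg _) hb.le
    nlinarith [(abs_le.1 h3).1, sq_nonneg (‖v x‖ - 2 * b * ‖v1 x‖)]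
  rw [integral_sub (hvv.const_mul _) (hv11.const_mul _), integral_const_mul,
    integral_const_mul] at h2
  have hV : 0 ≤ ∫ x in Icc (-b) b, ‖v x‖ ^ 2 := integral_nonneg fun x => by positivity
  have h4 : 4 * b ^ 2 * (μ * ∫ x in Icc (-b) b, ‖v x‖ ^ 2)
      ≤ 4 * b ^ 2 * (1 / (8 * b ^ 2) * ∫ x in Icc (-b) b, ‖v x‖ ^ 2) := by gcongr
  have h5 : 4 * b ^ 2 * (1 / (8 * b ^ 2) * ∫ x in Icc (-b) b, ‖v x‖ ^ 2)
      = 2⁻¹ * ∫ x in Icc (-b) b, ‖v x‖ ^ 2 := by field_simp; ring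
  have h6 := mul_le_mul_of_nonneg_left h1 (by positivity : 0 ≤ 4 * b ^ 2)
  nlinarith

/-- Caccioppoli-type estimate in the transition layer. -/
theorem integral_energy_layer_le {b a δ μ s : ℝ} (ha : 0 ≤ a) (hδ : 0 < δ) (hab : a + 4 * δ ≤ b)
    (hμ : 0 ≤ μ) {v v1 v2 g : ℝ → ℂ} {w : ℝ → ℝ}
    (hv : ContinuousOn v (Icc (-b) b)) (hv1 : ContinuousOn v1 (Icc (-b) b))
    (hv2 : ContinuousOn v2 (Icc (-b) b))
    (hd : ∀ x ∈ Ioo (-b) b, HasDerivAt v (v1 x) x)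
    (hd1 : ∀ x ∈ Ioo (-b) b, HasDerivAt v1 (v2 x) x)
    (heq : ∀ x ∈ Icc (-b) b, v2 x = Complex.I * ((s * w x : ℝ) : ℂ) * v x - μ * v x - g x)
    (hw : IntegrableOn w (Icc (-b) b)) (hg : IntegrableOn g (Icc (-b) b))
    (hw0 : ∀ x ∈ Icc (-b) b, 0 ≤ w x)
    (hwl : ∀ x ∈ Icc (a + δ) b, 1 ≤ δ ^ 2 * w x) :
    2 * ∫ x in Icc (a + 2 * δ) (a + 3 * δ), (‖v1 x‖ ^ 2 + μ * ‖v x‖ ^ 2)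
      ≤ (18 + 9 * μ * δ ^ 2) * (∫ x in Icc (-b) b, w x * ‖v x‖ ^ 2)
        + 6 * ∫ x in Icc (-b) b, ‖g x‖ * ‖v x‖ := by
  have hLs : Icc (a + δ) (a + 4 * δ) ⊆ Icc (-b) b := Icc_subset_Icc (by linarith) hab
  have hLo : Ioo (a + δ) (a + 4 * δ) ⊆ Ioo (-b) b := Ioo_subset_Ioo (by linarith) hab
  have hTs : Icc (a + 2 * δ) (a + 3 * δ) ⊆ Icc (a + δ) (a + 4 * δ) :=
    Icc_subset_Icc (by linarith) (by linarith)
  have hwv : IntegrableOn (fun x => w x * ‖v x‖ ^ 2) (Icc (-b) b) :=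
    hw.mul_continuousOn (hv.norm.pow 2) isCompact_Icc
  have hgv : IntegrableOn (fun x => ‖g x‖ * ‖v x‖) (Icc (-b) b) :=
    IntegrableOn.mul_continuousOn hg.norm hv.norm isCompact_Icc
  have he : ContinuousOn (fun x => ‖v1 x‖ ^ 2 + μ * ‖v x‖ ^ 2) (Icc (-b) b) :=
    (hv1.norm.pow 2).add (continuousOn_const.mul (hv.norm.pow 2))
  set p : ℝ → ℝ := fun x => (x - (a + δ)) * (a + 4 * δ - x) with hp
  set p' : ℝ → ℝ := fun x => 1 * (a + 4 * δ - x) + (x - (a + δ)) * (-1) with hp'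
  have hpc : Continuous p := by fun_prop
  have hpc' : Continuous p' := by fun_prop
  have hpd : ∀ x, HasDerivAt p (p' x) x := fun x =>
    ((hasDerivAt_id x).sub_const _).mul ((hasDerivAt_id x).const_sub _)
  set F' : ℝ → ℝ := fun x => (2 * p x * p' x) * ⟪v x, v1 x⟫ +
    p x ^ 2 * (⟪v x, v2 x⟫ + ⟪v1 x, v1 x⟫) with hF'
  have hFc : ContinuousOn F' (Icc (a + δ) (a + 4 * δ)) := by
    have h1 := (hv.inner (𝕜 := ℝ) hv1).mono hLs
    have h2 := ((hv.inner (𝕜 := ℝ) hv2).add (hv1.inner hv1)).mono hLs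
    exact (((continuousOn_const.mul hpc.continuousOn).mul hpc'.continuousOn).mul h1).add
      ((hpc.continuousOn.pow 2).mul h2)
  have key := setIntegral_Icc_eq_sub_of_hasDerivAt (c := a + δ) (d := a + 4 * δ) (by linarith)
    (F := fun x => p x ^ 2 * ⟪v x, v1 x⟫) (F' := F')
    ((hpc.continuousOn.pow 2).mul ((hv.inner hv1).mono hLs)) hFc (by
      intro x hx
      have h := ((hpd x).pow 2).mul ((hd x (hLo hx)).inner ℝ (hd1 x (hLo hx)))
      exact h.congr_deriv (by simp [hF']))
  have hp1 : p (a + δ) = 0 := by simp [hp]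
  have hp2 : p (a + 4 * δ) = 0 := by simp [hp]
  simp only [hp1, hp2, zero_pow two_ne_zero, zero_mul, sub_zero] at key
  set R : ℝ → ℝ := fun x => (18 * δ ^ 4 + 9 * μ * δ ^ 6) * (w x * ‖v x‖ ^ 2)
    + 6 * δ ^ 4 * (‖g x‖ * ‖v x‖) with hR
  have hRi : IntegrableOn R (Icc (-b) b) := (hwv.const_mul _).add (hgv.const_mul _)
  have hpt : ∀ x ∈ Icc (a + δ) (a + 4 * δ),
      p x ^ 2 / 2 * (‖v1 x‖ ^ 2 + μ * ‖v x‖ ^ 2) ≤ F' x + R x := by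
    intro x hx
    have hxb := hLs hx
    have hp0 : 0 ≤ p x := mul_nonneg (by linarith [hx.1]) (by linarith [hx.2])
    have hple : p x ^ 2 ≤ 6 * δ ^ 4 := by
      have h1 : p x ≤ 9 / 4 * δ ^ 2 := by
        simp only [hp]; nlinarith [sq_nonneg ((x - (a + δ)) - (a + 4 * δ - x))]
      have h2 := pow_le_pow_left₀ hp0 h1 2
      nlinarith [pow_pos hδ 4]
    have hple' : p' x ^ 2 ≤ 9 * δ ^ 2 := by
      have : |p' x| ≤ 3 * δ := by
        rw [abs_le]; simp only [hp']; constructor <;> linarith [hx.1, hx.2]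
      have := pow_le_pow_left₀ (abs_nonneg _) this 2
      rw [sq_abs] at this; linarith
    have hwx : ‖v x‖ ^ 2 ≤ δ ^ 2 * (w x * ‖v x‖ ^ 2) := by
      have := mul_le_mul_of_nonneg_right (hwl x ⟨hx.1, hx.2.trans hab⟩) (sq_nonneg ‖v x‖)
      linarith
    have hi1 := (abs_le.1 (abs_real_inner_le_norm (v x) (v1 x)))
    have hi2 := (abs_le.1 (abs_real_inner_le_norm (v x) (g x)))
    have hcross : -(p x ^ 2 / 2 * ‖v1 x‖ ^ 2 + 2 * p' x ^ 2 * ‖v x‖ ^ 2)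
        ≤ (2 * p x * p' x) * ⟪v x, v1 x⟫ := by
      have h1 : |p x * p' x * ⟪v x, v1 x⟫| ≤ |p x| * |p' x| * (‖v x‖ * ‖v1 x‖) := by
        rw [abs_mul, abs_mul]
        exact mul_le_mul_of_nonneg_left (abs_real_inner_le_norm _ _) (by positivity)
      have h2 := (abs_le.1 h1).1
      nlinarith [sq_nonneg (|p x| * ‖v1 x‖ - 2 * |p' x| * ‖v x‖), sq_abs (p x), sq_abs (p' x)]
    have hgterm : p x ^ 2 * ⟪v x, g x⟫ ≤ 6 * δ ^ 4 * (‖g x‖ * ‖v x‖) :=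
      (mul_le_mul_of_nonneg_left hi2.2 (sq_nonneg _)).trans (by
        rw [mul_comm ‖g x‖]
        exact mul_le_mul_of_nonneg_right hple (by positivity))
    have hv2' : 2 * p' x ^ 2 * ‖v x‖ ^ 2 ≤ 18 * δ ^ 4 * (w x * ‖v x‖ ^ 2) := by
      have h1 := mul_le_mul_of_nonneg_right hple' (sq_nonneg ‖v x‖)
      have h2 := mul_le_mul_of_nonneg_left hwx (by positivity : 0 ≤ 18 * δ ^ 2)
      nlinarith
    have hμ' : 3 / 2 * μ * (p x ^ 2 * ‖v x‖ ^ 2) ≤ 9 * μ * δ ^ 6 * (w x * ‖v x‖ ^ 2) := by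
      have h1 := mul_le_mul_of_nonneg_right hple (sq_nonneg ‖v x‖)
      have h2 := mul_le_mul_of_nonneg_left hwx (by positivity : 0 ≤ 6 * δ ^ 4)
      have h3 := mul_le_mul_of_nonneg_left (h1.trans h2) (by positivity : 0 ≤ 3 / 2 * μ)
      linarith
    simp only [hF', hR]
    rw [heq x hxb, (inner_damped _ _ _ _).2, real_inner_self_eq_norm_sq]
    linarith
  have h1 : ∫ x in Icc (a + 2 * δ) (a + 3 * δ), 2 * δ ^ 4 * (‖v1 x‖ ^ 2 + μ * ‖v x‖ ^ 2)
      ≤ ∫ x in Icc (a + 2 * δ) (a + 3 * δ), p x ^ 2 / 2 * (‖v1 x‖ ^ 2 + μ * ‖v x‖ ^ 2) := by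
    have he' := he.mono (hTs.trans hLs)
    refine setIntegral_mono_on
      ((continuousOn_const.mul he').integrableOn_compact isCompact_Icc)
      ((((hpc.continuousOn.pow 2).div_const _).mul he').integrableOn_compact isCompact_Icc)
      measurableSet_Icc fun x hx => ?_
    refine mul_le_mul_of_nonneg_right ?_ (by positivity)
    have h2 : 2 * δ ^ 2 ≤ p x := by
      simp only [hp]
      nlinarith [mul_nonneg (sub_nonneg.2 hx.1) (sub_nonneg.2 hx.2)]
    have h3 := pow_le_pow_left₀ (by positivity) h2 2
    nlinarith
  have hpi : IntegrableOn (fun x => p x ^ 2 / 2 * (‖v1 x‖ ^ 2 + μ * ‖v x‖ ^ 2))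
      (Icc (a + δ) (a + 4 * δ)) :=
    (((hpc.continuousOn.pow 2).div_const _).mul (he.mono hLs)).integrableOn_compact isCompact_Icc
  have h2 := setIntegral_mono_set hpi
    (Filter.Eventually.of_forall fun x => by dsimp only [Pi.zero_apply]; positivity) hTs.eventuallyLE
  have hFi : IntegrableOn F' (Icc (a + δ) (a + 4 * δ)) := hFc.integrableOn_compact isCompact_Icc
  have h3 := setIntegral_mono_on hpi (hFi.add (hRi.mono_set hLs)) measurableSet_Icc hpt
  have h3' : ∫ x in Icc (a + δ) (a + 4 * δ), (F' + R) x
      = ∫ x in Icc (a + δ) (a + 4 * δ), R x := by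
    simp only [Pi.add_apply]
    rw [integral_add hFi (hRi.mono_set hLs), key, zero_add]
  have h4 : ∫ x in Icc (a + δ) (a + 4 * δ), R x ≤ ∫ x in Icc (-b) b, R x := by
    refine setIntegral_mono_set hRi ?_ hLs.eventuallyLE
    filter_upwards [ae_restrict_mem measurableSet_Icc] with x hx
    have := hw0 x hx
    simp only [Pi.zero_apply, hR]
    positivity
  have h5 : ∫ x in Icc (-b) b, R x = (18 * δ ^ 4 + 9 * μ * δ ^ 6) *
      (∫ x in Icc (-b) b, w x * ‖v x‖ ^ 2) + 6 * δ ^ 4 * ∫ x in Icc (-b) b, ‖g x‖ * ‖v x‖ := by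
    simp only [hR]
    rw [integral_add (hwv.const_mul _) (hgv.const_mul _), integral_const_mul, integral_const_mul]
  rw [integral_const_mul] at h1
  have h6 := h1.trans (h2.trans (h3.trans (h3'.le.trans (h4.trans h5.le))))
  refine le_of_mul_le_mul_left ?_ (pow_pos hδ 4)
  linarith

/-- Averaging a function with controlled derivative against a subinterval. -/
theorem mul_integral_le_of_abs_deriv_le {c d t₀ t₁ : ℝ} (hc : c ≤ t₀) (ht : t₀ ≤ t₁) (hd : t₁ ≤ d)
    {e e' R : ℝ → ℝ} (he : ContinuousOn e (Icc c d)) (he' : ContinuousOn e' (Icc c d))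
    (hed : ∀ x ∈ Ioo c d, HasDerivAt e (e' x) x) (hR : IntegrableOn R (Icc c d))
    (heR : ∀ x ∈ Icc c d, |e' x| ≤ R x) :
    (t₁ - t₀) * ∫ x in Icc c d, e x
      ≤ (d - c) * ((∫ x in Icc t₀ t₁, e x) + (t₁ - t₀) * ∫ x in Icc c d, R x) := by
  have hcd : c ≤ d := hc.trans (ht.trans hd)
  have hTs : Icc t₀ t₁ ⊆ Icc c d := Icc_subset_Icc hc hd
  have hmain : ∀ x ∈ Icc c d, ∀ t ∈ Icc c d, t ≤ x → |e x - e t| ≤ ∫ y in Icc c d, R y := by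
    intro x hx t ht' htx
    have hs : Icc t x ⊆ Icc c d := Icc_subset_Icc ht'.1 hx.2
    rw [← setIntegral_Icc_eq_sub_of_hasDerivAt htx (he.mono hs) (he'.mono hs)
      fun y hy => hed y (Ioo_subset_Ioo ht'.1 hx.2 hy)]
    have h1 : ‖∫ y in Icc t x, e' y‖ ≤ ∫ y in Icc t x, R y :=
      norm_integral_le_of_norm_le (hR.mono_set hs)
        ((ae_restrict_mem measurableSet_Icc).mono fun y hy => heR y (hs hy))
    refine h1.trans (setIntegral_mono_set hR ?_ hs.eventuallyLE)
    filter_upwards [ae_restrict_mem measurableSet_Icc] with y hy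
    exact (abs_nonneg _).trans (heR y hy)
  have hpair : ∀ x ∈ Icc c d, ∀ t ∈ Icc c d, e x ≤ e t + ∫ y in Icc c d, R y := by
    intro x hx t ht'
    rcases le_total t x with h | h
    · linarith [(abs_le.1 (hmain x hx t ht' h)).2]
    · linarith [(abs_le.1 (hmain t ht' x hx h)).1]
  have hconst : ∀ {s₀ s₁ : ℝ} (K : ℝ), s₀ ≤ s₁ → ∫ _ in Icc s₀ s₁, K = (s₁ - s₀) * K := by
    intro s₀ s₁ K h
    simp [h]
  have hT : IntegrableOn e (Icc t₀ t₁) := (he.mono hTs).integrableOn_compact isCompact_Icc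
  have hci : ∀ (s₀ s₁ K : ℝ), IntegrableOn (fun _ => K) (Icc s₀ s₁) := fun s₀ s₁ K =>
    continuousOn_const.integrableOn_compact isCompact_Icc
  have h1 : ∀ x ∈ Icc c d, (t₁ - t₀) * e x
      ≤ (∫ t in Icc t₀ t₁, e t) + (t₁ - t₀) * ∫ y in Icc c d, R y := by
    intro x hx
    have h := setIntegral_mono_on (hci t₀ t₁ (e x)) (hT.add (hci t₀ t₁ (∫ y in Icc c d, R y)))
      measurableSet_Icc fun t ht' => hpair x hx t (hTs ht')
    rw [hconst _ ht] at h
    simp only [Pi.add_apply] at h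
    rwa [integral_add hT (hci _ _ _), hconst _ ht] at h
  have h2 := setIntegral_mono_on ((he.integrableOn_compact isCompact_Icc).const_mul (t₁ - t₀))
    (hci c d _) measurableSet_Icc h1
  rwa [integral_const_mul, hconst _ hcd] at h2

/-- The energy on the core `|x| ≤ a + 3δ` is controlled by the energy in the transition layer. -/
theorem integral_energy_core_le {b a δ μ s A : ℝ} (ha : 0 ≤ a) (hδ : 0 < δ)
    (hab : a + 4 * δ ≤ b) (hs : s = 1 ∨ s = -1) (hμ : 0 ≤ μ)
    {v v1 v2 g : ℝ → ℂ} {w : ℝ → ℝ}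
    (hv : ContinuousOn v (Icc (-b) b)) (hv1 : ContinuousOn v1 (Icc (-b) b))
    (hv2 : ContinuousOn v2 (Icc (-b) b))
    (hd : ∀ x ∈ Ioo (-b) b, HasDerivAt v (v1 x) x)
    (hd1 : ∀ x ∈ Ioo (-b) b, HasDerivAt v1 (v2 x) x)
    (heq : ∀ x ∈ Icc (-b) b, v2 x = Complex.I * ((s * w x : ℝ) : ℂ) * v x - μ * v x - g x)
    (hw : IntegrableOn w (Icc (-b) b))
    (hg2 : IntegrableOn (fun x => ‖g x‖ ^ 2) (Icc (-b) b))
    (hw0 : ∀ x ∈ Icc (-b) b, 0 ≤ w x)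
    (hwA : ∀ x ∈ Icc (-(a + 3 * δ)) (a + 3 * δ), w x ≤ A) :
    δ * ∫ x in Icc (-(a + 3 * δ)) (a + 3 * δ), (‖v1 x‖ ^ 2 + μ * ‖v x‖ ^ 2)
      ≤ 4 * b * (∫ x in Icc (a + 2 * δ) (a + 3 * δ), (‖v1 x‖ ^ 2 + μ * ‖v x‖ ^ 2))
        + 32 * b ^ 2 * δ * (A * (∫ x in Icc (-b) b, w x * ‖v x‖ ^ 2)
          + ∫ x in Icc (-b) b, ‖g x‖ ^ 2) := by
  have hb : 0 < b := by linarith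
  have hJs : Icc (-(a + 3 * δ)) (a + 3 * δ) ⊆ Icc (-b) b :=
    Icc_subset_Icc (by linarith) (by linarith)
  have hJo : Ioo (-(a + 3 * δ)) (a + 3 * δ) ⊆ Ioo (-b) b :=
    Ioo_subset_Ioo (by linarith) (by linarith)
  have hA : 0 ≤ A :=
    (hw0 0 ⟨by linarith, hb.le⟩).trans (hwA 0 ⟨by linarith, by linarith⟩)
  have he : ContinuousOn (fun x => ‖v1 x‖ ^ 2 + μ * ‖v x‖ ^ 2) (Icc (-b) b) :=
    (hv1.norm.pow 2).add (continuousOn_const.mul (hv.norm.pow 2))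
  have he' : ContinuousOn (fun x => 2 * ⟪v1 x, v2 x⟫ + μ * (2 * ⟪v x, v1 x⟫)) (Icc (-b) b) :=
    (continuousOn_const.mul (hv1.inner hv2)).add
      (continuousOn_const.mul (continuousOn_const.mul (hv.inner hv1)))
  have hwv : IntegrableOn (fun x => w x * ‖v x‖ ^ 2) (Icc (-b) b) :=
    hw.mul_continuousOn (hv.norm.pow 2) isCompact_Icc
  have hv11 : IntegrableOn (fun x => ‖v1 x‖ ^ 2) (Icc (-b) b) :=
    (hv1.norm.pow 2).integrableOn_compact isCompact_Icc
  set S : ℝ → ℝ := fun x => 8 * b * (A * (w x * ‖v x‖ ^ 2) + ‖g x‖ ^ 2) with hS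
  have hSi : IntegrableOn S (Icc (-b) b) := ((hwv.const_mul _).add hg2).const_mul _
  have hRi : IntegrableOn (fun x => 1 / (4 * b) * ‖v1 x‖ ^ 2 + S x) (Icc (-b) b) :=
    (hv11.const_mul _).add hSi
  have hosc := mul_integral_le_of_abs_deriv_le (c := -(a + 3 * δ)) (d := a + 3 * δ)
    (t₀ := a + 2 * δ) (t₁ := a + 3 * δ) (by linarith) (by linarith) le_rfl (he.mono hJs)
    (he'.mono hJs)
    (fun x hx => (hd1 x (hJo hx)).norm_sq.add ((hd x (hJo hx)).norm_sq.const_mul μ))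
    (R := fun x => 1 / (4 * b) * ‖v1 x‖ ^ 2 + S x)
    (hRi.mono_set hJs) (by
      intro x hx
      have hxb := hJs hx
      have h1 : 2 * ⟪v1 x, v2 x⟫ + μ * (2 * ⟪v x, v1 x⟫)
          = 2 * ⟪v1 x, Complex.I * ((s * w x : ℝ) : ℂ) * v x⟫ - 2 * ⟪v1 x, g x⟫ := by
        rw [heq x hxb, inner_sub_right, inner_sub_right, real_inner_comm (v1 x) (v x),
          ← Complex.real_smul (x := μ), inner_smul_right]
        ring
      have hn : ‖Complex.I * ((s * w x : ℝ) : ℂ) * v x‖ = w x * ‖v x‖ := by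
        have : |s| = 1 := by rcases hs with rfl | rfl <;> norm_num
        rw [norm_mul, norm_mul, Complex.norm_I, one_mul, Complex.norm_real, Real.norm_eq_abs,
          abs_mul, this, one_mul, abs_of_nonneg (hw0 x hxb)]
      have h2 := abs_real_inner_le_norm (v1 x) (Complex.I * ((s * w x : ℝ) : ℂ) * v x)
      have h3 := abs_real_inner_le_norm (v1 x) (g x)
      rw [hn] at h2
      have hyoung : ∀ X Y : ℝ, 2 * (X * Y) ≤ 1 / (8 * b) * X ^ 2 + 8 * b * Y ^ 2 := by
        intro X Y
        have : 1 / (8 * b) * X ^ 2 + 8 * b * Y ^ 2 - 2 * (X * Y)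
            = 1 / (8 * b) * (X - 8 * b * Y) ^ 2 := by field_simp; ring
        have : 0 ≤ 1 / (8 * b) * (X - 8 * b * Y) ^ 2 := by positivity
        linarith
      have h4 := hyoung ‖v1 x‖ (w x * ‖v x‖)
      have h5 := hyoung ‖v1 x‖ ‖g x‖
      have h6 : (w x * ‖v x‖) ^ 2 ≤ A * (w x * ‖v x‖ ^ 2) := by
        have := mul_le_mul_of_nonneg_right (hwA x hx)
          (mul_nonneg (hw0 x hxb) (sq_nonneg ‖v x‖))
        nlinarith
      have h7 := mul_le_mul_of_nonneg_left h6 (by positivity : 0 ≤ 8 * b)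
      have h8 : 1 / (4 * b) * ‖v1 x‖ ^ 2
          = 1 / (8 * b) * ‖v1 x‖ ^ 2 + 1 / (8 * b) * ‖v1 x‖ ^ 2 := by field_simp; ring
      rw [h1, abs_le]
      simp only [hS]
      constructor <;> linarith [(abs_le.1 h2).1, (abs_le.1 h2).2, (abs_le.1 h3).1, (abs_le.1 h3).2])
  rw [integral_add (IntegrableOn.mono_set (hv11.const_mul _) hJs) (hSi.mono_set hJs),
    integral_const_mul] at hosc
  have hSJ : ∫ x in Icc (-(a + 3 * δ)) (a + 3 * δ), S x ≤ ∫ x in Icc (-b) b, S x := by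
    refine setIntegral_mono_set hSi ?_ hJs.eventuallyLE
    filter_upwards [ae_restrict_mem measurableSet_Icc] with x hx
    have := hw0 x hx
    simp only [Pi.zero_apply, hS]
    positivity
  have hSe : ∫ x in Icc (-b) b, S x = 8 * b * (A * (∫ x in Icc (-b) b, w x * ‖v x‖ ^ 2)
      + ∫ x in Icc (-b) b, ‖g x‖ ^ 2) := by
    simp only [hS]
    rw [integral_const_mul, integral_add (hwv.const_mul _) hg2, integral_const_mul]
  rw [hSe] at hSJ
  have hvE : ∫ x in Icc (-(a + 3 * δ)) (a + 3 * δ), ‖v1 x‖ ^ 2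
      ≤ ∫ x in Icc (-(a + 3 * δ)) (a + 3 * δ), (‖v1 x‖ ^ 2 + μ * ‖v x‖ ^ 2) :=
    setIntegral_mono_on (hv11.mono_set hJs) ((he.mono hJs).integrableOn_compact isCompact_Icc)
      measurableSet_Icc fun x _ => le_add_of_nonneg_right (by positivity)
  have hT0 : 0 ≤ ∫ x in Icc (a + 2 * δ) (a + 3 * δ), (‖v1 x‖ ^ 2 + μ * ‖v x‖ ^ 2) :=
    integral_nonneg fun x => by positivity
  have hE0 : 0 ≤ ∫ x in Icc (-(a + 3 * δ)) (a + 3 * δ), (‖v1 x‖ ^ 2 + μ * ‖v x‖ ^ 2) :=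
    integral_nonneg fun x => by positivity
  have hNw : 0 ≤ ∫ x in Icc (-b) b, w x * ‖v x‖ ^ 2 :=
    setIntegral_nonneg measurableSet_Icc fun x hx => mul_nonneg (hw0 x hx) (by positivity)
  have hG : 0 ≤ ∫ x in Icc (-b) b, ‖g x‖ ^ 2 := integral_nonneg fun x => by positivity
  generalize (∫ x in Icc (-(a + 3 * δ)) (a + 3 * δ), (‖v1 x‖ ^ 2 + μ * ‖v x‖ ^ 2)) = E at *
  generalize (∫ x in Icc (a + 2 * δ) (a + 3 * δ), (‖v1 x‖ ^ 2 + μ * ‖v x‖ ^ 2)) = T at *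
  generalize (∫ x in Icc (-(a + 3 * δ)) (a + 3 * δ), ‖v1 x‖ ^ 2) = D at *
  generalize (∫ x in Icc (-(a + 3 * δ)) (a + 3 * δ), S x) = SJ at *
  generalize (∫ x in Icc (-b) b, w x * ‖v x‖ ^ 2) = N at *
  generalize (∫ x in Icc (-b) b, ‖g x‖ ^ 2) = G at *
  have e1 : a + 3 * δ - (a + 2 * δ) = δ := by ring
  have e2 : a + 3 * δ - -(a + 3 * δ) ≤ 2 * b := by linarith
  rw [e1] at hosc
  have hB : 1 / (4 * b) * D + SJ ≤ 1 / (4 * b) * E + 8 * b * (A * N + G) := by gcongr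
  have h9 : δ * E ≤ 2 * b * (T + δ * (1 / (4 * b) * E + 8 * b * (A * N + G))) := by
    refine hosc.trans ((mul_le_mul_of_nonneg_left ?_ (by linarith)).trans
      (mul_le_mul_of_nonneg_right e2 ?_))
    · gcongr
    · positivity
  have h10 : 2 * b * (T + δ * (1 / (4 * b) * E + 8 * b * (A * N + G)))
      = 2 * b * T + δ * E / 2 + 16 * b ^ 2 * δ * (A * N + G) := by field_simp; ring
  linarith

/-- The one-dimensional resolvent estimate, uniform in the spectral parameter `μ`. -/
theorem integral_sq_le_of_damped {b a δ μ s M : ℝ} (ha : 0 ≤ a) (hδ : 0 < δ) (hδ1 : δ ≤ 1)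
    (hab : a + 4 * δ ≤ b) (hs : s = 1 ∨ s = -1)
    {v v1 v2 g : ℝ → ℂ} {w : ℝ → ℝ}
    (hv : ContinuousOn v (Icc (-b) b)) (hv1 : ContinuousOn v1 (Icc (-b) b))
    (hv2 : ContinuousOn v2 (Icc (-b) b))
    (hd : ∀ x ∈ Ioo (-b) b, HasDerivAt v (v1 x) x)
    (hd1 : ∀ x ∈ Ioo (-b) b, HasDerivAt v1 (v2 x) x)
    (hl : v (-b) = 0) (hr : v b = 0)
    (heq : ∀ x ∈ Icc (-b) b, v2 x = Complex.I * ((s * w x : ℝ) : ℂ) * v x - μ * v x - g x)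
    (hw : IntegrableOn w (Icc (-b) b)) (hg : IntegrableOn g (Icc (-b) b))
    (hg2 : IntegrableOn (fun x => ‖g x‖ ^ 2) (Icc (-b) b))
    (hw0 : ∀ x ∈ Icc (-b) b, 0 ≤ w x)
    (hwM : ∀ x ∈ Icc (-b) b, |x| ≤ a + 3 * δ → δ ^ 2 * w x ≤ M)
    (hwl : ∀ x ∈ Icc (-b) b, a + δ ≤ |x| → 1 ≤ δ ^ 2 * w x) :
    δ ^ 4 * ∫ x in Icc (-b) b, ‖v x‖ ^ 2
      ≤ (((48 * b + 32 * b ^ 2 * M) * (8 * b ^ 2) + 20 * b + 1 + 8 * b ^ 2) ^ 2 + 512 * b ^ 4)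
        * ∫ x in Icc (-b) b, ‖g x‖ ^ 2 := by
  have hb : 0 < b := by linarith
  have hJs : Icc (-(a + 3 * δ)) (a + 3 * δ) ⊆ Icc (-b) b :=
    Icc_subset_Icc (by linarith) (by linarith)
  have hM : 0 ≤ M := by
    have h0 : (0 : ℝ) ∈ Icc (-b) b := ⟨by linarith, hb.le⟩
    refine le_trans ?_ (hwM 0 h0 (by rw [abs_zero]; positivity))
    exact mul_nonneg (sq_nonneg δ) (hw0 0 h0)
  have hvv : IntegrableOn (fun x => ‖v x‖ ^ 2) (Icc (-b) b) :=
    (hv.norm.pow 2).integrableOn_compact isCompact_Icc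
  have hwv : IntegrableOn (fun x => w x * ‖v x‖ ^ 2) (Icc (-b) b) :=
    hw.mul_continuousOn (hv.norm.pow 2) isCompact_Icc
  have hgv : IntegrableOn (fun x => ‖g x‖ * ‖v x‖) (Icc (-b) b) :=
    IntegrableOn.mul_continuousOn hg.norm hv.norm isCompact_Icc
  set K₁ : ℝ := (48 * b + 32 * b ^ 2 * M) * (8 * b ^ 2) + 20 * b with hK₁
  have hK₁0 : 0 ≤ K₁ := by positivity
  have hN0 : 0 ≤ ∫ x in Icc (-b) b, ‖g x‖ * ‖v x‖ := integral_nonneg fun x => by positivity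
  have hG0 : 0 ≤ ∫ x in Icc (-b) b, ‖g x‖ ^ 2 := integral_nonneg fun x => by positivity
  have hNw := integral_damping_le hb hs hv hv1 hv2 hd hd1 hl hr heq hw hg
  have hδ2 : δ ^ 2 ≤ 1 := pow_le_one₀ hδ.le hδ1
  have hmain : δ ^ 2 * ∫ x in Icc (-b) b, ‖v x‖ ^ 2
      ≤ (K₁ + 1 + 8 * b ^ 2) * (∫ x in Icc (-b) b, ‖g x‖ * ‖v x‖)
        + 256 * b ^ 4 * ∫ x in Icc (-b) b, ‖g x‖ ^ 2 := by
    rcases le_total μ (1 / (8 * b ^ 2)) with hμ | hμ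
    · have h1 := integral_sq_le_of_small hb hμ hv hv1 hv2 hd hd1 hl hr heq hg
      have h2 : δ ^ 2 * ∫ x in Icc (-b) b, ‖v x‖ ^ 2 ≤ 1 * ∫ x in Icc (-b) b, ‖v x‖ ^ 2 :=
        mul_le_mul_of_nonneg_right hδ2 (integral_nonneg fun x => by positivity)
      have h3 : 0 ≤ (K₁ + 1) * (∫ x in Icc (-b) b, ‖g x‖ * ‖v x‖)
        + 256 * b ^ 4 * ∫ x in Icc (-b) b, ‖g x‖ ^ 2 := by positivity
      linarith
    have hμ0 : 0 < μ := lt_of_lt_of_le (by positivity) hμ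
    have hμ1 : 1 ≤ 8 * b ^ 2 * μ := by
      rwa [div_le_iff₀ (by positivity), mul_comm] at hμ
    have hT := integral_energy_layer_le ha hδ hab hμ0.le hv hv1 hv2 hd hd1 heq hw hg hw0
      fun x hx => hwl x ⟨by linarith [hx.1], hx.2⟩ (hx.1.trans (le_abs_self x))
    have hE := integral_energy_core_le (A := M / δ ^ 2) ha hδ hab hs hμ0.le hv hv1 hv2 hd hd1 heq
      hw hg2 hw0 fun x hx => by
        rw [le_div_iff₀ (by positivity), mul_comm]
        exact hwM x (hJs hx) (abs_le.2 hx)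
    have hVJ : μ * ∫ x in Icc (-(a + 3 * δ)) (a + 3 * δ), ‖v x‖ ^ 2
        ≤ ∫ x in Icc (-(a + 3 * δ)) (a + 3 * δ), (‖v1 x‖ ^ 2 + μ * ‖v x‖ ^ 2) := by
      rw [← integral_const_mul]
      refine setIntegral_mono_on (IntegrableOn.mono_set (hvv.const_mul μ) hJs) ?_
        measurableSet_Icc fun x _ => le_add_of_nonneg_left (by positivity)
      exact (((hv1.norm.pow 2).add (continuousOn_const.mul (hv.norm.pow 2))).mono
        hJs).integrableOn_compact isCompact_Icc
    have hV : ∫ x in Icc (-b) b, ‖v x‖ ^ 2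
        ≤ (∫ x in Icc (-(a + 3 * δ)) (a + 3 * δ), ‖v x‖ ^ 2)
          + δ ^ 2 * ∫ x in Icc (-b) b, w x * ‖v x‖ ^ 2 := by
      have hi : IntegrableOn ((Icc (-(a + 3 * δ)) (a + 3 * δ)).indicator fun x => ‖v x‖ ^ 2)
          (Icc (-b) b) := Integrable.indicator hvv measurableSet_Icc
      have h1 : ∫ x in Icc (-b) b, (Icc (-(a + 3 * δ)) (a + 3 * δ)).indicator
          (fun x => ‖v x‖ ^ 2) x = ∫ x in Icc (-(a + 3 * δ)) (a + 3 * δ), ‖v x‖ ^ 2 := by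
        rw [setIntegral_indicator measurableSet_Icc, inter_eq_self_of_subset_right hJs]
      rw [← h1, ← integral_const_mul, ← integral_add hi (hwv.const_mul _)]
      refine setIntegral_mono_on hvv (hi.add (hwv.const_mul _)) measurableSet_Icc fun x hx => ?_
      have h2 := mul_nonneg (sq_nonneg δ) (mul_nonneg (hw0 x hx) (sq_nonneg ‖v x‖))
      by_cases hxJ : x ∈ Icc (-(a + 3 * δ)) (a + 3 * δ)
      · rw [indicator_of_mem hxJ]
        linarith
      · rw [indicator_of_notMem hxJ]
        have h3 : a + δ ≤ |x| := by
          by_contra hlt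
          exact hxJ (abs_le.1 (by linarith))
        have := mul_le_mul_of_nonneg_right (hwl x hx h3) (sq_nonneg ‖v x‖)
        linarith
    generalize (∫ x in Icc (-(a + 3 * δ)) (a + 3 * δ), (‖v1 x‖ ^ 2 + μ * ‖v x‖ ^ 2)) = E at *
    generalize (∫ x in Icc (a + 2 * δ) (a + 3 * δ), (‖v1 x‖ ^ 2 + μ * ‖v x‖ ^ 2)) = T at *
    generalize (∫ x in Icc (-(a + 3 * δ)) (a + 3 * δ), ‖v x‖ ^ 2) = VJ at *
    generalize (∫ x in Icc (-b) b, w x * ‖v x‖ ^ 2) = W at *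
    generalize (∫ x in Icc (-b) b, ‖g x‖ * ‖v x‖) = N at *
    generalize (∫ x in Icc (-b) b, ‖g x‖ ^ 2) = G at *
    generalize (∫ x in Icc (-b) b, ‖v x‖ ^ 2) = V at *
    have hT' : T ≤ (12 + 5 * μ * δ ^ 2) * N := by
      have := mul_le_mul_of_nonneg_left hNw (by positivity : 0 ≤ 18 + 9 * μ * δ ^ 2)
      have : 0 ≤ μ * δ ^ 2 * N := by positivity
      linarith
    have h1 : δ * E ≤ 4 * b * ((12 + 5 * μ * δ ^ 2) * N)
        + 32 * b ^ 2 * δ * (M / δ ^ 2 * N + G) := hE.trans (by gcongr)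
    have h2 : δ ^ 2 * E ≤ (48 * b * δ + 20 * b * μ * δ ^ 3 + 32 * b ^ 2 * M) * N
        + 32 * b ^ 2 * δ ^ 2 * G := by
      have h3 := mul_le_mul_of_nonneg_left h1 hδ.le
      have h4 : δ * (4 * b * ((12 + 5 * μ * δ ^ 2) * N)
          + 32 * b ^ 2 * δ * (M / δ ^ 2 * N + G))
          = (48 * b * δ + 20 * b * μ * δ ^ 3 + 32 * b ^ 2 * M) * N
          + 32 * b ^ 2 * δ ^ 2 * G := by field_simp; ring
      linarith
    have h3 : (48 * b * δ + 20 * b * μ * δ ^ 3 + 32 * b ^ 2 * M) * N + 32 * b ^ 2 * δ ^ 2 * G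
        ≤ (48 * b * 1 + 20 * b * μ * 1 + 32 * b ^ 2 * M) * N + 32 * b ^ 2 * 1 * G := by
      have : δ ^ 3 ≤ 1 := pow_le_one₀ hδ.le hδ1
      gcongr
    have h4 : ((48 * b + 32 * b ^ 2 * M) * N + 32 * b ^ 2 * G) * 1
        ≤ ((48 * b + 32 * b ^ 2 * M) * N + 32 * b ^ 2 * G) * (8 * b ^ 2 * μ) := by gcongr
    have h5 : μ * (δ ^ 2 * VJ) ≤ μ * (K₁ * N + 256 * b ^ 4 * G) := by
      have := mul_le_mul_of_nonneg_left hVJ (sq_nonneg δ)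
      rw [hK₁]
      linarith
    have h6 := le_of_mul_le_mul_left h5 hμ0
    have h7 := mul_le_mul_of_nonneg_left (hV.trans (add_le_add_right
      (mul_le_mul_of_nonneg_left hNw (sq_nonneg δ)) _)) (sq_nonneg δ)
    have h8 : δ ^ 2 * (δ ^ 2 * N) ≤ 1 * (1 * N) := by gcongr
    have h9 : 0 ≤ b ^ 2 * N := by positivity
    linarith
  set K₂ : ℝ := K₁ + 1 + 8 * b ^ 2
  have hyoung : K₂ * ∫ x in Icc (-b) b, ‖g x‖ * ‖v x‖
      ≤ δ ^ 2 / 2 * (∫ x in Icc (-b) b, ‖v x‖ ^ 2)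
        + K₂ ^ 2 / (2 * δ ^ 2) * ∫ x in Icc (-b) b, ‖g x‖ ^ 2 := by
    rw [← integral_const_mul, ← integral_const_mul, ← integral_const_mul,
      ← integral_add (hvv.const_mul _) (hg2.const_mul _)]
    refine setIntegral_mono_on (hgv.const_mul _) ((hvv.const_mul _).add (hg2.const_mul _))
      measurableSet_Icc fun x _ => ?_
    have h1 : δ ^ 2 / 2 * ‖v x‖ ^ 2 + K₂ ^ 2 / (2 * δ ^ 2) * ‖g x‖ ^ 2 - K₂ * (‖g x‖ * ‖v x‖)
        = 2⁻¹ * (δ * ‖v x‖ - K₂ / δ * ‖g x‖) ^ 2 := by field_simp; ring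
    have h2 : 0 ≤ 2⁻¹ * (δ * ‖v x‖ - K₂ / δ * ‖g x‖) ^ 2 := by positivity
    linarith
  generalize (∫ x in Icc (-b) b, ‖g x‖ ^ 2) = G at *
  generalize (∫ x in Icc (-b) b, ‖v x‖ ^ 2) = V at *
  have h1 : δ ^ 2 / 2 * V ≤ K₂ ^ 2 / (2 * δ ^ 2) * G + 256 * b ^ 4 * G := by linarith
  have h2 := mul_le_mul_of_nonneg_left h1 (by positivity : 0 ≤ 2 * δ ^ 2)
  have h3 : 2 * δ ^ 2 * (K₂ ^ 2 / (2 * δ ^ 2) * G + 256 * b ^ 4 * G)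
      = K₂ ^ 2 * G + 512 * b ^ 4 * (δ ^ 2 * G) := by field_simp; ring
  have h4 : 512 * b ^ 4 * (δ ^ 2 * G) ≤ 512 * b ^ 4 * (1 * G) := by gcongr
  linarith

/-- Parseval's identity for the sine system on `[0, L]`. -/
theorem hasSum_sq_sine_coeff_zero {L : ℝ} (hL : 0 < L) {g : ℝ → ℂ}
    (hg : ContinuousOn g (Icc 0 L)) :
    HasSum (fun n : ℤ => ‖∫ y in 0..L, ((Real.sin (Real.pi * n * y / L) : ℝ) : ℂ) * g y‖ ^ 2)
      (L * ∫ y in 0..L, ‖g y‖ ^ 2) := by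
  set G : ℝ → ℂ := fun y => if 0 ≤ y then g y else -g (-y) with hG
  have hneg : ContinuousOn (fun y => -g (-y)) (Icc (-L) 0) :=
    (hg.comp continuousOn_neg fun y hy => ⟨by linarith [hy.2], by linarith [hy.1]⟩).neg
  have hGr : EqOn G g (Icc 0 L) := fun y hy => if_pos hy.1
  have hGl : EqOn G (fun y => -g (-y)) (Ioo (-L) 0) := fun y hy => if_neg (not_le.2 hy.2)
  have hLL : -L < L := by linarith
  have hmem : MemLp G 2 (volume.restrict (Ioc (-L) L)) := by
    obtain ⟨C, hC⟩ := isCompact_Icc.exists_bound_of_continuousOn hg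
    have hm : AEStronglyMeasurable G (volume.restrict (Ioc (-L) L)) := by
      have hu : Ioc (-L) L = Ioo (-L) 0 ∪ Icc 0 L := by
        ext y; simp only [mem_Ioc, mem_union, mem_Ioo, mem_Icc]
        constructor
        · rintro ⟨h1, h2⟩
          rcases lt_or_ge y 0 with h | h
          · exact Or.inl ⟨h1, h⟩
          · exact Or.inr ⟨h, h2⟩
        · rintro (⟨h1, h2⟩ | ⟨h1, h2⟩) <;> constructor <;> linarith
      rw [hu, aestronglyMeasurable_union_iff]
      exact ⟨((hneg.mono Ioo_subset_Icc_self).congr hGl).aestronglyMeasurable measurableSet_Ioo,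
        (hg.congr hGr).aestronglyMeasurable measurableSet_Icc⟩
    refine MemLp.of_bound hm C ?_
    filter_upwards [ae_restrict_mem measurableSet_Ioc] with y hy
    by_cases h : 0 ≤ y
    · simp only [hG, if_pos h]
      exact hC y ⟨h, hy.2⟩
    · simp only [hG, if_neg h, norm_neg]
      exact hC (-y) ⟨by linarith, by linarith [hy.1]⟩
  have hsplit : ∀ {E : Type} [NormedAddCommGroup E] [NormedSpace ℝ E] (F Fl Fr : ℝ → E),
      EqOn F Fr (Icc 0 L) → EqOn F (fun y => Fl (-y)) (Ioo (-L) 0) →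
      ContinuousOn Fr (Icc 0 L) → ContinuousOn Fl (Icc 0 L) →
      ∫ y in (-L)..L, F y = ∫ y in 0..L, (Fl y + Fr y) := by
    intro E _ _ F Fl Fr hr hl hcr hcl
    have hcl' : ContinuousOn (fun y => Fl (-y)) (Icc (-L) 0) :=
      hcl.comp continuousOn_neg fun y hy => ⟨by linarith [hy.2], by linarith [hy.1]⟩
    have hIl : IntervalIntegrable (fun y => Fl (-y)) volume (-L) 0 :=
      hcl'.intervalIntegrable_of_Icc (by linarith)
    have hIr : IntervalIntegrable Fr volume 0 L := hcr.intervalIntegrable_of_Icc hL.le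
    have hae : F =ᵐ[volume.restrict (uIoc (-L) 0)] fun y => Fl (-y) := by
      rw [uIoc_of_le (by linarith : -L ≤ 0), ← restrict_Ioo_eq_restrict_Ioc]
      filter_upwards [ae_restrict_mem measurableSet_Ioo] with y hy using hl hy
    have her : EqOn F Fr (uIcc 0 L) := by rwa [uIcc_of_le hL.le]
    rw [← intervalIntegral.integral_add_adjacent_intervals (b := 0)
      (hIl.congr_ae hae.symm) (hIr.congr (her.symm.mono uIoc_subset_uIcc)),
      intervalIntegral.integral_congr_ae_restrict hae,
      intervalIntegral.integral_congr her,
      intervalIntegral.integral_comp_neg, neg_neg, neg_zero,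
      intervalIntegral.integral_add (hcl.intervalIntegrable_of_Icc hL.le) hIr]
  have h := hasSum_sq_fourierCoeffOn hLL hmem
  have hsq : ∫ y in (-L)..L, ‖G y‖ ^ 2 = 2 * ∫ y in 0..L, ‖g y‖ ^ 2 := by
    rw [hsplit (fun y => ‖G y‖ ^ 2) (fun y => ‖g y‖ ^ 2) (fun y => ‖g y‖ ^ 2)
      (fun y hy => by simp only [hGr hy]) (fun y hy => by simp only [hGl hy, norm_neg])
      (hg.norm.pow 2) (hg.norm.pow 2), ← intervalIntegral.integral_const_mul]
    congr 1
    ext y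
    ring
  have hcoef : ∀ n : ℤ, ‖∫ y in 0..L, ((Real.sin (Real.pi * n * y / L) : ℝ) : ℂ) * g y‖ ^ 2
      = L ^ 2 * ‖fourierCoeffOn hLL G n‖ ^ 2 := by
    intro n
    set ε : ℝ → ℂ := fun y => Complex.exp (-(Real.pi * n * y / L : ℝ) * Complex.I) with hε
    have hεc : Continuous ε := by fun_prop
    have hf : ∀ y : ℝ, fourier (-n) (y : AddCircle (L - -L)) = ε y := by
      intro y
      rw [fourier_coe_apply]
      simp only [hε]
      congr 1
      push_cast
      have : (L : ℂ) ≠ 0 := by exact_mod_cast hL.ne'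
      field_simp
      ring
    have hε2 : ∀ y, -ε (-y) + ε y = -2 * Complex.I * ((Real.sin (Real.pi * n * y / L) : ℝ) : ℂ) := by
      intro y
      have e1 : ((Real.pi * n * -y / L : ℝ) : ℂ) = -((Real.pi * n * y / L : ℝ) : ℂ) := by
        push_cast; ring
      simp only [hε]
      rw [e1, neg_neg, Complex.ofReal_sin, Complex.sin]
      linear_combination (Complex.exp (-((Real.pi * n * y / L : ℝ) : ℂ) * Complex.I)
        - Complex.exp (((Real.pi * n * y / L : ℝ) : ℂ) * Complex.I)) * Complex.I_sq
    rw [fourierCoeffOn_eq_integral]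
    simp only [hf, smul_eq_mul]
    rw [hsplit (fun y => ε y * G y) (fun y => -(ε (-y) * g y)) (fun y => ε y * g y)
      (fun y hy => by simp only [hGr hy]) (fun y hy => by simp only [hGl hy, neg_neg]; ring)
      (hεc.continuousOn.mul hg) (((hεc.comp continuous_neg).continuousOn.mul hg).neg)]
    have e2 : ∀ y, -(ε (-y) * g y) + ε y * g y
        = -2 * Complex.I * (((Real.sin (Real.pi * n * y / L) : ℝ) : ℂ) * g y) := by
      intro y
      rw [← mul_assoc, ← hε2]
      ring
    simp only [e2]
    rw [intervalIntegral.integral_const_mul, norm_smul, norm_mul, norm_mul, Complex.norm_I,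
      Real.norm_of_nonneg (by positivity)]
    simp only [norm_neg, Complex.norm_ofNat]
    have : L ≠ 0 := hL.ne'
    field_simp
    ring
  simp only [hcoef]
  have h' := h.mul_left (L ^ 2)
  have hval : L ^ 2 * ((L - -L)⁻¹ • (2 * ∫ y in 0..L, ‖g y‖ ^ 2)) = L * ∫ y in 0..L, ‖g y‖ ^ 2 := by
    rw [smul_eq_mul]
    field_simp
    ring
  rwa [hsq, hval] at h'

/-- Parseval's identity for the Dirichlet sine system on `[-b, b]`. -/
theorem hasSum_sq_sine_coeff {b : ℝ} (hb : 0 < b) {g : ℝ → ℂ} (hg : ContinuousOn g (Icc (-b) b)) :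
    HasSum (fun n : ℤ => ‖∫ y in Icc (-b) b,
        ((Real.sin (Real.pi * n / (2 * b) * (y + b)) : ℝ) : ℂ) * g y‖ ^ 2)
      (2 * b * ∫ y in Icc (-b) b, ‖g y‖ ^ 2) := by
  have h := hasSum_sq_sine_coeff_zero (L := 2 * b) (by linarith) (g := fun z => g (z - b))
    (hg.comp (continuous_sub_right b).continuousOn
      fun z hz => ⟨by linarith [hz.1], by linarith [hz.2]⟩)
  have hshift : ∀ {E : Type} [NormedAddCommGroup E] [NormedSpace ℝ E] (F : ℝ → E),
      ∫ y in Icc (-b) b, F y = ∫ z in 0..2 * b, F (z - b) := by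
    intro E _ _ F
    rw [intervalIntegral.integral_comp_sub_right, integral_Icc_eq_integral_Ioc,
      intervalIntegral.integral_of_le (by linarith)]
    congr 3 <;> ring
  rw [hshift]
  convert h using 1
  ext n
  rw [hshift]
  congr 3
  ext z
  congr 3
  field_simp
  ring

/-- Comparison of integrals of sums of nonnegative functions from a termwise comparison. -/
theorem integral_le_of_hasSum {α ι : Type*} [Countable ι] [MeasurableSpace α] {ν : Measure α}
    {A B : ι → α → ℝ} {U F : α → ℝ} {K : ℝ} (hK : 0 ≤ K)
    (hA : ∀ n, Integrable (A n) ν) (hB : ∀ n, Integrable (B n) ν)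
    (hA0 : ∀ n x, 0 ≤ A n x) (hB0 : ∀ n x, 0 ≤ B n x)
    (hU : ∀ᵐ x ∂ν, HasSum (fun n => A n x) (U x)) (hF : ∀ᵐ x ∂ν, HasSum (fun n => B n x) (F x))
    (hFi : Integrable F ν) (hAB : ∀ n, ∫ x, A n x ∂ν ≤ K * ∫ x, B n x ∂ν) :
    ∫ x, U x ∂ν ≤ K * ∫ x, F x ∂ν := by
  have hfin : ∀ s : Finset ι, ∑ n ∈ s, ∫ x, A n x ∂ν ≤ K * ∫ x, F x ∂ν := by
    intro s
    refine (Finset.sum_le_sum fun n _ => hAB n).trans ?_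
    rw [← Finset.mul_sum, ← integral_finsetSum _ fun n _ => hB n]
    refine mul_le_mul_of_nonneg_left ?_ hK
    refine integral_mono_ae (integrable_finsetSum _ fun n _ => hB n) hFi ?_
    filter_upwards [hF] with x hx
    exact sum_le_hasSum s (fun n _ => hB0 n x) hx
  have hAn : ∀ n, ∫ x, ‖A n x‖ ∂ν = ∫ x, A n x ∂ν := fun n =>
    integral_congr_ae (Filter.Eventually.of_forall fun x => Real.norm_of_nonneg (hA0 n x))
  have hsum : Summable fun n => ∫ x, ‖A n x‖ ∂ν := by
    simp only [hAn]
    exact summable_of_sum_le (fun n => integral_nonneg (hA0 n)) hfin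
  have h := hasSum_integral_of_summable_integral_norm hA hsum
  have hUe : ∫ x, U x ∂ν = ∫ x, ∑' n, A n x ∂ν :=
    integral_congr_ae (hU.mono fun x hx => hx.tsum_eq.symm)
  rw [hUe, ← h.tsum_eq]
  exact h.summable.tsum_le_of_sum_le hfin

theorem continuousOn_slice_right {E : Type*} [TopologicalSpace E] {s t : Set ℝ} {f : ℝ × ℝ → E}
    (hf : ContinuousOn f (s ×ˢ t)) {x : ℝ} (hx : x ∈ s) : ContinuousOn (fun y => f (x, y)) t :=
  hf.comp (Continuous.prodMk_right x).continuousOn fun _ hy => ⟨hx, hy⟩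

theorem continuousOn_slice_left {E : Type*} [TopologicalSpace E] {s t : Set ℝ} {f : ℝ × ℝ → E}
    (hf : ContinuousOn f (s ×ˢ t)) {y : ℝ} (hy : y ∈ t) : ContinuousOn (fun x => f (x, y)) s :=
  hf.comp (Continuous.prodMk_left y).continuousOn fun _ hx => ⟨hx, hy⟩

/-- Integrating a continuous function over vertical slices gives a continuous function. -/
theorem continuousOn_integral_slice {b : ℝ} {φ : ℝ → ℂ} (hφ : Continuous φ) {f : ℝ × ℝ → ℂ}
    (hf : ContinuousOn f (Icc (-b) b ×ˢ Icc (-b) b)) :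
    ContinuousOn (fun x => ∫ y in Icc (-b) b, φ y * f (x, y)) (Icc (-b) b) := by
  have hF : ContinuousOn (fun p : ℝ × ℝ => φ p.2 * f p) (Icc (-b) b ×ˢ Icc (-b) b) :=
    (hφ.comp continuous_snd).continuousOn.mul hf
  obtain ⟨C, hC⟩ := (isCompact_Icc.prod isCompact_Icc).exists_bound_of_continuousOn hF
  refine MeasureTheory.continuousOn_of_dominated (bound := fun _ => C) (fun x hx => ?_)
    (fun x hx => ?_) (integrable_const _) ?_
  · exact (continuousOn_slice_right hF hx).aestronglyMeasurable measurableSet_Icc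
  · filter_upwards [ae_restrict_mem measurableSet_Icc] with y hy using hC (x, y) ⟨hx, hy⟩
  · filter_upwards [ae_restrict_mem measurableSet_Icc] with y hy using continuousOn_slice_left hF hy

/-- Differentiation under the integral sign over vertical slices. -/
theorem hasDerivAt_integral_slice {b : ℝ} {φ : ℝ → ℂ} (hφ : Continuous φ) {f f' : ℝ × ℝ → ℂ}
    (hf : ContinuousOn f (Icc (-b) b ×ˢ Icc (-b) b))
    (hf' : ContinuousOn f' (Icc (-b) b ×ˢ Icc (-b) b))
    (hd : ∀ p ∈ Icc (-b) b ×ˢ Icc (-b) b,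
      HasDerivWithinAt (fun s => f (s, p.2)) (f' p) (Icc (-b) b) p.1)
    {x : ℝ} (hx : x ∈ Ioo (-b) b) :
    HasDerivAt (fun x => ∫ y in Icc (-b) b, φ y * f (x, y))
      (∫ y in Icc (-b) b, φ y * f' (x, y)) x := by
  have hF : ContinuousOn (fun p : ℝ × ℝ => φ p.2 * f p) (Icc (-b) b ×ˢ Icc (-b) b) :=
    (hφ.comp continuous_snd).continuousOn.mul hf
  have hF' : ContinuousOn (fun p : ℝ × ℝ => φ p.2 * f' p) (Icc (-b) b ×ˢ Icc (-b) b) :=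
    (hφ.comp continuous_snd).continuousOn.mul hf'
  obtain ⟨C, hC⟩ := (isCompact_Icc.prod isCompact_Icc).exists_bound_of_continuousOn hF'
  have hs := Ioo_mem_nhds hx.1 hx.2
  refine (hasDerivAt_integral_of_dominated_loc_of_deriv_le (bound := fun _ => C)
    (F := fun x y => φ y * f (x, y)) (F' := fun x y => φ y * f' (x, y)) hs ?_ ?_ ?_ ?_
    (integrable_const _) ?_).2
  · filter_upwards [hs] with z hz
    exact (continuousOn_slice_right hF (Ioo_subset_Icc_self hz)).aestronglyMeasurable
      measurableSet_Icc
  · exact (continuousOn_slice_right hF (Ioo_subset_Icc_self hx)).integrableOn_compact isCompact_Icc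
  · exact (continuousOn_slice_right hF' (Ioo_subset_Icc_self hx)).aestronglyMeasurable
      measurableSet_Icc
  · filter_upwards [ae_restrict_mem measurableSet_Icc] with y hy z hz
    exact hC (z, y) ⟨Ioo_subset_Icc_self hz, hy⟩
  · filter_upwards [ae_restrict_mem measurableSet_Icc] with y hy z hz
    exact ((hd (z, y) ⟨Ioo_subset_Icc_self hz, hy⟩).hasDerivAt
      (Icc_mem_nhds hz.1 hz.2)).const_mul (φ y)

/-- Sine coefficients of the second derivative of a function vanishing at the endpoints. -/
theorem integral_sin_mul_second_deriv {b : ℝ} (hb : 0 < b) (n : ℤ) {h h1 h2 : ℝ → ℂ}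
    (hc : ContinuousOn h (Icc (-b) b)) (hc1 : ContinuousOn h1 (Icc (-b) b))
    (hc2 : ContinuousOn h2 (Icc (-b) b))
    (hd : ∀ y ∈ Ioo (-b) b, HasDerivAt h (h1 y) y)
    (hd1 : ∀ y ∈ Ioo (-b) b, HasDerivAt h1 (h2 y) y) (hl : h (-b) = 0) (hr : h b = 0) :
    ∫ y in Icc (-b) b, ((Real.sin (Real.pi * n / (2 * b) * (y + b)) : ℝ) : ℂ) * h2 y
      = -((Real.pi * n / (2 * b)) ^ 2 : ℝ) *
        ∫ y in Icc (-b) b, ((Real.sin (Real.pi * n / (2 * b) * (y + b)) : ℝ) : ℂ) * h y := by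
  set l : ℝ := Real.pi * n / (2 * b) with hl_def
  set S : ℝ → ℂ := fun y => ((Real.sin (l * (y + b)) : ℝ) : ℂ) with hS
  set T : ℝ → ℂ := fun y => ((l * Real.cos (l * (y + b)) : ℝ) : ℂ) with hT
  have hSc : Continuous S := by fun_prop
  have hTc : Continuous T := by fun_prop
  have hlin : ∀ y, HasDerivAt (fun y : ℝ => l * (y + b)) l y := fun y => by
    simpa using ((hasDerivAt_id y).add_const b).const_mul l
  have hSd : ∀ y, HasDerivAt S (T y) y := fun y => by
    have h := ((hlin y).sin).ofReal_comp
    rwa [mul_comm] at h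
  have hTd : ∀ y, HasDerivAt T (-(l ^ 2 : ℝ) * S y) y := fun y => by
    have h := (((hlin y).cos).const_mul l).ofReal_comp
    refine h.congr_deriv ?_
    simp only [hS]
    push_cast
    ring
  have hS1 : S (-b) = 0 := by simp [hS]
  have hS2 : S b = 0 := by
    have : l * (b + b) = n * Real.pi := by rw [hl_def]; field_simp; ring
    simp [hS, this, Real.sin_int_mul_pi, -Complex.ofReal_sin]
  have hder : ∀ y ∈ Ioo (-b) b, HasDerivAt (fun y => S y * h1 y - T y * h y)
      (S y * h2 y + (l ^ 2 : ℝ) * (S y * h y)) y := fun y hy =>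
    (((hSd y).mul (hd1 y hy)).sub ((hTd y).mul (hd y hy))).congr_deriv (by ring)
  have hi2 : IntegrableOn (fun y => S y * h2 y) (Icc (-b) b) :=
    (hSc.continuousOn.mul hc2).integrableOn_compact isCompact_Icc
  have hi0 : IntegrableOn (fun y => S y * h y) (Icc (-b) b) :=
    (hSc.continuousOn.mul hc).integrableOn_compact isCompact_Icc
  have key := intervalIntegral.integral_eq_sub_of_hasDerivAt_of_le (by linarith : -b ≤ b)
    ((hSc.continuousOn.mul hc1).sub (hTc.continuousOn.mul hc)) hder
    (((hSc.continuousOn.mul hc2).add (continuousOn_const.mul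
      (hSc.continuousOn.mul hc))).intervalIntegrable_of_Icc (by linarith))
  rw [intervalIntegral.integral_of_le (by linarith), ← integral_Icc_eq_integral_Ioc,
    integral_add hi2 (hi0.const_mul _), integral_const_mul] at key
  simp only [Pi.sub_apply, Pi.mul_apply, hS1, hS2, hl, hr] at key
  simp only [zero_mul, mul_zero, sub_zero] at key
  linear_combination key

/-- The resolvent estimate on the square in terms of the boundary layer width `δ`. -/
theorem integral_sq_le_of_damped_square {b a δ q M : ℝ} (ha : 0 ≤ a) (hδ : 0 < δ) (hδ1 : δ ≤ 1)
    (hab : a + 4 * δ ≤ b) {W : ℝ → ℝ} (hWm : Measurable W) {B : ℝ} (hWB : ∀ x, |W x| ≤ B)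
    (hW0 : ∀ x ∈ Icc (-b) b, 0 ≤ W x)
    (hWM : ∀ x ∈ Icc (-b) b, |x| ≤ a + 3 * δ → δ ^ 2 * (|q| * W x) ≤ M)
    (hWl : ∀ x ∈ Icc (-b) b, a + δ ≤ |x| → 1 ≤ δ ^ 2 * (|q| * W x))
    {u ux uy uxx uyy f : ℝ × ℝ → ℂ}
    (hux : ∀ p ∈ Icc (-b) b ×ˢ Icc (-b) b,
      HasDerivWithinAt (fun s => u (s, p.2)) (ux p) (Icc (-b) b) p.1)
    (huxx : ∀ p ∈ Icc (-b) b ×ˢ Icc (-b) b,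
      HasDerivWithinAt (fun s => ux (s, p.2)) (uxx p) (Icc (-b) b) p.1)
    (huy : ∀ p ∈ Icc (-b) b ×ˢ Icc (-b) b,
      HasDerivWithinAt (fun t => u (p.1, t)) (uy p) (Icc (-b) b) p.2)
    (huyy : ∀ p ∈ Icc (-b) b ×ˢ Icc (-b) b,
      HasDerivWithinAt (fun t => uy (p.1, t)) (uyy p) (Icc (-b) b) p.2)
    (hu : ContinuousOn u (Icc (-b) b ×ˢ Icc (-b) b))
    (hcx : ContinuousOn ux (Icc (-b) b ×ˢ Icc (-b) b))
    (hcy : ContinuousOn uy (Icc (-b) b ×ˢ Icc (-b) b))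
    (hcxx : ContinuousOn uxx (Icc (-b) b ×ˢ Icc (-b) b))
    (hcyy : ContinuousOn uyy (Icc (-b) b ×ˢ Icc (-b) b))
    (hbd : ∀ p ∈ Icc (-b) b ×ˢ Icc (-b) b, (|p.1| = b ∨ |p.2| = b) → u p = 0)
    (hf : ∀ p, f p = -(uxx p + uyy p) + Complex.I * (q : ℂ) * ((W p.1 : ℝ) : ℂ) * u p
      - (q : ℂ) ^ 2 * u p) :
    δ ^ 4 * ∫ p in Icc (-b) b ×ˢ Icc (-b) b, ‖u p‖ ^ 2
      ≤ (((48 * b + 32 * b ^ 2 * M) * (8 * b ^ 2) + 20 * b + 1 + 8 * b ^ 2) ^ 2 + 512 * b ^ 4)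
        * ∫ p in Icc (-b) b ×ˢ Icc (-b) b, ‖f p‖ ^ 2 := by
  have hb : 0 < b := by linarith
  set K : ℝ :=
    ((48 * b + 32 * b ^ 2 * M) * (8 * b ^ 2) + 20 * b + 1 + 8 * b ^ 2) ^ 2 + 512 * b ^ 4
  have hK : 0 ≤ K := by positivity
  have hQm : MeasurableSet (Icc (-b) b ×ˢ Icc (-b) b) := measurableSet_Icc.prod measurableSet_Icc
  have hQc : IsCompact (Icc (-b) b ×ˢ Icc (-b) b) := isCompact_Icc.prod isCompact_Icc
  have hbb : -b ≤ b := by linarith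
  have hmem_l : -b ∈ Icc (-b) b := left_mem_Icc.2 hbb
  have hmem_r : b ∈ Icc (-b) b := right_mem_Icc.2 hbb
  obtain ⟨s, hs, hsq⟩ : ∃ s : ℝ, (s = 1 ∨ s = -1) ∧ s * |q| = q := by
    rcases le_total 0 q with h | h
    · exact ⟨1, Or.inl rfl, by rw [one_mul, abs_of_nonneg h]⟩
    · exact ⟨-1, Or.inr rfl, by rw [abs_of_nonpos h]; ring⟩
  have hWi : IntegrableOn (fun x => |q| * W x) (Icc (-b) b) :=
    (Measure.integrableOn_of_bounded (s := Icc (-b) b) (M := B) (by simp)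
      hWm.aestronglyMeasurable (Filter.Eventually.of_forall hWB)).const_mul _
  obtain ⟨Cf, hCf⟩ : ∃ C, ∀ p ∈ Icc (-b) b ×ˢ Icc (-b) b, ‖f p‖ ≤ C := by
    obtain ⟨C1, hC1⟩ := hQc.exists_bound_of_continuousOn
      ((hcxx.add hcyy).neg.sub (continuousOn_const (c := (q : ℂ) ^ 2) |>.mul hu))
    obtain ⟨C2, hC2⟩ := hQc.exists_bound_of_continuousOn hu
    refine ⟨C1 + |q| * B * C2, fun p hp => ?_⟩
    have h1 : f p = (-(uxx p + uyy p) - (q : ℂ) ^ 2 * u p)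
        + Complex.I * (q : ℂ) * ((W p.1 : ℝ) : ℂ) * u p := by rw [hf]; ring
    rw [h1]
    refine (norm_add_le _ _).trans (add_le_add (hC1 p hp) ?_)
    rw [norm_mul, norm_mul, norm_mul, Complex.norm_I, one_mul, Complex.norm_real,
      Complex.norm_real, Real.norm_eq_abs, Real.norm_eq_abs]
    have hB0 : 0 ≤ B := (abs_nonneg _).trans (hWB 0)
    gcongr
    · exact hWB p.1
    · exact hC2 p hp
  have hfm : AEStronglyMeasurable f (volume.restrict (Icc (-b) b ×ˢ Icc (-b) b)) := by
    have hfe : f = fun p => -(uxx p + uyy p) + Complex.I * (q : ℂ) * ((W p.1 : ℝ) : ℂ) * u p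
      - (q : ℂ) ^ 2 * u p := funext hf
    have m1 := hu.aestronglyMeasurable (μ := volume) hQm
    have m2 := hcxx.aestronglyMeasurable (μ := volume) hQm
    have m3 := hcyy.aestronglyMeasurable (μ := volume) hQm
    have m4 : AEStronglyMeasurable (fun p : ℝ × ℝ => Complex.I * (q : ℂ) * ((W p.1 : ℝ) : ℂ))
        (volume.restrict (Icc (-b) b ×ˢ Icc (-b) b)) :=
      ((Complex.measurable_ofReal.comp (hWm.comp measurable_fst)).const_mul _).aestronglyMeasurable
    rw [hfe]
    exact ((m2.add m3).neg.add (m4.mul m1)).sub (m1.const_mul _)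
  have hfi : IntegrableOn (fun p => ‖f p‖ ^ 2) (Icc (-b) b ×ˢ Icc (-b) b) := by
    have : IsFiniteMeasure (volume.restrict (Icc (-b) b ×ˢ Icc (-b) b)) :=
      isFiniteMeasure_restrict.2 hQc.measure_lt_top.ne
    refine Integrable.of_bound (hfm.norm.pow 2) (Cf ^ 2) ?_
    filter_upwards [ae_restrict_mem hQm] with p hp
    rw [Real.norm_of_nonneg (by positivity)]
    exact pow_le_pow_left₀ (norm_nonneg _) (hCf p hp) 2
  have hui : IntegrableOn (fun p => ‖u p‖ ^ 2) (Icc (-b) b ×ˢ Icc (-b) b) :=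
    (hu.norm.pow 2).integrableOn_compact hQc
  have hfslice : ∀ x ∈ Icc (-b) b, ContinuousOn (fun y => f (x, y)) (Icc (-b) b) := by
    intro x hx
    have hfe : (fun y => f (x, y)) = fun y => -(uxx (x, y) + uyy (x, y))
        + Complex.I * (q : ℂ) * ((W x : ℝ) : ℂ) * u (x, y) - (q : ℂ) ^ 2 * u (x, y) :=
      funext fun y => hf (x, y)
    rw [hfe]
    have c1 := continuousOn_slice_right hu hx
    have c2 := continuousOn_slice_right hcxx hx
    have c3 := continuousOn_slice_right hcyy hx
    exact ((c2.add c3).neg.add (continuousOn_const.mul c1)).sub (continuousOn_const.mul c1)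
  set S : ℤ → ℝ → ℂ := fun n y => ((Real.sin (Real.pi * n / (2 * b) * (y + b)) : ℝ) : ℂ) with hS
  have hSc : ∀ n, Continuous (S n) := fun n => by fun_prop
  set v : ℤ → ℝ → ℂ := fun n x => ∫ y in Icc (-b) b, S n y * u (x, y) with hv
  set v1 : ℤ → ℝ → ℂ := fun n x => ∫ y in Icc (-b) b, S n y * ux (x, y) with hv1
  set v2 : ℤ → ℝ → ℂ := fun n x => ∫ y in Icc (-b) b, S n y * uxx (x, y) with hv2
  set g : ℤ → ℝ → ℂ := fun n x => ∫ y in Icc (-b) b, S n y * f (x, y) with hg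
  have hvc : ∀ n, ContinuousOn (v n) (Icc (-b) b) := fun n => continuousOn_integral_slice (hSc n) hu
  have hv2c : ∀ n, ContinuousOn (v2 n) (Icc (-b) b) :=
    fun n => continuousOn_integral_slice (hSc n) hcxx
  have heq : ∀ n, ∀ x ∈ Icc (-b) b, v2 n x = Complex.I * ((s * (|q| * W x) : ℝ) : ℂ) * v n x
      - ((q ^ 2 - (Real.pi * n / (2 * b)) ^ 2 : ℝ) : ℂ) * v n x - g n x := by
    intro n x hx
    have hyy := integral_sin_mul_second_deriv hb n (continuousOn_slice_right hu hx)
      (continuousOn_slice_right hcy hx) (continuousOn_slice_right hcyy hx)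
      (fun y hy => (huy (x, y) ⟨hx, Ioo_subset_Icc_self hy⟩).hasDerivAt
        (Icc_mem_nhds hy.1 hy.2))
      (fun y hy => (huyy (x, y) ⟨hx, Ioo_subset_Icc_self hy⟩).hasDerivAt
        (Icc_mem_nhds hy.1 hy.2))
      (hbd _ ⟨hx, hmem_l⟩ (Or.inr (by rw [abs_neg, abs_of_pos hb])))
      (hbd _ ⟨hx, hmem_r⟩ (Or.inr (abs_of_pos hb)))
    have hi : ∀ {F : ℝ × ℝ → ℂ}, ContinuousOn F (Icc (-b) b ×ˢ Icc (-b) b) →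
        IntegrableOn (fun y => S n y * F (x, y)) (Icc (-b) b) := fun hF =>
      ((hSc n).continuousOn.mul (continuousOn_slice_right hF hx)).integrableOn_compact
        isCompact_Icc
    have hgx : g n x = ∫ y in Icc (-b) b, ((Complex.I * (q : ℂ) * ((W x : ℝ) : ℂ) - (q : ℂ) ^ 2) *
        (S n y * u (x, y)) - S n y * uxx (x, y) - S n y * uyy (x, y)) := by
      simp only [hg]
      congr 1
      ext y
      rw [hf]
      ring
    have hi12 : IntegrableOn (fun y => (Complex.I * (q : ℂ) * ((W x : ℝ) : ℂ) - (q : ℂ) ^ 2) *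
        (S n y * u (x, y)) - S n y * uxx (x, y)) (Icc (-b) b) :=
      ((hi hu).const_mul _).sub (hi hcxx)
    rw [integral_sub hi12 (hi hcyy), integral_sub ((hi hu).const_mul _) (hi hcxx),
      integral_const_mul, hyy] at hgx
    rw [hgx, ← mul_assoc, hsq]
    simp only [hv, hv2, hS]
    push_cast
    ring
  have hgC : ∀ n, ∀ x ∈ Icc (-b) b, ‖g n x‖ ≤ Cf * (2 * b) := by
    intro n x hx
    have h1 : ‖∫ y in Icc (-b) b, S n y * f (x, y)‖ ≤ Cf * volume.real (Icc (-b) b) := by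
      refine norm_setIntegral_le_of_norm_le_const (by simp) fun y hy => ?_
      rw [norm_mul]
      have h2 : ‖S n y‖ ≤ 1 := by
        simp only [hS, Complex.norm_real]
        exact Real.abs_sin_le_one _
      calc ‖S n y‖ * ‖f (x, y)‖ ≤ 1 * ‖f (x, y)‖ := by gcongr
        _ ≤ Cf := by rw [one_mul]; exact hCf _ ⟨hx, hy⟩
    rwa [Real.volume_real_Icc_of_le hbb, show b - -b = 2 * b by ring] at h1
  have hgm : ∀ n, AEStronglyMeasurable (g n) (volume.restrict (Icc (-b) b)) := by
    intro n
    have m1 := (hvc n).aestronglyMeasurable (μ := volume) measurableSet_Icc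
    have m2 := (hv2c n).aestronglyMeasurable (μ := volume) measurableSet_Icc
    have m3 : AEStronglyMeasurable (fun x => Complex.I * ((s * (|q| * W x) : ℝ) : ℂ))
        (volume.restrict (Icc (-b) b)) :=
      ((Complex.measurable_ofReal.comp ((hWm.const_mul _).const_mul _)).const_mul
        _).aestronglyMeasurable
    refine (((m3.mul m1).sub (m1.const_mul
      ((q ^ 2 - (Real.pi * n / (2 * b)) ^ 2 : ℝ) : ℂ))).sub m2).congr ?_
    filter_upwards [ae_restrict_mem measurableSet_Icc] with x hx
    simp only [Pi.sub_apply, Pi.mul_apply, heq n x hx]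
    ring
  have hgi : ∀ n, IntegrableOn (g n) (Icc (-b) b) := fun n =>
    Integrable.of_bound (hgm n) (Cf * (2 * b))
      ((ae_restrict_mem measurableSet_Icc).mono fun x hx => hgC n x hx)
  have hgi2 : ∀ n, IntegrableOn (fun x => ‖g n x‖ ^ 2) (Icc (-b) b) := fun n =>
    Integrable.of_bound ((hgm n).norm.pow 2) ((Cf * (2 * b)) ^ 2)
      ((ae_restrict_mem measurableSet_Icc).mono fun x hx => by
        rw [Real.norm_of_nonneg (by positivity)]
        exact pow_le_pow_left₀ (norm_nonneg _) (hgC n x hx) 2)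
  have hmode : ∀ n, δ ^ 4 * ∫ x in Icc (-b) b, ‖v n x‖ ^ 2
      ≤ K * ∫ x in Icc (-b) b, ‖g n x‖ ^ 2 := fun n =>
    integral_sq_le_of_damped (μ := q ^ 2 - (Real.pi * n / (2 * b)) ^ 2) (v1 := v1 n)
      ha hδ hδ1 hab hs (hvc n) (continuousOn_integral_slice (hSc n) hcx) (hv2c n)
      (fun x hx => hasDerivAt_integral_slice (hSc n) hu hcx hux hx)
      (fun x hx => hasDerivAt_integral_slice (hSc n) hcx hcxx huxx hx)
      (setIntegral_eq_zero_of_forall_eq_zero fun y hy => by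
        rw [hbd _ ⟨hmem_l, hy⟩ (Or.inl (by rw [abs_neg, abs_of_pos hb])), mul_zero])
      (setIntegral_eq_zero_of_forall_eq_zero fun y hy => by
        rw [hbd _ ⟨hmem_r, hy⟩ (Or.inl (abs_of_pos hb)), mul_zero])
      (heq n) hWi (hgi n) (hgi2 n) (fun x hx => mul_nonneg (abs_nonneg q) (hW0 x hx)) hWM hWl
  have hsum := integral_le_of_hasSum (ν := volume.restrict (Icc (-b) b))
    (A := fun n x => ‖v n x‖ ^ 2) (B := fun n x => ‖g n x‖ ^ 2) (K := K / δ ^ 4)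
    (U := fun x => 2 * b * ∫ y in Icc (-b) b, ‖u (x, y)‖ ^ 2)
    (F := fun x => 2 * b * ∫ y in Icc (-b) b, ‖f (x, y)‖ ^ 2) (by positivity)
    (fun n => ((hvc n).norm.pow 2).integrableOn_compact isCompact_Icc) hgi2
    (fun _ _ => by positivity) (fun _ _ => by positivity)
    ((ae_restrict_mem measurableSet_Icc).mono fun x hx =>
      hasSum_sq_sine_coeff hb (continuousOn_slice_right hu hx))
    ((ae_restrict_mem measurableSet_Icc).mono fun x hx => hasSum_sq_sine_coeff hb (hfslice x hx))
    (by
      have h1 := hfi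
      rw [IntegrableOn, Measure.volume_eq_prod, ← Measure.prod_restrict] at h1
      exact h1.integral_prod_left.const_mul _)
    (fun n => by
      rw [div_mul_eq_mul_div, le_div_iff₀ (by positivity), mul_comm]
      exact hmode n)
  rw [Measure.volume_eq_prod] at hui hfi ⊢
  rw [setIntegral_prod _ hui, setIntegral_prod _ hfi]
  rw [integral_const_mul, integral_const_mul, mul_left_comm] at hsum
  have h1 := le_of_mul_le_mul_left hsum (by positivity)
  rwa [div_mul_eq_mul_div, le_div_iff₀ (by positivity), mul_comm] at h1

/-- Resolvent estimate for the stationary damped wave operator on the square `[-b,b]²`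
with damping `W(x,y) = W₀(|x|)` vanishing like `(|x|-a)^β` across the undamped strip:
`‖u‖_{L²} ≤ C |q|^{2/(β+2)} ‖-Δu + iqWu - q²u‖_{L²}` for all real `q` with `|q| ≥ q₀`.
The partial derivatives of `u` are encoded through the slice functions. -/
theorem stmt_18 (β a σ b c₀ : ℝ) (hβ : 0 < β) (ha : 0 < a) (hσ : 0 < σ)
    (hab : a + σ < b) (hc₀ : 0 < c₀)
    (W₀ : ℝ → ℝ) (hW₀meas : Measurable W₀) (hW₀bdd : ∃ M : ℝ, ∀ s : ℝ, |W₀ s| ≤ M)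
    (hW₀0 : ∀ s : ℝ, s ≤ a → W₀ s = 0)
    (hW₀1 : ∀ s : ℝ, a < s → s < a + σ → W₀ s = (s - a) ^ β)
    (hW₀2 : ∀ s : ℝ, a + σ ≤ s → s ≤ b → c₀ ≤ W₀ s) :
    ∃ C > (0:ℝ), ∃ q₀ > (0:ℝ), ∀ q : ℝ, q₀ ≤ |q| →
      ∀ u ux uy uxx uyy : ℝ × ℝ → ℂ,
        (∀ p ∈ Icc (-b) b ×ˢ Icc (-b) b,
          HasDerivWithinAt (fun s => u (s, p.2)) (ux p) (Icc (-b) b) p.1) →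
        (∀ p ∈ Icc (-b) b ×ˢ Icc (-b) b,
          HasDerivWithinAt (fun s => ux (s, p.2)) (uxx p) (Icc (-b) b) p.1) →
        (∀ p ∈ Icc (-b) b ×ˢ Icc (-b) b,
          HasDerivWithinAt (fun t => u (p.1, t)) (uy p) (Icc (-b) b) p.2) →
        (∀ p ∈ Icc (-b) b ×ˢ Icc (-b) b,
          HasDerivWithinAt (fun t => uy (p.1, t)) (uyy p) (Icc (-b) b) p.2) →
        ContinuousOn u (Icc (-b) b ×ˢ Icc (-b) b) →
        ContinuousOn ux (Icc (-b) b ×ˢ Icc (-b) b) →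
        ContinuousOn uy (Icc (-b) b ×ˢ Icc (-b) b) →
        ContinuousOn uxx (Icc (-b) b ×ˢ Icc (-b) b) →
        ContinuousOn uyy (Icc (-b) b ×ˢ Icc (-b) b) →
        (∀ p ∈ Icc (-b) b ×ˢ Icc (-b) b, (|p.1| = b ∨ |p.2| = b) → u p = 0) →
        Real.sqrt (∫ p in Icc (-b) b ×ˢ Icc (-b) b, ‖u p‖ ^ 2)
          ≤ C * |q| ^ (2 / (β + 2)) *
            Real.sqrt (∫ p in Icc (-b) b ×ˢ Icc (-b) b,
              ‖-(uxx p + uyy p) + Complex.I * (q : ℂ) * ((W₀ |p.1| : ℝ) : ℂ) * u p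
                - (q : ℂ) ^ 2 * u p‖ ^ 2) := by
  have hc₀β : 0 < c₀ ^ (1 / β) := Real.rpow_pos_of_pos hc₀ _
  have hβ2 : 0 < β + 2 := by linarith
  obtain ⟨B, hB⟩ := hW₀bdd
  set δ₀ : ℝ := min 1 (min (σ / 8) (c₀ ^ (1 / β))) with hδ₀
  have hδ₀pos : 0 < δ₀ := lt_min one_pos (lt_min (by linarith) hc₀β)
  set K : ℝ := ((48 * b + 32 * b ^ 2 * 3 ^ β) * (8 * b ^ 2) + 20 * b + 1 + 8 * b ^ 2) ^ 2
    + 512 * b ^ 4 with hK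
  have hb : 0 < b := by linarith
  have hKpos : 0 < K := by positivity
  refine ⟨√K, Real.sqrt_pos.2 hKpos, δ₀ ^ (-(β + 2)), Real.rpow_pos_of_pos hδ₀pos _, ?_⟩
  intro q hq u ux uy uxx uyy hux huxx huy huyy hu hcx hcy hcxx hcyy hbd
  have hqpos : 0 < |q| := lt_of_lt_of_le (Real.rpow_pos_of_pos hδ₀pos _) hq
  set δ : ℝ := |q| ^ (-(1 / (β + 2))) with hδ_def
  have hδ : 0 < δ := Real.rpow_pos_of_pos hqpos _
  have hδle : δ ≤ δ₀ := by
    have h := Real.rpow_le_rpow_of_nonpos (Real.rpow_pos_of_pos hδ₀pos _) hq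
      (by rw [neg_nonpos]; positivity : -(1 / (β + 2)) ≤ 0)
    rwa [← Real.rpow_mul hδ₀pos.le, show -(β + 2) * -(1 / (β + 2)) = 1 by field_simp,
      Real.rpow_one] at h
  have hδ1 : δ ≤ 1 := hδle.trans (min_le_left _ _)
  have hδσ : δ ≤ σ / 8 := hδle.trans ((min_le_right _ _).trans (min_le_left _ _))
  have hδc : δ ^ β ≤ c₀ := by
    have h := Real.rpow_le_rpow hδ.le
      (hδle.trans ((min_le_right _ _).trans (min_le_right _ _))) hβ.le
    rwa [← Real.rpow_mul hc₀.le, one_div_mul_cancel hβ.ne', Real.rpow_one] at h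
  have hscale : δ ^ 2 * (|q| * δ ^ β) = 1 := by
    have h1 : δ ^ (β + 2) = |q|⁻¹ := by
      rw [hδ_def, ← Real.rpow_mul hqpos.le, show -(1 / (β + 2)) * (β + 2) = -1 by field_simp,
        Real.rpow_neg_one]
    have h2 : δ ^ (β + 2) = δ ^ β * δ ^ 2 := by
      rw [Real.rpow_add hδ, Real.rpow_two]
    calc δ ^ 2 * (|q| * δ ^ β) = |q| * (δ ^ β * δ ^ 2) := by ring
      _ = 1 := by rw [← h2, h1, mul_inv_cancel₀ hqpos.ne']
  have hlow : ∀ x ∈ Icc (-b) b, a + δ ≤ |x| → δ ^ β ≤ W₀ |x| := by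
    intro x hx hax
    rcases lt_or_ge |x| (a + σ) with h | h
    · rw [hW₀1 _ (by linarith) h]
      exact Real.rpow_le_rpow hδ.le (by linarith) hβ.le
    · exact hδc.trans (hW₀2 _ h (abs_le.2 hx))
  have hnonneg : ∀ x ∈ Icc (-b) b, 0 ≤ W₀ |x| := by
    intro x hx
    rcases le_or_gt |x| a with h | h
    · exact (hW₀0 _ h).ge
    rcases lt_or_ge |x| (a + σ) with h' | h'
    · rw [hW₀1 _ h h']
      exact Real.rpow_nonneg (by linarith) _
    · exact hc₀.le.trans (hW₀2 _ h' (abs_le.2 hx))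
  have hupp : ∀ x : ℝ, |x| ≤ a + 3 * δ → W₀ |x| ≤ 3 ^ β * δ ^ β := by
    intro x hx
    rw [← Real.mul_rpow (by norm_num) hδ.le]
    rcases le_or_gt |x| a with h | h
    · rw [hW₀0 _ h]
      positivity
    · rw [hW₀1 _ h (by linarith)]
      exact Real.rpow_le_rpow (by linarith) (by linarith) hβ.le
  have hmain := integral_sq_le_of_damped_square (q := q) (M := 3 ^ β) ha.le hδ hδ1 (by linarith)
    (W := fun x => W₀ |x|) (hW₀meas.comp measurable_norm) (fun x => hB |x|) hnonneg
    (fun x _ hx' => by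
      calc δ ^ 2 * (|q| * W₀ |x|) ≤ δ ^ 2 * (|q| * (3 ^ β * δ ^ β)) := by
            gcongr
            exact hupp x hx'
        _ = 3 ^ β * (δ ^ 2 * (|q| * δ ^ β)) := by ring
        _ = 3 ^ β := by rw [hscale, mul_one])
    (fun x hx hx' => by
      rw [← hscale]
      gcongr
      exact hlow x hx hx')
    hux huxx huy huyy hu hcx hcy hcxx hcyy hbd (fun _ => rfl)
  have hpow : |q| ^ (2 / (β + 2)) = (δ ^ 2)⁻¹ := by
    rw [hδ_def, ← Real.rpow_two, ← Real.rpow_mul hqpos.le, ← Real.rpow_neg hqpos.le]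
    congr 1
    ring
  rw [hpow]
  refine Real.sqrt_le_iff.2 ⟨by positivity, ?_⟩
  rw [mul_pow, mul_pow, Real.sq_sqrt hKpos.le, Real.sq_sqrt (integral_nonneg fun p => by positivity)]
  rw [inv_pow, ← pow_mul, mul_assoc, mul_left_comm, inv_mul_eq_div, le_div_iff₀ (by positivity),
    mul_comm]
  exact hmain
end
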